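/- arXiv:1801.00706 — 3 statements merged into one kernel-verified Lean document; each statement's English description precedes it below -/
import Mathlib

section
/- Let η ∈ L^∞(−1,1) and let g(j) = ∫_{−1}^{1} η(μ) μ^j dμ for j = 0, 1, 2, …. Then the Hankel operator G in ℓ²(ℤ₊) with matrix elements g(j) is unitarily equivalent to the pseudodifferential operator A = v(X) s(D) v(X) in L²(ℝ), where v(x) = √π / √(cosh(πx)) and the sign-function is s(ξ) = η((2e^{−ξ} − 1)/(2e^{−ξ} + 1)). -/
noncomputable section
open MeasureTheory Filter Asymptotics Set

/-- Lebesgue measure restricted to `(0, ∞)`. -/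
abbrev muP : Measure ℝ := volume.restrict (Set.Ioi (0:ℝ))

/-- The Hilbert space `L²((0,∞))`. -/
abbrev HSp := Lp ℂ 2 muP

/-- The Hilbert space `L²(ℝ)`. -/
abbrev HLine := Lp ℂ 2 (volume : Measure ℝ)

/-- The Hilbert space `ℓ²(ℤ₊)`. -/
abbrev ellTwo := lp (fun _ : ℕ => ℂ) 2

/-- `H` is the Hankel operator with kernel `h` : `(Hu)(t) = ∫₀^∞ h(t+s) u(s) ds`. -/
def IsHankel (h : ℝ → ℂ) (H : HSp →L[ℂ] HSp) : Prop :=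
  ∀ u : HSp, ∀ᵐ t ∂muP, (H u : ℝ → ℂ) t = ∫ s in Set.Ioi (0:ℝ), h (t + s) * (u : ℝ → ℂ) s

/-- `G` is the discrete Hankel operator with matrix elements `g` :
`(Gu)(j) = ∑ₖ g(j+k) u(k)`. -/
def IsHankelD (g : ℕ → ℂ) (G : ellTwo →L[ℂ] ellTwo) : Prop :=
  ∀ u : ellTwo, ∀ j : ℕ, (G u : ℕ → ℂ) j = ∑' k : ℕ, g (j + k) * (u : ℕ → ℂ) k

/-- `λₙ⁺(K)`, the `n`-th positive eigenvalue (non-increasing, with multiplicity) of a compact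
self-adjoint operator `K`, expressed through the Courant–Fischer max-min principle
(the value is `0` if `K` has fewer than `n` positive eigenvalues). -/
def posEig {E : Type*} [NormedAddCommGroup E] [InnerProductSpace ℂ E]
    (K : E →L[ℂ] E) (n : ℕ) : ℝ :=
  ⨆ V : {V : Submodule ℂ E // Module.finrank ℂ V = n},
    ⨅ x : {x : E // x ∈ V.1 ∧ ‖x‖ = 1}, (@inner ℂ E _ (K x.1) x.1).re

/-- `λₙ⁻(K) = λₙ⁺(-K)`. -/
def negEig {E : Type*} [NormedAddCommGroup E] [InnerProductSpace ℂ E]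
    (K : E →L[ℂ] E) (n : ℕ) : ℝ := posEig (-K) n

/-- `sₙ(K)`, the `n`-th singular value of a compact operator `K`, via the max–min principle. -/
def singVal {E : Type*} [NormedAddCommGroup E] [InnerProductSpace ℂ E]
    (K : E →L[ℂ] E) (n : ℕ) : ℝ :=
  ⨆ V : {V : Submodule ℂ E // Module.finrank ℂ V = n},
    ⨅ x : {x : E // x ∈ V.1 ∧ ‖x‖ = 1}, ‖K x.1‖

/-- `N(α) = [α] + 1` if `α ≥ 1/2`, and `N(α) = 0` if `α < 1/2`. -/
def Nal (α : ℝ) : ℕ := if α < 1/2 then 0 else Nat.floor α + 1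

/-- The constant `τ(α) = 2^{-α} π^{1-2α} B(1/(2α), 1/2)^α`. -/
def tauC (α : ℝ) : ℝ :=
  (2:ℝ) ^ (-α) * Real.pi ^ (1 - 2*α) *
    (Real.Gamma (1/(2*α)) * Real.Gamma (1/2) / Real.Gamma (1/(2*α) + 1/2)) ^ α

/-- Iterated differences of a sequence: `g⁽⁰⁾ = g`, `g⁽ᵐ⁾(j) = g⁽ᵐ⁻¹⁾(j+1) - g⁽ᵐ⁻¹⁾(j)`. -/
def iterDiff {E : Type*} [Sub E] (g : ℕ → E) : ℕ → ℕ → E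
  | 0 => g
  | m + 1 => fun j => iterDiff g m (j + 1) - iterDiff g m j

/-- The standard function `v(x) = √π / √(cosh πx)`. -/
def vStd (x : ℝ) : ℝ := Real.sqrt Real.pi / Real.sqrt (Real.cosh (Real.pi * x))

/-- The Fourier transform `(Φw)(ξ) = (2π)^{-1/2} ∫ e^{-ixξ} w(x) dx`. -/
def fou (w : ℝ → ℂ) (ξ : ℝ) : ℂ :=
  (((2 * Real.pi) ^ (-(1:ℝ)/2) : ℝ) : ℂ) * ∫ x : ℝ, Complex.exp (-(Complex.I * x * ξ)) * w x

/-- `h ∈ L^∞_loc((0,∞))`. -/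
def LinftyLoc {E : Type*} [NormedAddCommGroup E] (h : ℝ → E) : Prop :=
  AEStronglyMeasurable h muP ∧
    ∀ K : Set ℝ, IsCompact K → K ⊆ Set.Ioi 0 → ∃ C, ∀ᵐ t ∂muP, t ∈ K → ‖h t‖ ≤ C

/-- The quadratic-form characterization of the pseudodifferential operator
`A = v(X) s(D) v(X)` on `L²(ℝ)`:  `⟪g, A f⟫ = ∫ conj((Φ(v·g))(ξ)) s(ξ) (Φ(v·f))(ξ) dξ`
for all `f, g` represented by smooth compactly supported functions. -/
def IsVSDV (v : ℝ → ℝ) (s : ℝ → ℂ) (A : HLine →L[ℂ] HLine) : Prop :=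
  ∀ (f g : HLine) (F G : ℝ → ℂ),
    ContDiff ℝ (⊤ : ℕ∞) F → HasCompactSupport F → ContDiff ℝ (⊤ : ℕ∞) G → HasCompactSupport G →
    (f : ℝ → ℂ) =ᵐ[volume] F → (g : ℝ → ℂ) =ᵐ[volume] G →
    (@inner ℂ HLine _ g (A f)) =
      ∫ ξ : ℝ, (starRingEnd ℂ) (fou (fun x => (v x : ℂ) * G x) ξ) * s ξ *
        fou (fun x => (v x : ℂ) * F x) ξ

/-- The span of a family with trivial orthogonal complement is dense. -/
theorem denseRange_linearCombination_of_orthogonal_trivial {ι L : Type*}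
    [NormedAddCommGroup L] [InnerProductSpace ℂ L] [CompleteSpace L]
    (c : ι → L) (hc : ∀ u, (∀ i, inner ℂ (c i) u = 0) → u = 0) :
    DenseRange (Finsupp.linearCombination ℂ c) := by
  have h : (LinearMap.range (Finsupp.linearCombination ℂ c)).topologicalClosure = ⊤ := by
    rw [Submodule.topologicalClosure_eq_top_iff, Submodule.eq_bot_iff]
    intro u hu
    refine hc u fun i => (Submodule.mem_orthogonal _ u).1 hu _ ⟨Finsupp.single i 1, ?_⟩
    simp
  exact Submodule.dense_iff_topologicalClosure_eq_top.2 h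

/-- Two families with the same Gram matrix, each with trivial orthogonal complement, are related
by a unitary operator. -/
theorem exists_linearIsometryEquiv_of_inner_eq {ι H K : Type*}
    [NormedAddCommGroup H] [InnerProductSpace ℂ H] [CompleteSpace H]
    [NormedAddCommGroup K] [InnerProductSpace ℂ K] [CompleteSpace K]
    (a : ι → H) (b : ι → K) (hab : ∀ i j, inner ℂ (a i) (a j) = inner ℂ (b i) (b j))
    (ha : ∀ u, (∀ i, inner ℂ (a i) u = 0) → u = 0)
    (hb : ∀ u, (∀ i, inner ℂ (b i) u = 0) → u = 0) :
    ∃ U : H ≃ₗᵢ[ℂ] K, ∀ i, U (a i) = b i := by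
  have da := denseRange_linearCombination_of_orthogonal_trivial a ha
  have db := denseRange_linearCombination_of_orthogonal_trivial b hb
  have hnorm (x : ι →₀ ℂ) : ‖Finsupp.linearCombination ℂ b (LinearEquiv.refl ℂ (ι →₀ ℂ) x)‖ =
      ‖Finsupp.linearCombination ℂ a x‖ := by
    have h : inner ℂ (Finsupp.linearCombination ℂ b x) (Finsupp.linearCombination ℂ b x) =
        inner ℂ (Finsupp.linearCombination ℂ a x) (Finsupp.linearCombination ℂ a x) := by
      simp only [Finsupp.linearCombination_apply, Finsupp.sum, sum_inner, inner_sum,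
        inner_smul_left, inner_smul_right, hab]
    rw [LinearEquiv.refl_apply, ← sq_eq_sq₀ (norm_nonneg _) (norm_nonneg _),
      ← inner_self_eq_norm_sq (𝕜 := ℂ), ← inner_self_eq_norm_sq (𝕜 := ℂ), h]
  refine ⟨(LinearEquiv.refl ℂ (ι →₀ ℂ)).extendOfIsometry _ _ da db hnorm,
    fun i => ?_⟩
  have := LinearEquiv.extendOfIsometry_eq (LinearEquiv.refl ℂ (ι →₀ ℂ)) _ _ da
    db hnorm (Finsupp.single i 1)
  simpa using this

open scoped FourierTransform in
/-- On integrable functions, the `L²` Fourier transform is the Fourier integral. -/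
theorem coeFn_fourier_ae_eq_fourierIntegral (h : HLine) (hi : Integrable (h : ℝ → ℂ)) :
    ((𝓕 h : HLine) : ℝ → ℂ) =ᵐ[volume] 𝓕 (h : ℝ → ℂ) := by
  have hcont : Continuous (𝓕 (h : ℝ → ℂ)) :=
    VectorFourier.fourierIntegral_continuous Real.continuous_fourierChar
      (by fun_prop) hi
  refine ae_eq_of_integral_contDiff_smul_eq ((Lp.memLp _).locallyIntegrable (by norm_num))
    hcont.locallyIntegrable fun φ hφ hφc => ?_
  let φc : ℝ → ℂ := fun x => φ x
  have hφc' : HasCompactSupport φc := hφc.comp_left (g := fun x : ℝ => (x : ℂ)) (by simp)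
  have hφd : ContDiff ℝ (⊤ : ℕ∞) φc := Complex.ofRealCLM.contDiff.comp hφ
  let ψ : SchwartzMap ℝ ℂ := hφc'.toSchwartzMap hφd
  have e1 := congrArg (fun T => T ψ) (Lp.fourier_toTemperedDistribution_eq h)
  simp only [TemperedDistribution.fourier_apply, Lp.toTemperedDistribution_apply] at e1
  have e2 := VectorFourier.integral_fourierIntegral_smul_eq_flip (μ := volume) (ν := volume)
    (L := innerₗ ℝ) (f := (ψ : ℝ → ℂ)) (g := (h : ℝ → ℂ)) Real.continuous_fourierChar
    (by fun_prop) ψ.integrable hi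
  rw [flip_innerₗ] at e2
  calc _ = ∫ x, ψ x • ((𝓕 h : HLine) : ℝ → ℂ) x := rfl
    _ = ∫ x, (𝓕 ψ) x • (h : ℝ → ℂ) x := e1.symm
    _ = ∫ x, ψ x • 𝓕 (h : ℝ → ℂ) x := e2
    _ = _ := rfl

/-- The function `π / cosh (π x)` is its own Fourier transform. -/
theorem integral_cexp_mul_pi_div_cosh (τ : ℝ) :
    ∫ x : ℝ, Complex.exp (2 * Real.pi * Complex.I * x * τ) *
      ((Real.pi / Real.cosh (Real.pi * x) : ℝ) : ℂ) =
      ((Real.pi / Real.cosh (Real.pi * τ) : ℝ) : ℂ) := by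
  set z : ℂ := 1 / 2 + Complex.I * τ with hz
  have hz' : 1 - z = 1 / 2 - Complex.I * τ := by rw [hz]; ring
  have hbeta : Complex.betaIntegral z (1 - z) = ((Real.pi / Real.cosh (Real.pi * τ) : ℝ) : ℂ) := by
    have h1 := Complex.Gamma_mul_Gamma_eq_betaIntegral (s := z) (t := 1 - z)
      (by simp [hz]) (by rw [hz']; simp)
    rw [add_sub_cancel, Complex.Gamma_one, one_mul] at h1
    rw [← h1, Complex.Gamma_mul_Gamma_one_sub, hz, mul_add, add_comm,
      show (Real.pi : ℂ) * (1 / 2) = Real.pi / 2 by ring, Complex.sin_add_pi_div_two,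
      show (Real.pi : ℂ) * (Complex.I * τ) = (Real.pi * τ : ℂ) * Complex.I by ring,
      Complex.cos_mul_I]
    push_cast
    rfl
  let q : ℝ → ℝ := fun x => Real.sigmoid (2 * Real.pi * x)
  have hpi := Real.pi_pos
  have hq' (x : ℝ) : HasDerivAt q (q x * (1 - q x) * (2 * Real.pi)) x := by
    have h1 : HasDerivAt (fun x : ℝ => 2 * Real.pi * x) (2 * Real.pi) x := by
      simpa using (hasDerivAt_id x).const_mul (2 * Real.pi)
    exact (Real.hasDerivAt_sigmoid (2 * Real.pi * x)).comp x h1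
  have hqinj : Function.Injective q := fun x y hxy => by
    have := Real.sigmoid_injective hxy
    exact mul_left_cancel₀ (by positivity) this
  have himg : q '' univ = Ioo 0 1 := by
    rw [image_univ, ← Real.range_sigmoid]
    exact (mul_left_surjective₀ (show (2 * Real.pi) ≠ 0 by positivity)).range_comp Real.sigmoid
  rw [← hbeta, Complex.betaIntegral, intervalIntegral.integral_of_le zero_le_one,
    integral_Ioc_eq_integral_Ioo, ← himg,
    integral_image_eq_integral_abs_deriv_smul MeasurableSet.univ
      (fun x _ => (hq' x).hasDerivWithinAt) hqinj.injOn, Measure.restrict_univ]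
  congr 1 with x
  have hc := Real.cosh_pos (Real.pi * x)
  set c := 2 * Real.cosh (Real.pi * x) with hcdef
  have hc0 : 0 < c := by positivity
  have hce : c = Real.exp (Real.pi * x) + Real.exp (-(Real.pi * x)) := by
    rw [hcdef, Real.cosh_eq]; ring
  have e1 : q x = Real.exp (Real.pi * x) / c := by
    simp only [q]
    rw [Real.sigmoid_def, hce, show -(2 * Real.pi * x) = -(Real.pi * x) + -(Real.pi * x) by ring,
      Real.exp_add, Real.exp_neg]
    field_simp
  have e2 : 1 - q x = Real.exp (-(Real.pi * x)) / c := by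
    rw [e1, eq_div_iff hc0.ne', sub_mul, div_mul_cancel₀ _ hc0.ne', hce]; ring
  have p1 : 0 < q x := Real.sigmoid_pos _
  have p2 : 0 < 1 - q x := sub_pos.2 (Real.sigmoid_lt_one _)
  have l1 : Real.log (q x) = Real.pi * x - Real.log c := by
    rw [e1, Real.log_div (Real.exp_pos _).ne' hc0.ne', Real.log_exp]
  have l2 : Real.log (1 - q x) = -(Real.pi * x) - Real.log c := by
    rw [e2, Real.log_div (Real.exp_pos _).ne' hc0.ne', Real.log_exp]
  have c2 : (1 : ℂ) - (q x : ℂ) = ((1 - q x : ℝ) : ℂ) := by push_cast; rfl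
  have hprod : (q x : ℂ) ^ (z - 1) * (1 - (q x : ℂ)) ^ (1 - z - 1) =
      Complex.exp (2 * Real.pi * Complex.I * x * τ) * c := by
    rw [c2, Complex.cpow_def_of_ne_zero (Complex.ofReal_ne_zero.2 p1.ne'),
      Complex.cpow_def_of_ne_zero (Complex.ofReal_ne_zero.2 p2.ne'),
      ← Complex.ofReal_log p1.le, ← Complex.ofReal_log p2.le, l1, l2, ← Complex.exp_add]
    have : (c : ℂ) = Complex.exp (Real.log c : ℝ) := by
      rw [← Complex.ofReal_exp, Real.exp_log hc0]
    conv_rhs => rw [this]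
    rw [← Complex.exp_add, hz]
    congr 1
    push_cast
    ring
  have habs : |q x * (1 - q x) * (2 * Real.pi)| = 2 * Real.pi / c ^ 2 := by
    rw [abs_of_pos (by positivity), e2, e1]
    have : Real.exp (Real.pi * x) * Real.exp (-(Real.pi * x)) = 1 := by
      rw [← Real.exp_add]; simp
    field_simp
    linear_combination this
  rw [hprod, habs, Complex.real_smul]
  have : Real.pi / Real.cosh (Real.pi * x) = 2 * Real.pi / c ^ 2 * c := by
    rw [hcdef]; field_simp
  rw [this]
  push_cast
  ring

/-- The change of variables `ξ ↦ (2e^{-ξ} - 1)/(2e^{-ξ} + 1)` in the variable `y = ξ / 2π`. -/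
def moebExp (y : ℝ) : ℝ :=
  (2 * Real.exp (-(2 * Real.pi * y)) - 1) / (2 * Real.exp (-(2 * Real.pi * y)) + 1)

/-- The square root of the Jacobian of `moebExp`. -/
def moebWeight (y : ℝ) : ℝ :=
  2 * Real.sqrt (2 * Real.pi) * Real.exp (-(Real.pi * y)) /
    (2 * Real.exp (-(2 * Real.pi * y)) + 1)

theorem moebWeight_pos (y : ℝ) : 0 < moebWeight y := by
  have := Real.pi_pos
  unfold moebWeight
  positivity

theorem moebWeight_sq (y : ℝ) : moebWeight y ^ 2 =
    8 * Real.pi * Real.exp (-(2 * Real.pi * y)) / (2 * Real.exp (-(2 * Real.pi * y)) + 1) ^ 2 := by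
  have h : Real.exp (-(2 * Real.pi * y)) = Real.exp (-(Real.pi * y)) ^ 2 := by
    rw [← Real.exp_nat_mul]; congr 1; push_cast; ring
  rw [moebWeight, div_pow, mul_pow, mul_pow, Real.sq_sqrt (by have := Real.pi_pos; positivity), ← h]
  ring

theorem hasDerivAt_moebExp (y : ℝ) : HasDerivAt moebExp (-(moebWeight y ^ 2)) y := by
  have h1 : HasDerivAt (fun y : ℝ => -(2 * Real.pi * y)) (-(2 * Real.pi)) y := by
    exact ((hasDerivAt_id y).const_mul (2 * Real.pi)).neg.congr_deriv (by simp)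
  have h2 := h1.exp.const_mul 2
  have hne : 2 * Real.exp (-(2 * Real.pi * y)) + 1 ≠ 0 := by positivity
  refine ((h2.sub_const 1).div (h2.add_const 1) hne).congr_deriv ?_
  rw [moebWeight_sq]
  field_simp
  ring

theorem moebExp_mem_Ioo (y : ℝ) : moebExp y ∈ Ioo (-1 : ℝ) 1 := by
  have h := Real.exp_pos (-(2 * Real.pi * y))
  constructor
  · rw [moebExp, lt_div_iff₀ (by positivity)]; linarith
  · rw [moebExp, div_lt_iff₀ (by positivity)]; linarith

theorem exists_moebExp_eq {x : ℝ} (hx : x ∈ Ioo (-1 : ℝ) 1) : ∃ y, moebExp y = x := by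
  have h1 : 0 < 1 + x := by linarith [hx.1]
  have h2 : 0 < 1 - x := by linarith [hx.2]
  refine ⟨-(Real.log ((1 + x) / (2 * (1 - x)))) / (2 * Real.pi), ?_⟩
  rw [moebExp, show -(2 * Real.pi * (-(Real.log ((1 + x) / (2 * (1 - x)))) / (2 * Real.pi))) =
    Real.log ((1 + x) / (2 * (1 - x))) by field_simp, Real.exp_log (by positivity)]
  have : 2 * ((1 + x) / (2 * (1 - x))) + 1 ≠ 0 := by positivity
  rw [div_eq_iff this]
  field_simp
  ring

theorem moebExp_injective : Function.Injective moebExp := by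
  refine (strictAnti_of_deriv_neg fun y => ?_).injective
  rw [(hasDerivAt_moebExp y).deriv]
  have := moebWeight_pos y
  exact neg_neg_of_pos (by positivity)

theorem moebExp_image_univ : moebExp '' univ = Ioo (-1) 1 := by
  ext x
  constructor
  · rintro ⟨y, -, rfl⟩; exact moebExp_mem_Ioo y
  · intro hx
    obtain ⟨y, hy⟩ := exists_moebExp_eq hx
    exact ⟨y, mem_univ _, hy⟩

theorem integral_Ioo_eq_integral_moebExp (f : ℝ → ℂ) :
    ∫ x in Ioo (-1 : ℝ) 1, f x = ∫ y, ((moebWeight y ^ 2 : ℝ) : ℂ) * f (moebExp y) := by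
  rw [← moebExp_image_univ, integral_image_eq_integral_abs_deriv_smul MeasurableSet.univ
    (fun x _ => (hasDerivAt_moebExp x).hasDerivWithinAt) moebExp_injective.injOn,
    Measure.restrict_univ]
  simp only [abs_neg, abs_sq, Complex.real_smul]

theorem continuous_moebExp : Continuous moebExp :=
  continuous_iff_continuousAt.2 fun y => (hasDerivAt_moebExp y).continuousAt

theorem quasiMeasurePreserving_moebExp :
    Measure.QuasiMeasurePreserving moebExp volume (volume.restrict (Ioo (-1 : ℝ) 1)) := by
  refine ⟨continuous_moebExp.measurable, Measure.AbsolutelyContinuous.mk fun N hN hN0 => ?_⟩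
  rw [Measure.map_apply continuous_moebExp.measurable hN]
  have hpre : MeasurableSet (moebExp ⁻¹' N) := continuous_moebExp.measurable hN
  have h := lintegral_image_eq_lintegral_abs_deriv_mul hpre
    (fun x _ => (hasDerivAt_moebExp x).hasDerivWithinAt) moebExp_injective.injOn (fun _ => 1)
  have h0 : volume (moebExp '' (moebExp ⁻¹' N)) = 0 := by
    rw [Measure.restrict_apply hN] at hN0
    refine measure_mono_null ?_ hN0
    rintro _ ⟨y, hy, rfl⟩
    exact ⟨hy, moebExp_mem_Ioo y⟩
  rw [setLIntegral_one, h0, eq_comm, setLIntegral_eq_zero_iff' hpre] at h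
  · have h' : ∀ᵐ y, y ∉ moebExp ⁻¹' N := by
      filter_upwards [h] with y hy hyN
      have := hy hyN
      have hw := moebWeight_pos y
      simp at this
      exact hw.ne' this
    rw [ae_iff] at h'
    simpa only [not_not] using! h'
  · have : Continuous moebWeight := by
      unfold moebWeight
      refine Continuous.div (by fun_prop) (by fun_prop) fun y => by positivity
    fun_prop

theorem moebWeight_mul_div (y y' : ℝ) :
    moebWeight y * moebWeight y' / (1 - moebExp y * moebExp y') =
      Real.pi / Real.cosh (Real.pi * (y' - y)) := by
  have h (y : ℝ) : Real.exp (-(2 * Real.pi * y)) = Real.exp (-(Real.pi * y)) ^ 2 := by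
    rw [← Real.exp_nat_mul]; congr 1; push_cast; ring
  have hc : Real.cosh (Real.pi * (y' - y)) =
      (Real.exp (-(Real.pi * y)) / Real.exp (-(Real.pi * y')) +
        Real.exp (-(Real.pi * y')) / Real.exp (-(Real.pi * y))) / 2 := by
    rw [Real.cosh_eq, ← Real.exp_sub, ← Real.exp_sub]
    ring_nf
  have hs := Real.sq_sqrt (show 0 ≤ 2 * Real.pi by positivity)
  rw [hc, moebWeight, moebWeight, moebExp, moebExp, h, h]
  have p := Real.exp_pos (-(Real.pi * y))
  have p' := Real.exp_pos (-(Real.pi * y'))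
  generalize Real.exp (-(Real.pi * y)) = e at *
  generalize Real.exp (-(Real.pi * y')) = e' at *
  have hd : 1 - (2 * e ^ 2 - 1) / (2 * e ^ 2 + 1) * ((2 * e' ^ 2 - 1) / (2 * e' ^ 2 + 1)) =
      4 * (e ^ 2 + e' ^ 2) / ((2 * e ^ 2 + 1) * (2 * e' ^ 2 + 1)) := by
    field_simp; ring
  rw [hd]
  generalize Real.sqrt (2 * Real.pi) = r at *
  field_simp
  linear_combination 2 * hs

/-- Multiplication by an essentially bounded function, as an operator on `L²(ℝ)`. -/
def mulOp (m : ℝ → ℂ) (hm : MemLp m ⊤) : HLine →L[ℂ] HLine :=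
  (ContinuousLinearMap.mul ℂ ℂ).holderL volume ⊤ 2 2 hm.toLp

theorem coeFn_mulOp (m : ℝ → ℂ) (hm : MemLp m ⊤) (f : HLine) :
    (mulOp m hm f : ℝ → ℂ) =ᵐ[volume] fun x => m x * (f : ℝ → ℂ) x := by
  have h : (mulOp m hm f : ℝ → ℂ) =ᵐ[volume] _ :=
    (ContinuousLinearMap.mul ℂ ℂ).coeFn_holder (r := 2) hm.toLp f
  filter_upwards [h, hm.coeFn_toLp] with x h1 h2
  rw [h1, h2, ContinuousLinearMap.mul_apply']

theorem vStd_pos (x : ℝ) : 0 < vStd x :=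
  div_pos (Real.sqrt_pos.2 Real.pi_pos) (Real.sqrt_pos.2 (Real.cosh_pos _))

theorem vStd_sq (x : ℝ) : vStd x ^ 2 = Real.pi / Real.cosh (Real.pi * x) := by
  rw [vStd, div_pow, Real.sq_sqrt Real.pi_pos.le, Real.sq_sqrt (Real.cosh_pos _).le]

theorem continuous_vStd : Continuous vStd := by
  unfold vStd
  refine continuous_const.div (by fun_prop) fun x => ?_
  exact (Real.sqrt_pos.2 (Real.cosh_pos _)).ne'

theorem memLp_top_vStd : MemLp (fun x => (vStd x : ℂ)) ⊤ := by
  refine memLp_top_of_bound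
    (Complex.continuous_ofReal.comp continuous_vStd).aestronglyMeasurable (Real.sqrt Real.pi)
    (Eventually.of_forall fun x => ?_)
  rw [Complex.norm_real, Real.norm_of_nonneg (vStd_pos x).le, vStd]
  exact div_le_self (Real.sqrt_nonneg _) (Real.one_le_sqrt.2 (Real.one_le_cosh _))

theorem integrable_vStd_sq : Integrable (fun x => vStd x ^ 2) := by
  have h := integral_cexp_mul_pi_div_cosh 0
  simp only [Complex.ofReal_zero, mul_zero, Complex.exp_zero, one_mul, Real.cosh_zero, div_one,
    ← vStd_sq] at h
  have hi : Integrable (fun x => ((vStd x ^ 2 : ℝ) : ℂ)) := by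
    by_contra hn
    rw [integral_undef hn] at h
    exact Real.pi_ne_zero (Complex.ofReal_eq_zero.1 h.symm)
  exact hi.re

/-- The function `v(x) e^{2πixy}`. -/
def vExp (y x : ℝ) : ℂ := Complex.exp (2 * Real.pi * Complex.I * x * y) * vStd x

theorem norm_vExp (y x : ℝ) : ‖vExp y x‖ = vStd x := by
  rw [vExp, norm_mul, show (2 * Real.pi * Complex.I * x * y : ℂ) =
    ((2 * Real.pi * x * y : ℝ) : ℂ) * Complex.I by push_cast; ring,
    Complex.norm_exp_ofReal_mul_I, one_mul, Complex.norm_real, Real.norm_of_nonneg (vStd_pos x).le]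

theorem continuous_vExp (y : ℝ) : Continuous (vExp y) := by
  have := continuous_vStd
  unfold vExp
  fun_prop

theorem memLp_vExp (y : ℝ) : MemLp (vExp y) 2 := by
  rw [memLp_two_iff_integrable_sq_norm (continuous_vExp y).aestronglyMeasurable]
  simpa only [norm_vExp] using! integrable_vStd_sq

theorem conj_vExp (y x : ℝ) : (starRingEnd ℂ) (vExp y x) = vExp (-y) x := by
  simp only [vExp, map_mul, ← Complex.exp_conj, Complex.conj_ofReal, Complex.conj_I, map_ofNat]
  push_cast
  ring_nf

theorem inner_toLp_vExp (y : ℝ) (f : HLine) :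
    inner ℂ ((memLp_vExp y).toLp) f = ∫ x, vExp (-y) x * (f : ℝ → ℂ) x := by
  rw [L2.inner_def]
  refine integral_congr_ae ?_
  filter_upwards [(memLp_vExp y).coeFn_toLp] with x hx
  rw [hx, RCLike.inner_apply, conj_vExp, mul_comm]

theorem inner_toLp_vExp_toLp_vExp (y y' : ℝ) :
    inner ℂ ((memLp_vExp y).toLp) ((memLp_vExp y').toLp) =
      ((Real.pi / Real.cosh (Real.pi * (y' - y)) : ℝ) : ℂ) := by
  rw [inner_toLp_vExp, ← integral_cexp_mul_pi_div_cosh]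
  refine integral_congr_ae ?_
  filter_upwards [(memLp_vExp y').coeFn_toLp] with x hx
  rw [hx, ← vStd_sq, vExp, vExp, mul_mul_mul_comm, ← Complex.exp_add]
  push_cast
  ring_nf

/-- The operator `f ↦ 𝓕 (v f)`. -/
def fourierMulV : HLine →L[ℂ] HLine :=
  (Lp.fourierTransformₗᵢ ℝ ℂ).toContinuousLinearEquiv.toContinuousLinearMap ∘L
    mulOp (fun x => (vStd x : ℂ)) memLp_top_vStd

theorem coeFn_fourierMulV (f : HLine) :
    (fourierMulV f : ℝ → ℂ) =ᵐ[volume] fun y => inner ℂ ((memLp_vExp y).toLp) f := by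
  set h : HLine := mulOp (fun x => (vStd x : ℂ)) memLp_top_vStd f with hh
  have hae : (h : ℝ → ℂ) =ᵐ[volume] fun x => vStd x * (f : ℝ → ℂ) x := coeFn_mulOp _ _ f
  have hv2 : MemLp (fun x => (vStd x : ℂ)) 2 := by
    have := memLp_vExp 0
    unfold vExp at this
    simpa using this
  have hi : Integrable (h : ℝ → ℂ) := (hv2.integrable_mul (Lp.memLp f)).congr hae.symm
  filter_upwards [coeFn_fourier_ae_eq_fourierIntegral h hi] with y hy
  rw [inner_toLp_vExp]
  refine hy.trans ?_
  rw [Real.fourier_real_eq_integral_exp_smul]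
  refine integral_congr_ae ?_
  filter_upwards [hae] with x hx
  rw [hx, vExp, smul_eq_mul]
  push_cast
  ring_nf

theorem eq_zero_of_fourierMulV_eq_zero {f : HLine} (hf : fourierMulV f = 0) : f = 0 := by
  have h : mulOp (fun x => (vStd x : ℂ)) memLp_top_vStd f = 0 :=
    (Lp.fourierTransformₗᵢ ℝ ℂ).map_eq_zero_iff.1 hf
  have hae := coeFn_mulOp (fun x => (vStd x : ℂ)) memLp_top_vStd f
  rw [h] at hae
  refine Lp.ext ?_
  filter_upwards [hae, Lp.coeFn_zero ℂ 2 (volume : Measure ℝ)] with x h1 h2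
  rw [h2] at h1 ⊢
  simpa [(vStd_pos x).ne'] using h1.symm

theorem eq_zero_of_inner_toLp_vExp_eq_zero {f : HLine}
    (hf : ∀ y, inner ℂ ((memLp_vExp y).toLp) f = 0) : f = 0 := by
  refine eq_zero_of_fourierMulV_eq_zero (Lp.ext ?_)
  filter_upwards [coeFn_fourierMulV f, Lp.coeFn_zero ℂ 2 (volume : Measure ℝ)] with y h1 h2
  rw [h1, h2, hf y, Pi.zero_apply]

/-- The sequence `w(y) M(y)^k`, where `M` is `moebExp` and `w` is `moebWeight`. -/
def moebSeq (y : ℝ) : ellTwo :=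
  ⟨fun k => ((moebWeight y * moebExp y ^ k : ℝ) : ℂ), by
    refine memℓp_gen ?_
    have hM : |moebExp y| < 1 := abs_lt.2 (moebExp_mem_Ioo y)
    have h : Summable fun k : ℕ => moebWeight y ^ 2 * (moebExp y ^ 2) ^ k := by
      refine (summable_geometric_of_lt_one (sq_nonneg _) ?_).mul_left _
      rwa [sq_lt_one_iff_abs_lt_one]
    refine h.congr fun k => ?_
    rw [ENNReal.toReal_ofNat, Real.rpow_ofNat, Complex.norm_real, Real.norm_eq_abs, sq_abs]
    ring⟩

theorem moebSeq_apply (y : ℝ) (k : ℕ) :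
    (moebSeq y : ℕ → ℂ) k = ((moebWeight y * moebExp y ^ k : ℝ) : ℂ) := rfl

theorem inner_moebSeq (y : ℝ) (u : ellTwo) :
    inner ℂ (moebSeq y) u =
      ∑' k, ((moebWeight y * moebExp y ^ k : ℝ) : ℂ) * (u : ℕ → ℂ) k := by
  rw [lp.inner_eq_tsum]
  congr 1 with k
  rw [moebSeq_apply, RCLike.inner_apply, Complex.conj_ofReal, mul_comm]

theorem inner_moebSeq_moebSeq (y y' : ℝ) :
    inner ℂ (moebSeq y) (moebSeq y') =
      ((Real.pi / Real.cosh (Real.pi * (y' - y)) : ℝ) : ℂ) := by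
  have hM (y : ℝ) : |moebExp y| < 1 := abs_lt.2 (moebExp_mem_Ioo y)
  have hlt : |moebExp y * moebExp y'| < 1 := by
    rw [abs_mul]
    exact mul_lt_one_of_nonneg_of_lt_one_left (abs_nonneg _) (hM y) (hM y').le
  rw [inner_moebSeq, ← moebWeight_mul_div, div_eq_mul_inv, ← tsum_geometric_of_abs_lt_one hlt,
    ← tsum_mul_left, Complex.ofReal_tsum]
  congr 1 with k
  rw [moebSeq_apply]
  push_cast
  ring

/-- A bounded sequence whose power series vanishes on `(-1, 1)` is zero. -/
theorem eq_zero_of_tsum_pow_mul_eq_zero (u : ℕ → ℂ) (B : ℝ) (hB : ∀ k, ‖u k‖ ≤ B)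
    (h : ∀ x ∈ Ioo (-1 : ℝ) 1, ∑' k, ((x ^ k : ℝ) : ℂ) * u k = 0) (k : ℕ) : u k = 0 := by
  let p : FormalMultilinearSeries ℝ ℝ ℂ := fun n =>
    ContinuousMultilinearMap.mkPiRing ℝ (Fin n) (u n)
  have hr : (1 : ENNReal) ≤ p.radius := by
    refine p.le_radius_of_bound (r := 1) B fun n => ?_
    simpa [p] using hB n
  have hp := (p.hasFPowerSeriesOnBall (zero_lt_one.trans_le hr)).hasFPowerSeriesAt
  have hp0 : HasFPowerSeriesAt 0 p (0 : ℝ) := by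
    refine hp.congr ?_
    filter_upwards [Ioo_mem_nhds (show (-1 : ℝ) < 0 by norm_num) one_pos] with x hx
    rw [FormalMultilinearSeries.sum, Pi.zero_apply, ← h x hx]
    congr 1 with n
    simp [p]
  have := congrArg (fun T => T fun _ => (1 : ℝ)) (congrFun hp0.eq_zero k)
  simpa [p] using this

theorem eq_zero_of_inner_moebSeq_eq_zero {u : ellTwo}
    (hu : ∀ y, inner ℂ (moebSeq y) u = 0) : u = 0 := by
  refine lp.ext (funext fun k => ?_)
  refine eq_zero_of_tsum_pow_mul_eq_zero u ‖u‖ (fun k => lp.norm_apply_le_norm two_ne_zero u k)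
    (fun x hx => ?_) k
  obtain ⟨y, rfl⟩ := exists_moebExp_eq hx
  have h := hu y
  rw [inner_moebSeq] at h
  have h' : ((moebWeight y : ℝ) : ℂ) * ∑' k, ((moebExp y ^ k : ℝ) : ℂ) * (u : ℕ → ℂ) k = 0 := by
    rw [← h, ← tsum_mul_left]
    congr 1 with k
    push_cast
    ring
  exact (mul_eq_zero.1 h').resolve_left (Complex.ofReal_ne_zero.2 (moebWeight_pos y).ne')

theorem memLp_top_comp_moebExp {η : ℝ → ℂ} {C : ℝ}
    (hηm : AEStronglyMeasurable η (volume.restrict (Set.Ioo (-1:ℝ) 1)))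
    (hηb : ∀ᵐ μ ∂(volume.restrict (Set.Ioo (-1:ℝ) 1)), ‖η μ‖ ≤ C) :
    MemLp (fun y => η (moebExp y)) ⊤ :=
  memLp_top_of_bound (hηm.comp_quasiMeasurePreserving quasiMeasurePreserving_moebExp) C
    (quasiMeasurePreserving_moebExp.ae hηb)

theorem fou_vStd_mul (f : HLine) (F : ℝ → ℂ) (hF : (f : ℝ → ℂ) =ᵐ[volume] F) (y : ℝ) :
    fou (fun x => (vStd x : ℂ) * F x) (2 * Real.pi * y) =
      (((2 * Real.pi) ^ (-(1:ℝ)/2) : ℝ) : ℂ) * inner ℂ ((memLp_vExp y).toLp) f := by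
  rw [fou, inner_toLp_vExp]
  congr 1
  refine integral_congr_ae ?_
  filter_upwards [hF] with x hx
  rw [hx, vExp]
  push_cast
  ring_nf

/-- The quadratic form of `v(X) s(D) v(X)` through the operator `fourierMulV`. -/
theorem IsVSDV.inner_eq {s : ℝ → ℂ} {A : HLine →L[ℂ] HLine} (hA : IsVSDV vStd s A)
    {σ : ℝ → ℂ} (hσ : MemLp σ ⊤) (hσs : ∀ y, σ y = s (2 * Real.pi * y)) (f g : HLine) :
    inner ℂ g (A f) = inner ℂ (fourierMulV g) (mulOp σ hσ (fourierMulV f)) := by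
  let D : Set HLine := {f | ∃ g : ℝ → ℂ, f =ᵐ[volume] g ∧ HasCompactSupport g ∧
    ContDiff ℝ (⊤ : ℕ∞) g}
  have hD : Dense D := Lp.dense_hasCompactSupport_contDiff (by norm_num)
  have key : (fun p : HLine × HLine => inner ℂ p.2 (A p.1)) =
      fun p => inner ℂ (fourierMulV p.2) (mulOp σ hσ (fourierMulV p.1)) := by
    refine Continuous.ext_on (hD.prod hD) (by fun_prop) (by fun_prop) ?_
    rintro ⟨f, g⟩ ⟨⟨F, hfF, hFc, hFd⟩, ⟨G, hgG, hGc, hGd⟩⟩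
    have hpi : 0 < 2 * Real.pi := by positivity
    have hscale := Measure.integral_comp_mul_left (fun ξ : ℝ =>
      (starRingEnd ℂ) (fou (fun x => (vStd x : ℂ) * G x) ξ) * s ξ *
        fou (fun x => (vStd x : ℂ) * F x) ξ) (2 * Real.pi)
    rw [abs_of_pos (inv_pos.2 hpi), eq_inv_smul_iff₀ hpi.ne'] at hscale
    have hc : (2 * Real.pi) * ((2 * Real.pi) ^ (-(1:ℝ)/2) * (2 * Real.pi) ^ (-(1:ℝ)/2)) = 1 := by
      rw [← Real.rpow_add hpi, show -(1:ℝ)/2 + -(1:ℝ)/2 = -1 by norm_num, Real.rpow_neg_one,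
        mul_inv_cancel₀ hpi.ne']
    have hc' := congrArg Complex.ofReal hc
    change inner ℂ g (A f) = inner ℂ (fourierMulV g) (mulOp σ hσ (fourierMulV f))
    rw [hA f g F G hFd hFc hGd hGc hfF hgG, ← hscale, L2.inner_def, ← integral_smul]
    refine integral_congr_ae ?_
    filter_upwards [coeFn_mulOp σ hσ (fourierMulV f), coeFn_fourierMulV f, coeFn_fourierMulV g]
      with y h1 h2 h3
    rw [h1, h2, h3, RCLike.inner_apply, hσs, fou_vStd_mul f F hfF, fou_vStd_mul g G hgG, map_mul,
      Complex.conj_ofReal, Complex.real_smul]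
    rw [Complex.ofReal_mul, Complex.ofReal_mul (_ ^ _), Complex.ofReal_one] at hc'
    generalize (s (2 * Real.pi * y)) = t
    generalize inner ℂ ((memLp_vExp y).toLp) f = a
    generalize (starRingEnd ℂ) (inner ℂ ((memLp_vExp y).toLp) g) = b
    linear_combination (b * t * a) * hc'
  exact congrFun key (f, g)

/-- Theorem 7.7 of [Yafaev3].  Let `η ∈ L^∞(-1,1)` and
`g(j) = ∫_{-1}^1 η(μ) μ^j dμ`.  Then the Hankel operator `G` in `ℓ²(ℤ₊)` with matrix elements
`g(j)` is unitarily equivalent to the pseudodifferential operator `A = v(X) s(D) v(X)` in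
`L²(ℝ)`, where `v(x) = √π/√(cosh πx)` and `s(ξ) = η((2e^{-ξ} - 1)/(2e^{-ξ} + 1))`. -/
theorem statement2 (η : ℝ → ℂ) (C : ℝ)
    (hηm : AEStronglyMeasurable η (volume.restrict (Set.Ioo (-1:ℝ) 1)))
    (hηb : ∀ᵐ μ ∂(volume.restrict (Set.Ioo (-1:ℝ) 1)), ‖η μ‖ ≤ C)
    (g : ℕ → ℂ) (hg : ∀ j : ℕ, g j = ∫ μ in Set.Ioo (-1:ℝ) 1, η μ * (μ : ℂ) ^ j)
    (s : ℝ → ℂ)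
    (hs : ∀ ξ : ℝ, s ξ = η ((2 * Real.exp (-ξ) - 1) / (2 * Real.exp (-ξ) + 1)))
    (G : ellTwo →L[ℂ] ellTwo) (hG : IsHankelD g G)
    (A : HLine →L[ℂ] HLine) (hA : IsVSDV vStd s A) :
    ∃ U : ellTwo ≃ₗᵢ[ℂ] HLine, ∀ u : ellTwo, U (G u) = A (U u) := by
  have hs' (y : ℝ) : η (moebExp y) = s (2 * Real.pi * y) := (hs _).symm
  have hσ := memLp_top_comp_moebExp hηm hηb
  obtain ⟨U, hU⟩ := exists_linearIsometryEquiv_of_inner_eq moebSeq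
    (fun y => (memLp_vExp y).toLp)
    (fun y y' => by rw [inner_moebSeq_moebSeq, inner_toLp_vExp_toLp_vExp])
    (fun u => eq_zero_of_inner_moebSeq_eq_zero)
    (fun f => eq_zero_of_inner_toLp_vExp_eq_zero)
  let e : ℕ → ellTwo := fun k => lp.single 2 k (1 : ℂ)
  have hUe (k : ℕ) : (fourierMulV (U (e k)) : ℝ → ℂ) =ᵐ[volume]
      fun y => ((moebWeight y * moebExp y ^ k : ℝ) : ℂ) := by
    filter_upwards [coeFn_fourierMulV (U (e k))] with y hy
    rw [hy, ← hU, U.inner_map_map, lp.inner_single_right, moebSeq_apply, RCLike.inner_apply,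
      Complex.conj_ofReal, one_mul]
  have hG' (j k : ℕ) : (G (e k) : ℕ → ℂ) j = g (j + k) := by
    rw [hG, tsum_eq_single k fun i hi => by simp [e, hi]]
    simp [e]
  have hUA (j k : ℕ) : inner ℂ (U (e j)) (A (U (e k))) = g (j + k) := by
    rw [hA.inner_eq hσ hs', L2.inner_def, hg, integral_Ioo_eq_integral_moebExp]
    refine integral_congr_ae ?_
    filter_upwards [coeFn_mulOp _ hσ (fourierMulV (U (e k))), hUe j, hUe k] with y h1 h2 h3
    rw [h1, h2, h3, RCLike.inner_apply, Complex.conj_ofReal]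
    push_cast
    ring
  have hGA (k : ℕ) : U (G (e k)) = A (U (e k)) := by
    rw [← U.apply_symm_apply (A (U (e k)))]
    congr 1
    refine lp.ext (funext fun j => ?_)
    have h := hUA j k
    rw [← U.apply_symm_apply (A (U (e k))), U.inner_map_map, lp.inner_single_left,
      RCLike.inner_apply, map_one, mul_one] at h
    rw [hG', h]
  refine ⟨U, fun u => ?_⟩
  have hsum := lp.hasSum_single (p := 2) (by norm_num) u
  let T : ellTwo →L[ℂ] HLine := U.toContinuousLinearEquiv.toContinuousLinearMap ∘L G -
    A ∘L U.toContinuousLinearEquiv.toContinuousLinearMap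
  have hT : T u = 0 := by
    refine (hsum.mapL T).unique ?_
    convert (hasSum_zero : HasSum (fun _ : ℕ => (0 : HLine)) 0) using 2 with k
    have : lp.single 2 k ((u : ℕ → ℂ) k) = (u : ℕ → ℂ) k • e k := by
      rw [← lp.single_smul, smul_eq_mul, mul_one]
    rw [this, map_smul]
    have h0 : T (e k) = 0 := sub_eq_zero.2 (hGA k)
    rw [h0, smul_zero]
  exact sub_eq_zero.1 hT
end
end

section
/- Let α > 0 and let h ∈ L^∞_loc((0,∞)) be a complex-valued function; if α ≥ 1/2, suppose moreover h ∈ C^{N(α)}((0,∞)). Assume that h^{(m)}(t) = o(t^{−1−m} ⟨log t⟩^{−α}) as t → 0 and as t → ∞, for all m = 0, 1, …, N(α). Then the singular values of the Hankel operator H with kernel h on L²(0,∞) satisfy s_n(H) = o(n^{−α}) as n → ∞. -/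
noncomputable section
open MeasureTheory Filter Asymptotics Set

/-- A bound for `sₙ(K)` from a bound for `K` on the orthogonal complement of fewer than `n`
vectors. -/
lemma singVal_le_of_orthogonal {E : Type*} [NormedAddCommGroup E] [InnerProductSpace ℂ E]
    (K : E →L[ℂ] E) (S : Finset E) {n : ℕ} (hn : S.card < n) {c : ℝ} (hc : 0 ≤ c)
    (hS : ∀ x : E, (∀ φ ∈ S, inner ℂ φ x = 0) → ‖K x‖ ≤ c * ‖x‖) :
    singVal K n ≤ c := by
  refine Real.iSup_le ?_ hc
  rintro ⟨V, hV⟩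
  have hfin : FiniteDimensional ℂ V := Module.finite_of_finrank_pos (by omega)
  let f : V →ₗ[ℂ] (S → ℂ) := LinearMap.pi fun φ =>
    (innerSL ℂ φ.1).toLinearMap ∘ₗ V.subtype
  have hker : LinearMap.ker f ≠ ⊥ := by
    apply LinearMap.ker_ne_bot_of_finrank_lt
    rw [Module.finrank_fintype_fun_eq_card, Fintype.card_coe, hV]
    exact hn
  obtain ⟨y, hy, hy0⟩ := Submodule.exists_mem_ne_zero_of_ne_bot hker
  have hyE : (y : E) ≠ 0 := by simpa using hy0
  have hny : ‖(y : E)‖ ≠ 0 := by simpa using hyE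
  have horth : ∀ φ ∈ S, inner ℂ φ (y : E) = 0 := by
    intro φ hφ
    have := congrFun (LinearMap.mem_ker.mp hy) ⟨φ, hφ⟩
    simpa [f] using this
  let x : E := ((‖(y : E)‖⁻¹ : ℝ) : ℂ) • (y : E)
  have hx1 : ‖x‖ = 1 := by
    simp only [x, norm_smul, Complex.norm_real, norm_inv, norm_norm]
    exact inv_mul_cancel₀ hny
  have hxV : x ∈ V := V.smul_mem _ y.2
  have hbdd : BddBelow (Set.range fun x : {x : E // x ∈ V ∧ ‖x‖ = 1} => ‖K x.1‖) :=
    ⟨0, by rintro _ ⟨z, rfl⟩; positivity⟩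
  refine (ciInf_le hbdd ⟨x, hxV, hx1⟩).trans ?_
  have := hS x (fun φ hφ => by simp [x, horth φ hφ])
  simpa [hx1] using this

/-- A greedy choice: if a quadratically homogeneous functional sums to at most `B` along every
finite orthonormal family, then it is at most `B / r` times the square norm on the orthogonal
complement of some `r` vectors. -/
lemma exists_finset_orthogonal_le {E : Type*} [NormedAddCommGroup E] [InnerProductSpace ℂ E]
    (q : E → ENNReal) {B : ENNReal}
    (hq : ∀ (c : ℂ) (x : E), q (c • x) = ‖c‖ₑ ^ 2 * q x)
    (hsum : ∀ S : Finset E, Orthonormal ℂ (fun x : S => (x : E)) →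
      ∑ x ∈ S, q x ≤ B) {r : ℕ} (hr : 1 ≤ r) :
    ∃ S : Finset E, S.card ≤ r ∧
      ∀ x, (∀ φ ∈ S, inner ℂ φ x = 0) → q x ≤ B / r * ‖x‖ₑ ^ 2 := by
  classical
  by_contra hcon
  push Not at hcon
  have hr0 : (r : ENNReal) ≠ 0 := by
    simp only [ne_eq, Nat.cast_eq_zero]; omega
  have key : ∀ k : ℕ, k ≤ r + 1 → ∃ S : Finset E, S.card = k ∧
      Orthonormal ℂ (fun x : S => (x : E)) ∧ ∀ x ∈ S, B / r < q x := by
    intro k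
    induction k with
    | zero =>
      intro _
      refine ⟨∅, rfl, ?_, by simp⟩
      rw [orthonormal_iff_ite]
      rintro ⟨x, hx⟩
      simp at hx
    | succ k ih =>
      intro hk
      obtain ⟨S, hcard, hon, hgt⟩ := ih (by omega)
      obtain ⟨x, horth, hx⟩ := hcon S (by omega)
      have hx0 : x ≠ 0 := by
        rintro rfl
        have h0 := hq 0 0
        simp only [smul_zero, enorm_zero, ne_eq, OfNat.ofNat_ne_zero, not_false_eq_true,
          zero_pow, zero_mul] at h0
        simp [h0] at hx
      have hnx : ‖x‖ ≠ 0 := by simpa using hx0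
      let c : ℂ := ((‖x‖⁻¹ : ℝ) : ℂ)
      have hcx : ‖c • x‖ = 1 := by
        simp only [c, norm_smul, Complex.norm_real, norm_inv, norm_norm]
        exact inv_mul_cancel₀ hnx
      have hc2 : ‖c‖ₑ ^ 2 * ‖x‖ₑ ^ 2 = 1 := by
        rw [← mul_pow, ← enorm_smul, ← ofReal_norm, hcx]; simp
      have hc0 : ‖c‖ₑ ^ 2 ≠ 0 := by
        intro h; rw [h] at hc2; simp at hc2
      have hct : ‖c‖ₑ ^ 2 ≠ ⊤ := by finiteness
      have horth' : ∀ φ ∈ S, inner ℂ φ (c • x) = 0 := fun φ hφ => by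
        rw [inner_smul_right, horth φ hφ, mul_zero]
      have hnot : c • x ∉ S := by
        intro hmem
        have := horth' _ hmem
        rw [inner_self_eq_zero] at this
        rw [this] at hcx; simp at hcx
      refine ⟨insert (c • x) S, by rw [Finset.card_insert_of_notMem hnot, hcard], ?_, ?_⟩
      · constructor
        · rintro ⟨y, hy⟩
          rcases Finset.mem_insert.mp hy with rfl | hy
          · exact hcx
          · exact hon.1 ⟨y, hy⟩
        · rintro ⟨y, hy⟩ ⟨z, hz⟩ hne
          have hne' : y ≠ z := fun h => hne (Subtype.ext h)
          rcases Finset.mem_insert.mp hy with rfl | hy <;>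
            rcases Finset.mem_insert.mp hz with rfl | hz
          · exact absurd rfl hne'
          · exact inner_eq_zero_symm.mp (horth' _ hz)
          · exact horth' _ hy
          · exact hon.2 (i := ⟨y, hy⟩) (j := ⟨z, hz⟩) (fun h => hne' (congrArg Subtype.val h))
      · intro y hy
        rcases Finset.mem_insert.mp hy with rfl | hy
        · rw [hq]
          calc B / r = ‖c‖ₑ ^ 2 * (B / r * ‖x‖ₑ ^ 2) := by
                rw [mul_left_comm, hc2, mul_one]
            _ < ‖c‖ₑ ^ 2 * q x := by
                exact (ENNReal.mul_lt_mul_iff_right hc0 hct).mpr hx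
        · exact hgt y hy
  obtain ⟨S, hcard, hon, hgt⟩ := key (r + 1) le_rfl
  have hne : S.Nonempty := Finset.card_pos.mp (by omega)
  have h1 : ∑ _x ∈ S, B / r < ∑ x ∈ S, q x := ENNReal.sum_lt_sum_of_nonempty hne hgt
  have h2 := h1.trans_le (hsum S hon)
  rw [Finset.sum_const, hcard, nsmul_eq_mul] at h2
  have h3 : B ≤ ((r + 1 : ℕ) : ENNReal) * (B / r) := by
    calc B = r * (B / r) := (ENNReal.mul_div_cancel hr0 (by simp)).symm
      _ ≤ _ := by gcongr; simp
  exact absurd h2 (not_lt.mpr h3)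

lemma sum_rpow_neg_le {θ : ℝ} (h0 : 0 ≤ θ) (h1 : θ < 1) (n : ℕ) :
    ∑ k ∈ Finset.range n, ((k : ℝ) + 1) ^ (-θ) ≤ (n : ℝ) ^ (1 - θ) / (1 - θ) := by
  have hpos : 0 < 1 - θ := by linarith
  induction n with
  | zero => simp [Real.zero_rpow hpos.ne']
  | succ n ih =>
    rw [Finset.sum_range_succ]
    have hn : (0 : ℝ) < (n : ℝ) + 1 := by positivity
    have hb := rpow_one_add_le_one_add_mul_self (s := -(1 / ((n : ℝ) + 1))) (p := 1 - θ)
      (by rw [neg_le_neg_iff, div_le_one hn]; linarith [(Nat.cast_nonneg n : (0:ℝ) ≤ n)])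
      hpos.le (by linarith)
    have he : (1 + -(1 / ((n : ℝ) + 1))) = (n : ℝ) / (n + 1) := by field_simp; ring
    rw [he, Real.div_rpow (by positivity) hn.le, div_le_iff₀ (by positivity)] at hb
    have hs : ((n : ℝ) + 1) ^ (1 - θ) = ((n : ℝ) + 1) * ((n : ℝ) + 1) ^ (-θ) := by
      rw [sub_eq_add_neg, Real.rpow_add hn, Real.rpow_one]
    have h3 : (n : ℝ) ^ (1 - θ) ≤ ((n : ℝ) + 1) ^ (1 - θ) - (1 - θ) * ((n : ℝ) + 1) ^ (-θ) := by
      refine hb.trans (le_of_eq ?_)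
      rw [hs]; field_simp; ring
    push_cast
    have h4 : (n : ℝ) ^ (1 - θ) / (1 - θ) ≤
        ((n : ℝ) + 1) ^ (1 - θ) / (1 - θ) - ((n : ℝ) + 1) ^ (-θ) := by
      rw [div_le_iff₀ hpos, sub_mul, div_mul_cancel₀ _ hpos.ne']
      linarith
    linarith

lemma sum_ceil_rpow_le {θ : ℝ} (h0 : 0 ≤ θ) (h1 : θ < 1) (n : ℕ) :
    ∑ k ∈ Finset.range n, (⌈((n : ℝ) / (k + 1)) ^ θ⌉₊ : ℝ) ≤ (1 + 1 / (1 - θ)) * n := by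
  rcases Nat.eq_zero_or_pos n with rfl | hn
  · simp
  have hn' : (0 : ℝ) < n := by exact_mod_cast hn
  calc ∑ k ∈ Finset.range n, (⌈((n : ℝ) / (k + 1)) ^ θ⌉₊ : ℝ)
      ≤ ∑ k ∈ Finset.range n, (1 + (n : ℝ) ^ θ * ((k : ℝ) + 1) ^ (-θ)) := by
        refine Finset.sum_le_sum fun k _ => ?_
        have hk : (0 : ℝ) < (k : ℝ) + 1 := by positivity
        have := (Nat.ceil_lt_add_one (a := ((n : ℝ) / (k + 1)) ^ θ) (by positivity)).le
        rw [Real.div_rpow hn'.le hk.le] at this ⊢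
        rw [Real.rpow_neg hk.le, ← div_eq_mul_inv]
        linarith
    _ = n + (n : ℝ) ^ θ * ∑ k ∈ Finset.range n, ((k : ℝ) + 1) ^ (-θ) := by
        rw [Finset.sum_add_distrib, Finset.mul_sum]; simp
    _ ≤ n + (n : ℝ) ^ θ * ((n : ℝ) ^ (1 - θ) / (1 - θ)) := by
        gcongr; exact sum_rpow_neg_le h0 h1 n
    _ = (1 + 1 / (1 - θ)) * n := by
        rw [← mul_div_assoc, ← Real.rpow_add hn']; simp; ring

lemma singVal_nonneg {E : Type*} [NormedAddCommGroup E] [InnerProductSpace ℂ E]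
    (K : E →L[ℂ] E) (n : ℕ) : 0 ≤ singVal K n :=
  Real.iSup_nonneg fun _ => Real.iInf_nonneg fun _ => norm_nonneg _

/-- Singular value bound from estimates of the columns `Q j` of an operator, each of which
becomes small on the orthogonal complement of few vectors. -/
lemma singVal_le_of_columns {E : Type*} [NormedAddCommGroup E] [InnerProductSpace ℂ E]
    (K : E →L[ℂ] E) (Q p : ℤ → E → ENNReal) {C₁ C₂ : ℝ} (hC₁ : 0 ≤ C₁) (hC₂ : 0 ≤ C₂)
    (hK : ∀ x, ‖K x‖ₑ ^ 2 ≤ ENNReal.ofReal C₁ * ∑' j, Q j x)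
    (hp : ∀ x, ∑' j, p j x ≤ ‖x‖ₑ ^ 2)
    {α a ν : ℝ} (hα : 0 < α) (ha : α < a) (haν : a < ν) (c : ℕ) {ε L : ℝ} (hε : 0 ≤ ε)
    (hL : 0 ≤ L) (D : ℤ → ℝ)
    (hD : ∀ j, D j = ε * (1 + |(j : ℝ)|) ^ (-α) + L * (1 + |(j : ℝ)|) ^ (-a))
    (hfree : ∀ j x, Q j x ≤ ENNReal.ofReal (C₂ * D j ^ 2) * p j x)
    (htest : ∀ j, ∀ r : ℕ, 1 ≤ r → ∃ S : Finset E, S.card ≤ c * r ∧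
      ∀ x, (∀ φ ∈ S, inner ℂ φ x = 0) →
        Q j x ≤ ENNReal.ofReal (C₂ * (D j * (r : ℝ) ^ (-ν)) ^ 2) * p j x)
    {n m : ℕ} (hn : 1 ≤ n) (hm : 2 * c * (1 + 1 / (1 - a / ν)) * n < m) :
    singVal K m ≤ √(C₁ * C₂) * (ε * (n : ℝ) ^ (-α) + L * (n : ℝ) ^ (-a)) := by
  classical
  have hn' : (0 : ℝ) < n := by exact_mod_cast hn
  have hapos : 0 < a := hα.trans ha
  have hνpos : 0 < ν := hapos.trans haν
  have hθ0 : 0 ≤ a / ν := by positivity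
  have hθ1 : a / ν < 1 := by rw [div_lt_one hνpos]; exact haν
  let r : ℕ → ℕ := fun k => ⌈((n : ℝ) / (k + 1)) ^ (a / ν)⌉₊
  have hr : ∀ k, 1 ≤ r k := fun k => Nat.one_le_ceil_iff.mpr (by positivity)
  choose! T hTcard hT using htest
  let S : Finset E := (Finset.range n).biUnion fun k => T k (r k) ∪ T (-(k : ℤ)) (r k)
  have hScard : (S.card : ℝ) ≤ 2 * c * (1 + 1 / (1 - a / ν)) * n := by
    have h1 : S.card ≤ ∑ k ∈ Finset.range n, 2 * c * r k := by
      refine Finset.card_biUnion_le.trans (Finset.sum_le_sum fun k _ => ?_)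
      refine (Finset.card_union_le _ _).trans ?_
      have := hTcard k (r k) (hr k)
      have := hTcard (-(k : ℤ)) (r k) (hr k)
      linarith
    calc (S.card : ℝ) ≤ ((∑ k ∈ Finset.range n, 2 * c * r k : ℕ) : ℝ) := by exact_mod_cast h1
      _ = 2 * c * ∑ k ∈ Finset.range n, (r k : ℝ) := by
          push_cast; rw [Finset.mul_sum]
      _ ≤ 2 * c * ((1 + 1 / (1 - a / ν)) * n) := by
          gcongr; exact sum_ceil_rpow_le hθ0 hθ1 n
      _ = _ := by ring
  have hScard' : S.card < m := by exact_mod_cast hScard.trans_lt hm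
  set d : ℝ := ε * (n : ℝ) ^ (-α) + L * (n : ℝ) ^ (-a) with hd
  have hd0 : 0 ≤ d := by positivity
  have hD0 : ∀ j, 0 ≤ D j := fun j => by rw [hD]; positivity
  refine singVal_le_of_orthogonal K S hScard' (by positivity) fun x hx => ?_
  have hcol : ∀ j, Q j x ≤ ENNReal.ofReal (C₂ * d ^ 2) * p j x := by
    intro j
    have hj1 : (0 : ℝ) < 1 + |(j : ℝ)| := by positivity
    by_cases hj : j.natAbs < n
    · have habs : ((j.natAbs : ℕ) : ℝ) = |(j : ℝ)| := by
        rw [Nat.cast_natAbs, Int.cast_abs]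
      have hmem : ∀ φ ∈ T j (r j.natAbs), inner ℂ φ x = 0 := by
        intro φ hφ
        refine hx φ (Finset.mem_biUnion.mpr ⟨j.natAbs, Finset.mem_range.mpr hj, ?_⟩)
        rcases Int.natAbs_eq j with h | h
        · exact Finset.mem_union_left _ (by rw [← h]; exact hφ)
        · exact Finset.mem_union_right _ (by rw [← h]; exact hφ)
      refine (hT j _ (hr _) x hmem).trans ?_
      have hle : D j * (r j.natAbs : ℝ) ^ (-ν) ≤ d := by
        set y : ℝ := 1 + |(j : ℝ)| with hy
        have hyn : y ≤ n := by
          rw [hy, ← habs]; norm_cast; omega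
        have hr1 : ((n : ℝ) / y) ^ (a / ν) ≤ r j.natAbs := by
          have hy' : ((j.natAbs : ℕ) : ℝ) + 1 = y := by rw [habs, hy, add_comm]
          rw [← hy']
          exact Nat.le_ceil _
        have hr2 : (r j.natAbs : ℝ) ^ (-ν) ≤ ((n : ℝ) / y) ^ (-a) := by
          refine (Real.rpow_le_rpow_of_nonpos (by positivity) hr1 (by linarith)).trans ?_
          rw [← Real.rpow_mul (by positivity)]
          apply le_of_eq; congr 1; field_simp
        have hny : 1 ≤ (n : ℝ) / y := by rwa [one_le_div hj1]
        have hr3 : ((n : ℝ) / y) ^ (-a) ≤ ((n : ℝ) / y) ^ (-α) :=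
          Real.rpow_le_rpow_of_exponent_le hny (by linarith)
        have e1 : ∀ b : ℝ, y ^ b * ((n : ℝ) / y) ^ b = (n : ℝ) ^ b := fun b => by
          rw [← Real.mul_rpow hj1.le (by positivity)]; congr 1; field_simp
        rw [hD, hd, ← e1 (-α), ← e1 (-a), add_mul, ← hy, mul_assoc, mul_assoc]
        gcongr
        exact hr2.trans hr3
      have := mul_nonneg (hD0 j) (Real.rpow_nonneg (Nat.cast_nonneg (r j.natAbs)) (-ν))
      gcongr
    · refine (hfree j x).trans ?_
      have hnj : (n : ℝ) ≤ 1 + |(j : ℝ)| := by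
        have : (n : ℝ) ≤ (j.natAbs : ℕ) := by exact_mod_cast not_lt.mp hj
        rw [Nat.cast_natAbs, Int.cast_abs] at this
        linarith
      have hle : D j ≤ d := by
        rw [hD, hd]
        gcongr ?_ * ?_ + ?_ * ?_
        · exact Real.rpow_le_rpow_of_nonpos hn' hnj (by linarith)
        · exact Real.rpow_le_rpow_of_nonpos hn' hnj (by linarith)
      have := hD0 j
      gcongr
  have hfin : ‖K x‖ₑ ^ 2 ≤ ENNReal.ofReal (C₁ * C₂ * d ^ 2) * ‖x‖ₑ ^ 2 := by
    calc ‖K x‖ₑ ^ 2 ≤ ENNReal.ofReal C₁ * ∑' j, Q j x := hK x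
      _ ≤ ENNReal.ofReal C₁ * ∑' j, ENNReal.ofReal (C₂ * d ^ 2) * p j x := by
          gcongr with j; exact hcol j
      _ = ENNReal.ofReal (C₁ * C₂ * d ^ 2) * ∑' j, p j x := by
          rw [ENNReal.tsum_mul_left, ← mul_assoc, ← ENNReal.ofReal_mul hC₁, mul_assoc C₁]
      _ ≤ _ := by gcongr; exact hp x
  rw [← ofReal_norm, ← ofReal_norm, ← ENNReal.ofReal_pow (norm_nonneg _),
    ← ENNReal.ofReal_pow (norm_nonneg _), ← ENNReal.ofReal_mul (by positivity),
    ENNReal.ofReal_le_ofReal_iff (by positivity)] at hfin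
  refine (pow_le_pow_iff_left₀ (norm_nonneg _) (by positivity) two_ne_zero).mp ?_
  rw [mul_pow, mul_pow, Real.sq_sqrt (by positivity)]
  exact hfin

lemma isLittleO_rpow_of_two_scale {s : ℕ → ℝ} (hs : ∀ n, 0 ≤ s n) {α a : ℝ} (hα : 0 < α)
    (ha : α < a) (C₀ C : ℝ)
    (h : ∀ ε > 0, ∃ L ≥ 0, ∀ n m : ℕ, 1 ≤ n → C₀ * n < m →
      s m ≤ C * (ε * (n : ℝ) ^ (-α) + L * (n : ℝ) ^ (-a))) :
    s =o[atTop] fun n : ℕ => (n : ℝ) ^ (-α) := by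
  obtain ⟨k, hk⟩ := exists_nat_ge (max C₀ 1)
  have hkC : C₀ ≤ k := (le_max_left _ _).trans hk
  have hk1 : (1 : ℝ) ≤ k := (le_max_right _ _).trans hk
  have hk1' : 1 ≤ k := by exact_mod_cast hk1
  rw [isLittleO_iff]
  intro δ hδ
  set A : ℝ := (4 * (k : ℝ)) ^ α with hA
  have hApos : 0 < A := by positivity
  set C' : ℝ := max C 1
  have hC' : 0 < C' := lt_of_lt_of_le one_pos (le_max_right _ _)
  obtain ⟨L, hL0, hL⟩ := h (δ / (2 * C' * A)) (by positivity)
  have hlim : Tendsto (fun m : ℕ => C' * L * (4 * (k : ℝ)) ^ a * (m : ℝ) ^ (-(a - α)))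
      atTop (nhds 0) := by
    have := ((tendsto_rpow_neg_atTop (y := a - α) (by linarith)).comp
      tendsto_natCast_atTop_atTop).const_mul (C' * L * (4 * (k : ℝ)) ^ a)
    simpa using this
  filter_upwards [hlim.eventually (gt_mem_nhds (half_pos hδ)), eventually_ge_atTop (2 * k)]
    with m hm1 hm2
  have hmpos : (0 : ℝ) < m := by
    have : 0 < m := by omega
    exact_mod_cast this
  set n := m / (2 * k) with hn
  have hn1 : 1 ≤ n := (Nat.one_le_div_iff (by omega)).mpr hm2
  have hn0 : (0 : ℝ) < n := by exact_mod_cast hn1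
  have h1 : C₀ * n < m := by
    have h2 : 2 * k * n ≤ m := Nat.mul_div_le m (2 * k)
    have h2' : 2 * (k : ℝ) * n ≤ m := by exact_mod_cast h2
    have : C₀ * n ≤ k * n := by gcongr
    nlinarith [mul_pos (lt_of_lt_of_le one_pos hk1) hn0]
  have h2 : (m : ℝ) / (4 * k) ≤ n := by
    rw [div_le_iff₀ (by positivity)]
    have : m < 2 * k * (n + 1) := by
      rw [hn]; exact Nat.lt_mul_div_succ m (by omega)
    have h3 : (m : ℝ) < 2 * k * (n + 1) := by exact_mod_cast this
    have h4 : (1 : ℝ) ≤ n := by exact_mod_cast hn1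
    nlinarith
  have h3 : ∀ b : ℝ, 0 < b → (n : ℝ) ^ (-b) ≤ (4 * (k : ℝ)) ^ b * (m : ℝ) ^ (-b) := by
    intro b hb
    refine (Real.rpow_le_rpow_of_nonpos (by positivity) h2 (by linarith)).trans (le_of_eq ?_)
    rw [Real.div_rpow hmpos.le (by positivity), Real.rpow_neg (x := 4 * (k : ℝ)) (by positivity),
      div_inv_eq_mul, mul_comm]
  have hmα : (0 : ℝ) < (m : ℝ) ^ (-α) := by positivity
  rw [Real.norm_of_nonneg (hs m), Real.norm_of_nonneg hmα.le]
  calc s m ≤ C * (δ / (2 * C' * A) * (n : ℝ) ^ (-α) + L * (n : ℝ) ^ (-a)) := hL n m hn1 h1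
    _ ≤ C' * (δ / (2 * C' * A) * (n : ℝ) ^ (-α) + L * (n : ℝ) ^ (-a)) := by
        gcongr; exact le_max_left _ _
    _ ≤ C' * (δ / (2 * C' * A) * (A * (m : ℝ) ^ (-α)) +
          L * ((4 * (k : ℝ)) ^ a * (m : ℝ) ^ (-a))) := by
        gcongr
        · exact h3 α hα
        · exact h3 a (hα.trans ha)
    _ = δ / 2 * (m : ℝ) ^ (-α) +
          C' * L * (4 * (k : ℝ)) ^ a * (m : ℝ) ^ (-(a - α)) * (m : ℝ) ^ (-α) := by
        have : (m : ℝ) ^ (-a) = (m : ℝ) ^ (-(a - α)) * (m : ℝ) ^ (-α) := by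
          rw [← Real.rpow_add hmpos]; congr 1; ring
        rw [this]; field_simp
    _ ≤ δ / 2 * (m : ℝ) ^ (-α) + δ / 2 * (m : ℝ) ^ (-α) := by gcongr
    _ = _ := by ring

/-- The exponential block `(e^j, e^(j+1)]` of the half-line. -/
def expBlock (j : ℤ) : Set ℝ := Ioc (Real.exp j) (Real.exp (j + 1))

lemma measurableSet_expBlock (j : ℤ) : MeasurableSet (expBlock j) := measurableSet_Ioc

lemma expBlock_subset (j : ℤ) : expBlock j ⊆ Ioi 0 := fun _ hs => (Real.exp_pos _).trans hs.1

lemma pairwise_disjoint_expBlock : Pairwise (Function.onFun Disjoint expBlock) := by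
  intro i j hij
  rw [Function.onFun, Set.disjoint_left]
  rintro s ⟨h1, h2⟩ ⟨h3, h4⟩
  have h5 : (i : ℝ) < j + 1 := Real.exp_lt_exp.mp (h1.trans_le h4)
  have h6 : (j : ℝ) < i + 1 := Real.exp_lt_exp.mp (h3.trans_le h2)
  norm_cast at h5 h6
  omega

lemma iUnion_expBlock : ⋃ j, expBlock j = Ioi (0 : ℝ) := by
  refine Subset.antisymm (iUnion_subset expBlock_subset) fun s hs => ?_
  rw [mem_iUnion]
  refine ⟨⌈Real.log s⌉ - 1, ?_, ?_⟩
  · rw [← Real.lt_log_iff_exp_lt hs]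
    push_cast
    linarith [Int.ceil_lt_add_one (Real.log s)]
  · rw [← Real.log_le_iff_le_exp hs]
    push_cast
    linarith [Int.le_ceil (Real.log s)]

lemma volume_expBlock_le (j : ℤ) : volume (expBlock j) ≤ ENNReal.ofReal (2 * Real.exp j) := by
  rw [expBlock, Real.volume_Ioc]
  apply ENNReal.ofReal_le_ofReal
  rw [Real.exp_add]
  nlinarith [Real.exp_one_lt_d9, Real.exp_pos (j : ℝ)]

/-- The action of the column of the Hankel kernel over the block `j`. -/
def colInt (h : ℝ → ℂ) (j : ℤ) (x : ℝ → ℂ) (t : ℝ) : ℂ := ∫ s in expBlock j, h (t + s) * x s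

/-- The weighted square norm of the column over the block `j`. -/
def colForm (h : ℝ → ℂ) (j : ℤ) (x : ℝ → ℂ) : ENNReal :=
  ∫⁻ t in Ioi (0 : ℝ), ENNReal.ofReal (Real.exp (|Real.log t - j| / 4)) * ‖colInt h j x t‖ₑ ^ 2

/-- The square of the `L²` norm over the block `j`. -/
def blockMass (j : ℤ) (x : ℝ → ℂ) : ENNReal := ∫⁻ s in expBlock j, ‖x s‖ₑ ^ 2

lemma lintegral_mul_sq_le {X : Type*} [MeasurableSpace X] {μ : Measure X} {f g : X → ENNReal}
    (hf : AEMeasurable f μ) (hg : AEMeasurable g μ) :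
    (∫⁻ x, f x * g x ∂μ) ^ 2 ≤ (∫⁻ x, f x ^ 2 ∂μ) * ∫⁻ x, g x ^ 2 ∂μ := by
  have h2 : Real.HolderConjugate 2 2 := Real.HolderConjugate.two_two
  have := ENNReal.lintegral_mul_le_Lp_mul_Lq μ h2 hf hg
  simp only [Pi.mul_apply] at this
  calc (∫⁻ x, f x * g x ∂μ) ^ 2
      ≤ ((∫⁻ x, f x ^ (2 : ℝ) ∂μ) ^ (1 / (2 : ℝ)) * (∫⁻ x, g x ^ (2 : ℝ) ∂μ) ^ (1 / (2 : ℝ))) ^ 2 := by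
        gcongr
    _ = _ := by
        rw [mul_pow, ← ENNReal.rpow_natCast, ← ENNReal.rpow_mul, ← ENNReal.rpow_natCast,
          ← ENNReal.rpow_mul]
        norm_num

lemma tsum_mul_sq_le {ι : Type*} (f g : ι → ENNReal) :
    (∑' i, f i * g i) ^ 2 ≤ (∑' i, f i ^ 2) * ∑' i, g i ^ 2 := by
  let _ : MeasurableSpace ι := ⊤
  have : MeasurableSingletonClass ι := ⟨fun _ => trivial⟩
  have := lintegral_mul_sq_le (μ := Measure.count) (f := f) (g := g)
    measurable_from_top.aemeasurable measurable_from_top.aemeasurable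
  simpa [lintegral_count] using this

lemma enorm_sq_eq_lintegral {X : Type*} [MeasurableSpace X] {μ : Measure X} (u : Lp ℂ 2 μ) :
    ‖u‖ₑ ^ 2 = ∫⁻ x, ‖u x‖ₑ ^ 2 ∂μ := by
  rw [Lp.enorm_def, eLpNorm_eq_lintegral_rpow_enorm_toReal two_ne_zero ENNReal.ofNat_ne_top,
    ← ENNReal.rpow_natCast, ← ENNReal.rpow_mul]
  norm_num

lemma summable_exp_neg_abs_int : Summable fun d : ℤ => Real.exp (-(|(d : ℝ)| / 4)) := by
  have hgeo : Summable fun n : ℕ => Real.exp (-((n : ℝ) / 4)) := by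
    have : Summable fun n : ℕ => Real.exp (-(1 / 4)) ^ n :=
      summable_geometric_of_lt_one (Real.exp_pos _).le (Real.exp_lt_one_iff.mpr (by norm_num))
    refine this.congr fun n => ?_
    rw [← Real.exp_nat_mul]; congr 1; ring
  refine Summable.of_nat_of_neg ?_ ?_
  · exact hgeo.congr fun n => by simp
  · exact hgeo.congr fun n => by simp

lemma exists_tsum_exp_le : ∃ C : ℝ, 0 ≤ C ∧ ∀ y : ℝ,
    ∑' j : ℤ, ENNReal.ofReal (Real.exp (-(|y - j| / 4))) ≤ ENNReal.ofReal C := by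
  refine ⟨∑' d : ℤ, Real.exp (1 / 4) * Real.exp (-(|(d : ℝ)| / 4)),
    tsum_nonneg fun _ => by positivity, fun y => ?_⟩
  rw [ENNReal.ofReal_tsum_of_nonneg (fun _ => by positivity)
    (summable_exp_neg_abs_int.mul_left _),
    ← (Equiv.subLeft ⌊y⌋).tsum_eq fun d : ℤ =>
      ENNReal.ofReal (Real.exp (1 / 4) * Real.exp (-(|(d : ℝ)| / 4)))]
  refine ENNReal.tsum_le_tsum fun j => ENNReal.ofReal_le_ofReal ?_
  rw [← Real.exp_add, Real.exp_le_exp, Equiv.subLeft_apply]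
  push_cast
  have h1 : |(⌊y⌋ : ℝ) - j| ≤ |(⌊y⌋ : ℝ) - y| + |y - j| := abs_sub_le _ _ _
  have h2 : |(⌊y⌋ : ℝ) - y| ≤ 1 := by
    rw [abs_le]; constructor <;> linarith [Int.floor_le y, Int.lt_floor_add_one y]
  linarith

lemma measurable_colInt {h : ℝ → ℂ} (hh : Measurable h) (j : ℤ) {x : ℝ → ℂ}
    (hx : AEStronglyMeasurable x (volume.restrict (expBlock j))) : Measurable (colInt h j x) := by
  have hcongr : colInt h j x = fun t => ∫ s in expBlock j, h (t + s) * hx.mk x s := by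
    ext t
    refine integral_congr_ae ?_
    filter_upwards [hx.ae_eq_mk] with s hs
    rw [hs]
  rw [hcongr]
  apply StronglyMeasurable.measurable
  apply StronglyMeasurable.integral_prod_right
  apply Measurable.stronglyMeasurable
  exact (hh.comp (measurable_fst.add measurable_snd)).mul
    (hx.stronglyMeasurable_mk.measurable.comp measurable_snd)

lemma tsum_blockMass (u : HSp) : ∑' j, blockMass j u = ‖u‖ₑ ^ 2 := by
  rw [enorm_sq_eq_lintegral]
  simp only [blockMass]
  rw [← lintegral_iUnion measurableSet_expBlock pairwise_disjoint_expBlock, iUnion_expBlock]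

/-- The Schur test over the blocks: a Hankel operator is controlled by its columns. -/
lemma exists_enorm_sq_le_tsum_colForm : ∃ C : ℝ, 0 ≤ C ∧ ∀ (h : ℝ → ℂ) (H : HSp →L[ℂ] HSp),
    Measurable h → IsHankel h H →
      ∀ u : HSp, ‖H u‖ₑ ^ 2 ≤ ENNReal.ofReal C * ∑' j, colForm h j u := by
  obtain ⟨C, hC0, hC⟩ := exists_tsum_exp_le
  refine ⟨C, hC0, fun h H hh hH u => ?_⟩
  have hpt : ∀ᵐ t ∂muP, ‖H u t‖ₑ ^ 2 ≤ ENNReal.ofReal C * ∑' j : ℤ,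
      ENNReal.ofReal (Real.exp (|Real.log t - j| / 4)) * ‖colInt h j u t‖ₑ ^ 2 := by
    filter_upwards [hH u] with t ht
    have h1 : ‖H u t‖ₑ ≤ ∑' j : ℤ, ‖colInt h j u t‖ₑ := by
      rw [ht]
      by_cases hmul : IntegrableOn (fun s => h (t + s) * u s) (Ioi (0 : ℝ))
      · rw [← iUnion_expBlock] at hmul ⊢
        rw [← (hasSum_integral_iUnion measurableSet_expBlock pairwise_disjoint_expBlock
          hmul).tsum_eq]
        exact enorm_tsum_le_tsum_enorm
      · rw [integral_undef hmul]; simp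
    set y := Real.log t
    have h2 : ∀ j : ℤ, ‖colInt h j u t‖ₑ = ENNReal.ofReal (Real.exp (-(|y - j| / 8))) *
        (ENNReal.ofReal (Real.exp (|y - j| / 8)) * ‖colInt h j u t‖ₑ) := by
      intro j
      rw [← mul_assoc, ← ENNReal.ofReal_mul (by positivity), ← Real.exp_add]
      simp
    have h3 : ∀ z : ℝ, ENNReal.ofReal (Real.exp (z / 8)) ^ 2 =
        ENNReal.ofReal (Real.exp (z / 4)) := by
      intro z
      rw [← ENNReal.ofReal_pow (by positivity), ← Real.exp_nat_mul]
      congr 2; push_cast; ring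
    calc ‖H u t‖ₑ ^ 2 ≤ (∑' j : ℤ, ‖colInt h j u t‖ₑ) ^ 2 := by gcongr
      _ = (∑' j : ℤ, ENNReal.ofReal (Real.exp (-(|y - j| / 8))) *
          (ENNReal.ofReal (Real.exp (|y - j| / 8)) * ‖colInt h j u t‖ₑ)) ^ 2 := by
          congr 1; exact tsum_congr h2
      _ ≤ _ := tsum_mul_sq_le _ _
      _ ≤ _ := by
          gcongr ?_ * ?_
          · refine le_trans (le_of_eq (tsum_congr fun j => ?_)) (hC y)
            rw [← neg_div, h3, neg_div]
          · refine le_of_eq (tsum_congr fun j => ?_)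
            rw [mul_pow, h3]
  rw [enorm_sq_eq_lintegral]
  refine (lintegral_mono_ae hpt).trans ?_
  rw [lintegral_const_mul' _ _ ENNReal.ofReal_ne_top, lintegral_tsum]
  · rfl
  · intro j
    have hu : AEStronglyMeasurable u (volume.restrict (expBlock j)) :=
      (Lp.aestronglyMeasurable u).mono_measure
        (Measure.restrict_mono (expBlock_subset j) le_rfl)
    have := measurable_colInt hh j hu
    exact Measurable.aemeasurable (by fun_prop)

lemma lintegral_exp_log_lt_top :
    ∫⁻ τ in Ioi (0 : ℝ), ENNReal.ofReal (Real.exp (|Real.log τ| / 4) * (1 + τ) ^ (-(7 / 4) : ℝ))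
      < ⊤ := by
  have h1 : IntegrableOn (fun τ : ℝ => τ ^ (-(1 / 4) : ℝ)) (Ioc 0 1) := by
    rw [← intervalIntegrable_iff_integrableOn_Ioc_of_le zero_le_one]
    exact intervalIntegral.intervalIntegrable_rpow' (by norm_num)
  have h2 : IntegrableOn (fun τ : ℝ => τ ^ (-(3 / 2) : ℝ)) (Ioi 1) :=
    integrableOn_Ioi_rpow_of_lt (by norm_num) one_pos
  have hpos : ∀ (b : ℝ) {s : Set ℝ}, s ⊆ Ioi 0 → MeasurableSet s →
      0 ≤ᵐ[volume.restrict s] fun τ : ℝ => τ ^ b := fun b s hs hm => by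
    filter_upwards [ae_restrict_mem hm] with τ hτ
    exact Real.rpow_nonneg (le_of_lt (hs hτ)) _
  rw [← Ioc_union_Ioi_eq_Ioi (zero_le_one : (0 : ℝ) ≤ 1)]
  refine (lintegral_union_le _ _ _).trans_lt (ENNReal.add_lt_top.mpr ⟨?_, ?_⟩)
  · refine lt_of_le_of_lt ?_ h1.lintegral_lt_top
    refine setLIntegral_mono' measurableSet_Ioc fun τ hτ => ENNReal.ofReal_le_ofReal ?_
    rw [abs_of_nonpos (Real.log_nonpos hτ.1.le hτ.2), Real.rpow_def_of_pos hτ.1]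
    have : (1 + τ) ^ (-(7 / 4) : ℝ) ≤ 1 :=
      Real.rpow_le_one_of_one_le_of_nonpos (by linarith [hτ.1]) (by norm_num)
    calc _ ≤ Real.exp (-Real.log τ / 4) * 1 := by gcongr
      _ = _ := by rw [mul_one]; congr 1; ring
  · refine lt_of_le_of_lt ?_ h2.lintegral_lt_top
    refine setLIntegral_mono' measurableSet_Ioi fun τ hτ => ENNReal.ofReal_le_ofReal ?_
    have hτ0 : (0 : ℝ) < τ := one_pos.trans hτ
    rw [abs_of_nonneg (Real.log_nonneg (le_of_lt hτ))]
    have : (1 + τ) ^ (-(7 / 4) : ℝ) ≤ τ ^ (-(7 / 4) : ℝ) :=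
      Real.rpow_le_rpow_of_nonpos hτ0 (by linarith) (by norm_num)
    calc _ ≤ Real.exp (Real.log τ / 4) * τ ^ (-(7 / 4) : ℝ) := by gcongr
      _ = _ := by
        rw [Real.rpow_def_of_pos hτ0, Real.rpow_def_of_pos hτ0, ← Real.exp_add]
        congr 1; ring

lemma exists_lintegral_weight_le : ∃ C : ℝ, 0 ≤ C ∧ ∀ j : ℤ,
    ∫⁻ t in Ioi (0 : ℝ), ENNReal.ofReal (Real.exp (|Real.log t - j| / 4)) *
      ENNReal.ofReal (Real.exp (-j) * (1 + t * Real.exp (-j)) ^ (-(7 / 4) : ℝ))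
      ≤ ENNReal.ofReal C := by
  refine ⟨(∫⁻ τ in Ioi (0 : ℝ),
    ENNReal.ofReal (Real.exp (|Real.log τ| / 4) * (1 + τ) ^ (-(7 / 4) : ℝ))).toReal,
    ENNReal.toReal_nonneg, fun j => le_of_eq ?_⟩
  rw [ENNReal.ofReal_toReal lintegral_exp_log_lt_top.ne]
  set b : ℝ := Real.exp (-j) with hb
  have hbpos : 0 < b := Real.exp_pos _
  have hmap := Real.map_volume_mul_left (a := b) hbpos.ne'
  have hvol : (volume : Measure ℝ) =
      ENNReal.ofReal b • Measure.map (fun x => b * x) volume := by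
    rw [hmap, smul_smul, ← ENNReal.ofReal_mul hbpos.le, abs_of_pos (by positivity),
      mul_inv_cancel₀ hbpos.ne']
    simp
  rw [← lintegral_indicator measurableSet_Ioi, ← lintegral_indicator measurableSet_Ioi]
  conv_rhs => rw [hvol]
  rw [lintegral_smul_measure, (measurableEmbedding_mulLeft₀ hbpos.ne').lintegral_map,
    smul_eq_mul, ← lintegral_const_mul' _ _ ENNReal.ofReal_ne_top]
  refine lintegral_congr fun t => ?_
  by_cases ht : 0 < t
  · rw [indicator_of_mem (show t ∈ Ioi (0 : ℝ) from ht),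
      indicator_of_mem (show b * t ∈ Ioi (0 : ℝ) from mul_pos hbpos ht),
      Real.log_mul hbpos.ne' ht.ne', hb, Real.log_exp, ← hb, ← ENNReal.ofReal_mul (by positivity),
      ← ENNReal.ofReal_mul (by positivity), mul_comm t b,
      show -(j : ℝ) + Real.log t = Real.log t - j by ring]
    congr 1; ring
  · rw [indicator_of_notMem (show t ∉ Ioi (0 : ℝ) from ht),
      indicator_of_notMem, mul_zero]
    exact fun h => ht ((mul_pos_iff_of_pos_left hbpos).mp h)

/-- Envelope of the size of the kernel `(t + s)⁻¹` for `s` in the block `j`, up to logarithms. -/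
def envelope (j : ℤ) (t : ℝ) : ℝ :=
  Real.exp (-j) * (1 + t * Real.exp (-j)) ^ (-(7 / 8) : ℝ)

lemma envelope_nonneg (j : ℤ) {t : ℝ} (ht : 0 < t) : 0 ≤ envelope j t := by
  unfold envelope; positivity

lemma envelope_sq_mul (j : ℤ) {t : ℝ} (ht : 0 < t) (B : ℝ) :
    2 * Real.exp j * (B * envelope j t) ^ 2 =
      Real.exp (-j) * (1 + t * Real.exp (-j)) ^ (-(7 / 4) : ℝ) * (2 * B ^ 2) := by
  have h1 : (0 : ℝ) ≤ 1 + t * Real.exp (-j) := by positivity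
  have h2 : (1 + t * Real.exp (-j)) ^ (-(7 / 4) : ℝ) =
      ((1 + t * Real.exp (-j)) ^ (-(7 / 8) : ℝ)) ^ 2 := by
    rw [← Real.rpow_natCast, ← Real.rpow_mul h1]; norm_num
  have h3 : Real.exp (j : ℝ) * Real.exp (-(j : ℝ)) = 1 := by rw [← Real.exp_add]; simp
  rw [h2, envelope]
  linear_combination 2 * B ^ 2 * Real.exp (-(j : ℝ)) *
    ((1 + t * Real.exp (-j)) ^ (-(7 / 8) : ℝ)) ^ 2 * h3

instance isFiniteMeasure_expBlock (j : ℤ) : IsFiniteMeasure (volume.restrict (expBlock j)) :=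
  ⟨by rw [Measure.restrict_apply_univ]
      exact (volume_expBlock_le j).trans_lt ENNReal.ofReal_lt_top⟩

lemma restrict_expBlock_le (j : ℤ) : volume.restrict (expBlock j) ≤ muP :=
  Measure.restrict_mono (expBlock_subset j) le_rfl

lemma lintegral_expBlock_const_le (j : ℤ) {b : ℝ} (f : ℝ → ℂ)
    (hf : ∀ s ∈ expBlock j, ‖f s‖ ≤ b) :
    ∫⁻ s in expBlock j, ‖f s‖ₑ ^ 2 ≤ ENNReal.ofReal (2 * Real.exp j * b ^ 2) := by
  calc ∫⁻ s in expBlock j, ‖f s‖ₑ ^ 2 ≤ ∫⁻ _s in expBlock j, ENNReal.ofReal b ^ 2 := by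
        refine setLIntegral_mono' (measurableSet_expBlock j) fun s hs => ?_
        gcongr
        rw [← ofReal_norm]
        exact ENNReal.ofReal_le_ofReal (hf s hs)
    _ = ENNReal.ofReal b ^ 2 * volume (expBlock j) := setLIntegral_const _ _
    _ ≤ ENNReal.ofReal b ^ 2 * ENNReal.ofReal (2 * Real.exp j) := by
        gcongr; exact volume_expBlock_le j
    _ ≤ _ := by
        rcases le_total 0 b with hb | hb
        · rw [← ENNReal.ofReal_pow hb, ← ENNReal.ofReal_mul (by positivity), mul_comm]
        · simp [ENNReal.ofReal_of_nonpos hb]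

lemma enorm_integral_mul_sq_le (j : ℤ) {b : ℝ} (k x : ℝ → ℂ)
    (hx : AEStronglyMeasurable x (volume.restrict (expBlock j)))
    (hk : ∀ s ∈ expBlock j, ‖k s‖ ≤ b) :
    ‖∫ s in expBlock j, k s * x s‖ₑ ^ 2 ≤
      ENNReal.ofReal (2 * Real.exp j * b ^ 2) * blockMass j x := by
  calc ‖∫ s in expBlock j, k s * x s‖ₑ ^ 2
      ≤ (∫⁻ s in expBlock j, ENNReal.ofReal b * ‖x s‖ₑ) ^ 2 := by
        gcongr
        refine (enorm_integral_le_lintegral_enorm _).trans ?_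
        refine setLIntegral_mono' (measurableSet_expBlock j) fun s hs => ?_
        rw [enorm_mul]
        gcongr
        rw [← ofReal_norm]
        exact ENNReal.ofReal_le_ofReal (hk s hs)
    _ ≤ (∫⁻ _s in expBlock j, ENNReal.ofReal b ^ 2) * blockMass j x :=
        lintegral_mul_sq_le aemeasurable_const hx.enorm
    _ ≤ _ := by
        gcongr
        have : ∀ _s ∈ expBlock j, ‖((max b 0 : ℝ) : ℂ)‖ ≤ max b 0 := fun s _ => by
          rw [Complex.norm_real, Real.norm_of_nonneg (le_max_right _ _)]
        refine le_trans (lintegral_mono fun s => ?_)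
          ((lintegral_expBlock_const_le j (fun _ => ((max b 0 : ℝ) : ℂ)) this).trans ?_)
        · rw [← ofReal_norm, Complex.norm_real, Real.norm_of_nonneg (le_max_right _ _)]
          gcongr; exact le_max_left _ _
        · apply ENNReal.ofReal_le_ofReal
          gcongr ?_ * ?_
          rcases le_total 0 b with hb | hb
          · rw [max_eq_left hb]
          · rw [max_eq_right hb]; simpa using sq_nonneg b

lemma exists_lintegral_weight_mul_le : ∃ C : ℝ, 0 ≤ C ∧ ∀ (j : ℤ) (F : ℝ → ENNReal) (A : ENNReal),
    (∀ t > 0, F t ≤ ENNReal.ofReal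
      (Real.exp (-j) * (1 + t * Real.exp (-j)) ^ (-(7 / 4) : ℝ)) * A) →
    ∫⁻ t in Ioi (0 : ℝ), ENNReal.ofReal (Real.exp (|Real.log t - j| / 4)) * F t ≤
      ENNReal.ofReal C * A := by
  obtain ⟨C, hC0, hC⟩ := exists_lintegral_weight_le
  refine ⟨C, hC0, fun j F A hF => ?_⟩
  calc _ ≤ ∫⁻ t in Ioi (0 : ℝ), ENNReal.ofReal (Real.exp (|Real.log t - j| / 4)) *
      ENNReal.ofReal (Real.exp (-j) * (1 + t * Real.exp (-j)) ^ (-(7 / 4) : ℝ)) * A := by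
        refine setLIntegral_mono' measurableSet_Ioi fun t ht => ?_
        rw [mul_assoc]
        gcongr
        exact hF t ht
    _ ≤ _ := by
        rw [lintegral_mul_const _ (by fun_prop)]
        gcongr
        exact hC j

lemma exists_rpow_neg_log_le {a : ℝ} (ha : 0 < a) : ∃ C : ℝ, 0 ≤ C ∧ ∀ (j : ℤ) (t u : ℝ), 0 < t →
    t + Real.exp j ≤ u → u ≤ t + Real.exp (j + 1) →
      u⁻¹ * (1 + |Real.log u|) ^ (-a) ≤ C * (1 + |(j : ℝ)|) ^ (-a) * envelope j t := by
  refine ⟨(8 * a) ^ a * Real.exp (1 / 4), by positivity, fun j t u ht h1 h2 => ?_⟩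
  set τ := t * Real.exp (-j) with hτ
  have hτ0 : 0 < τ := by positivity
  have hjj : Real.exp (-(j : ℝ)) * Real.exp j = 1 := by rw [← Real.exp_add]; simp
  have ht' : t = Real.exp j * τ := by rw [hτ]; linear_combination -t * hjj
  have hu1 : Real.exp j * (1 + τ) ≤ u := by linarith
  have hu2 : u ≤ Real.exp (j + 1) * (1 + τ) := by
    refine h2.trans ?_
    have : t ≤ Real.exp (j + 1) * τ := by
      rw [ht']; gcongr; linarith
    linarith
  have hu0 : 0 < u := lt_of_lt_of_le (by positivity) hu1
  set v := Real.log u - j with hv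
  have hlogτ : 0 ≤ Real.log (1 + τ) := Real.log_nonneg (by linarith)
  have hv0 : 0 ≤ v := by
    have := Real.log_le_log (by positivity) hu1
    rw [Real.log_mul (by positivity) (by positivity), Real.log_exp] at this
    linarith
  have hv1 : v ≤ 1 + Real.log (1 + τ) := by
    have := Real.log_le_log hu0 hu2
    rw [Real.log_mul (by positivity) (by positivity), Real.log_exp] at this
    linarith
  have hw : (1 + v) ^ a ≤ (8 * a) ^ a * Real.exp (1 / 4) * (1 + τ) ^ (1 / 8 : ℝ) := by
    have e1 : 1 + v ≤ 8 * a * Real.exp ((1 + v) / (8 * a)) := by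
      have := Real.add_one_le_exp ((1 + v) / (8 * a))
      calc 1 + v = 8 * a * ((1 + v) / (8 * a)) := by field_simp
        _ ≤ _ := by gcongr; linarith
    calc (1 + v) ^ a ≤ (8 * a * Real.exp ((1 + v) / (8 * a))) ^ a := by gcongr
      _ = (8 * a) ^ a * Real.exp ((1 + v) / 8) := by
          rw [Real.mul_rpow (by positivity) (by positivity), ← Real.exp_mul]
          congr 2; field_simp
      _ ≤ (8 * a) ^ a * Real.exp (1 / 4 + Real.log (1 + τ) * (1 / 8)) := by
          gcongr; linarith
      _ = _ := by
          rw [Real.exp_add, Real.rpow_def_of_pos (x := 1 + τ) (by positivity), mul_assoc]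
  have hj : 1 + |(j : ℝ)| ≤ (1 + |Real.log u|) * (1 + v) := by
    have : |(j : ℝ)| ≤ |Real.log u| + v := by
      have := abs_sub_abs_le_abs_sub (j : ℝ) (Real.log u)
      rw [abs_sub_comm, ← hv, abs_of_nonneg hv0] at this
      linarith
    nlinarith [abs_nonneg (Real.log u)]
  have hlog : (1 + |Real.log u|) ^ (-a) ≤ (1 + |(j : ℝ)|) ^ (-a) * (1 + v) ^ a := by
    have := Real.rpow_le_rpow_of_nonpos (by positivity) hj (by linarith : -a ≤ 0)
    rw [Real.mul_rpow (by positivity) (by positivity), Real.rpow_neg (x := 1 + v) (by positivity),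
      ← div_eq_mul_inv, div_le_iff₀ (by positivity)] at this
    exact this
  have hinv : u⁻¹ ≤ Real.exp (-j) * (1 + τ)⁻¹ := by
    rw [Real.exp_neg, ← mul_inv]
    gcongr
  have henv : envelope j t = Real.exp (-j) * (1 + τ)⁻¹ * (1 + τ) ^ (1 / 8 : ℝ) := by
    rw [envelope, ← hτ, mul_assoc, ← Real.rpow_neg_one, ← Real.rpow_add (by positivity)]
    norm_num
  calc u⁻¹ * (1 + |Real.log u|) ^ (-a)
      ≤ Real.exp (-j) * (1 + τ)⁻¹ * ((1 + |(j : ℝ)|) ^ (-a) *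
        ((8 * a) ^ a * Real.exp (1 / 4) * (1 + τ) ^ (1 / 8 : ℝ))) := by
        gcongr
        exact hlog.trans (by gcongr)
    _ = _ := by rw [henv]; ring

/-- Extension by zero of a function on the block `j`. -/
def blockExt (j : ℤ) (φ : ℝ → ℂ) (hφ : MemLp φ 2 (volume.restrict (expBlock j))) : HSp :=
  MemLp.toLp ((expBlock j).indicator φ) (by
    rw [memLp_indicator_iff_restrict (measurableSet_expBlock j),
      Measure.restrict_restrict (measurableSet_expBlock j),
      inter_eq_left.mpr (expBlock_subset j)]
    exact hφ)

lemma inner_blockExt (j : ℤ) (φ : ℝ → ℂ) (hφ : MemLp φ 2 (volume.restrict (expBlock j)))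
    (x : HSp) : inner ℂ (blockExt j φ hφ) x = ∫ s in expBlock j, x s * (starRingEnd ℂ) (φ s) := by
  rw [L2.inner_def]
  have : (fun s => inner ℂ (blockExt j φ hφ s) (x s)) =ᵐ[muP]
      (expBlock j).indicator fun s => x s * (starRingEnd ℂ) (φ s) := by
    filter_upwards [MemLp.coeFn_toLp (f := (expBlock j).indicator φ) (μ := muP) (p := 2) _]
      with s hs
    rw [blockExt, hs, RCLike.inner_apply]
    by_cases h : s ∈ expBlock j <;> simp [h]
  rw [integral_congr_ae this, integral_indicator (measurableSet_expBlock j),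
    Measure.restrict_restrict (measurableSet_expBlock j), inter_eq_left.mpr (expBlock_subset j)]

lemma exists_colForm_le : ∃ C : ℝ, 0 ≤ C ∧ ∀ (h : ℝ → ℂ) (j : ℤ) (B : ℝ),
    (∀ t > 0, ∀ s ∈ expBlock j, ‖h (t + s)‖ ≤ B * envelope j t) → ∀ x : HSp,
      colForm h j x ≤ ENNReal.ofReal (C * B ^ 2) * blockMass j x := by
  obtain ⟨C, hC0, hC⟩ := exists_lintegral_weight_mul_le
  refine ⟨C * 2, by positivity, fun h j B hB x => ?_⟩
  have hx := (Lp.aestronglyMeasurable x).mono_measure (restrict_expBlock_le j)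
  refine (hC j _ (ENNReal.ofReal (2 * B ^ 2) * blockMass j x) fun t ht => ?_).trans (le_of_eq ?_)
  · refine (enorm_integral_mul_sq_le j _ _ hx (hB t ht)).trans (le_of_eq ?_)
    rw [envelope_sq_mul j ht, ENNReal.ofReal_mul (by positivity), mul_assoc]
  · rw [← mul_assoc, ← ENNReal.ofReal_mul hC0, mul_assoc]

lemma exists_finset_colForm_le_of_sq_integrable : ∃ C : ℝ, 0 ≤ C ∧ ∀ (h : ℝ → ℂ) (j : ℤ) (B : ℝ),
    Measurable h →
    (∀ t > 0, ∀ s ∈ expBlock j, ‖h (t + s)‖ ≤ B * envelope j t) → ∀ r : ℕ, 1 ≤ r →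
      ∃ S : Finset HSp, S.card ≤ r ∧ ∀ x : HSp, (∀ φ ∈ S, inner ℂ φ x = 0) →
        colForm h j x ≤ ENNReal.ofReal (C * (B * (r : ℝ) ^ (-(1 / 2) : ℝ)) ^ 2) *
          blockMass j x := by
  classical
  obtain ⟨C, hC0, hC⟩ := exists_lintegral_weight_mul_le
  refine ⟨C * 2, by positivity, fun h j B hh hB r hr => ?_⟩
  have hr0 : (0 : ℝ) < r := by exact_mod_cast hr
  let E := Lp ℂ 2 (volume.restrict (expBlock j))
  have hmeas : ∀ t, AEStronglyMeasurable (fun s => (starRingEnd ℂ) (h (t + s)))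
      (volume.restrict (expBlock j)) := fun t =>
    (Complex.continuous_conj.measurable.comp
      (hh.comp (measurable_const_add t))).aestronglyMeasurable
  have hsum : ∀ S : Finset E, Orthonormal ℂ (fun x : S => (x : E)) →
      ∑ e ∈ S, colForm h j e ≤ ENNReal.ofReal (C * (2 * B ^ 2)) := by
    intro S hS
    have hmc : ∀ e ∈ S, Measurable fun t => ENNReal.ofReal (Real.exp (|Real.log t - j| / 4)) *
        ‖colInt h j e t‖ₑ ^ 2 := fun e _ => by
      have := measurable_colInt hh j (Lp.aestronglyMeasurable e)
      fun_prop
    have h1 : ∑ e ∈ S, colForm h j e = ∫⁻ t in Ioi (0 : ℝ),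
        ENNReal.ofReal (Real.exp (|Real.log t - j| / 4)) * ∑ e ∈ S, ‖colInt h j e t‖ₑ ^ 2 := by
      simp only [colForm, Finset.mul_sum]
      rw [lintegral_finsetSum S hmc]
    rw [h1, ENNReal.ofReal_mul hC0]
    refine hC j _ _ fun t ht => ?_
    rw [← ENNReal.ofReal_mul (by positivity), ← envelope_sq_mul j ht]
    have hbound : ∀ s ∈ expBlock j, ‖(starRingEnd ℂ) (h (t + s))‖ ≤ B * envelope j t :=
      fun s hs => by rw [RCLike.norm_conj]; exact hB t ht s hs
    have hmem : MemLp (fun s => (starRingEnd ℂ) (h (t + s))) 2 (volume.restrict (expBlock j)) :=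
      MemLp.of_bound (hmeas t) (B * envelope j t)
        ((ae_restrict_iff' (measurableSet_expBlock j)).mpr (Eventually.of_forall hbound))
    let g : E := hmem.toLp _
    have hg : ∀ e : E, ‖colInt h j e t‖ = ‖inner ℂ e g‖ := by
      intro e
      rw [norm_inner_symm, L2.inner_def]
      congr 1
      refine integral_congr_ae ?_
      filter_upwards [hmem.coeFn_toLp] with s hs
      rw [hs, RCLike.inner_apply, starRingEnd_self_apply, mul_comm]
    calc ∑ e ∈ S, ‖colInt h j e t‖ₑ ^ 2 = ENNReal.ofReal (∑ e ∈ S, ‖inner ℂ e g‖ ^ 2) := by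
          rw [ENNReal.ofReal_sum_of_nonneg fun _ _ => by positivity]
          refine Finset.sum_congr rfl fun e _ => ?_
          rw [← hg, ENNReal.ofReal_pow (norm_nonneg _), ofReal_norm]
      _ ≤ ENNReal.ofReal (‖g‖ ^ 2) := by
          apply ENNReal.ofReal_le_ofReal
          rw [← Finset.sum_coe_sort]
          exact hS.sum_inner_products_le g
      _ = ∫⁻ s in expBlock j, ‖(starRingEnd ℂ) (h (t + s))‖ₑ ^ 2 := by
          rw [ENNReal.ofReal_pow (norm_nonneg _), ofReal_norm, enorm_sq_eq_lintegral]
          refine lintegral_congr_ae ?_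
          filter_upwards [hmem.coeFn_toLp] with s hs
          rw [hs]
      _ ≤ _ := lintegral_expBlock_const_le j _ hbound
  have hhom : ∀ (c : ℂ) (e : E), colForm h j (c • e : E) = ‖c‖ₑ ^ 2 * colForm h j e := by
    intro c e
    have hcol : ∀ t, colInt h j (c • e : E) t = c * colInt h j e t := by
      intro t
      rw [colInt, colInt, ← integral_const_mul]
      refine integral_congr_ae ?_
      filter_upwards [Lp.coeFn_smul c e] with s hs
      rw [hs, Pi.smul_apply, smul_eq_mul]; ring
    rw [colForm, colForm, ← lintegral_const_mul' _ _ (by finiteness)]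
    refine lintegral_congr fun t => ?_
    rw [hcol, enorm_mul]; ring
  obtain ⟨S, hcard, hS⟩ := exists_finset_orthogonal_le (fun e : E => colForm h j e) hhom hsum hr
  refine ⟨S.image fun e : E => blockExt j e (Lp.memLp e), Finset.card_image_le.trans hcard,
    fun x hx => ?_⟩
  have hxm : MemLp x 2 (volume.restrict (expBlock j)) :=
    (Lp.memLp x).mono_measure (restrict_expBlock_le j)
  let y : E := hxm.toLp x
  have hy : y =ᵐ[volume.restrict (expBlock j)] x := hxm.coeFn_toLp
  have horth : ∀ e ∈ S, inner ℂ e y = 0 := by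
    intro e he
    have := hx _ (Finset.mem_image_of_mem _ he)
    rw [inner_blockExt] at this
    rw [← this, L2.inner_def]
    refine integral_congr_ae ?_
    filter_upwards [hy] with s hs
    rw [hs, RCLike.inner_apply]
  have hQ : colForm h j y = colForm h j x := by
    refine lintegral_congr fun t => ?_
    congr 3
    refine integral_congr_ae ?_
    filter_upwards [hy] with s hs
    rw [hs]
  have hM : ‖y‖ₑ ^ 2 = blockMass j x := by
    rw [enorm_sq_eq_lintegral]
    refine lintegral_congr_ae ?_
    filter_upwards [hy] with s hs
    rw [hs]
  have := hS y horth
  rw [hQ, hM] at this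
  refine this.trans (le_of_eq ?_)
  congr 1
  rw [← ENNReal.ofReal_natCast, ← ENNReal.ofReal_div_of_pos hr0]
  congr 1
  rw [mul_pow B, ← Real.rpow_natCast ((r : ℝ) ^ (-(1 / 2) : ℝ)), ← Real.rpow_mul hr0.le]
  norm_num [Real.rpow_neg_one]
  ring

lemma exists_mem_Ioc_node {a δ s : ℝ} (hδ : 0 < δ) {r : ℕ} (hs : s ∈ Ioc a (a + r * δ)) :
    ∃ i < r, s ∈ Ioc (a + i * δ) (a + (i + 1 : ℕ) * δ) := by
  have hpos : 0 < (s - a) / δ := div_pos (by linarith [hs.1]) hδ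
  have hc : 0 < ⌈(s - a) / δ⌉₊ := Nat.ceil_pos.mpr hpos
  have hle : ⌈(s - a) / δ⌉₊ ≤ r := by
    rw [Nat.ceil_le, div_le_iff₀ hδ]; linarith [hs.2]
  refine ⟨⌈(s - a) / δ⌉₊ - 1, by omega, ?_, ?_⟩
  · have : ((⌈(s - a) / δ⌉₊ - 1 : ℕ) : ℝ) < (s - a) / δ := by
      apply Nat.lt_ceil.mp; omega
    rw [lt_div_iff₀ hδ] at this
    linarith
  · have := Nat.le_ceil ((s - a) / δ)
    rw [div_le_iff₀ hδ] at this
    rw [show ⌈(s - a) / δ⌉₊ - 1 + 1 = ⌈(s - a) / δ⌉₊ by omega]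
    linarith

lemma iteratedDerivWithin_Icc_eq {N : ℕ} {h : ℝ → ℂ} (hh : ContDiffOn ℝ N h (Ioi 0)) {p q y : ℝ}
    (hp : 0 < p) (hpq : p < q) (hy : y ∈ Icc p q) :
    iteratedDerivWithin N h (Icc p q) y = iteratedDerivWithin N h (Ioi 0) y := by
  have hy0 : y ∈ Ioi (0 : ℝ) := hp.trans_le hy.1
  have hc : ContDiffAt ℝ N h y := hh.contDiffAt (Ioi_mem_nhds hy0)
  rw [iteratedDerivWithin_eq_iteratedDeriv (uniqueDiffOn_Icc hpq) hc hy,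
    iteratedDerivWithin_eq_iteratedDeriv (uniqueDiffOn_Ioi 0) hc hy0]

/-- Columns of a smooth Hankel kernel are small on functions orthogonal to piecewise
polynomials. -/
lemma exists_finset_colForm_le_of_contDiffOn (N : ℕ) : ∃ C : ℝ, 0 ≤ C ∧
    ∀ (h : ℝ → ℂ) (j : ℤ) (B : ℝ), 0 ≤ B → Measurable h → ContDiffOn ℝ (N + 1 : ℕ) h (Ioi 0) →
    (∀ t > 0, ∀ s ∈ expBlock j, ‖h (t + s)‖ ≤ B * envelope j t) →
    (∀ t > 0, ∀ u ∈ Icc (t + Real.exp j) (t + Real.exp (j + 1)),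
      ‖iteratedDerivWithin (N + 1) h (Ioi 0) u‖ ≤ (u ^ (N + 1))⁻¹ * (B * envelope j t)) →
    ∀ r : ℕ, 1 ≤ r →
      ∃ S : Finset HSp, S.card ≤ (N + 1) * r ∧ ∀ x : HSp, (∀ φ ∈ S, inner ℂ φ x = 0) →
        colForm h j x ≤ ENNReal.ofReal (C * (B * (r : ℝ) ^ (-((N + 1 : ℕ) : ℝ))) ^ 2) *
          blockMass j x := by
  classical
  obtain ⟨C, hC0, hC⟩ := exists_lintegral_weight_mul_le
  refine ⟨C * 2 * (2 ^ (N + 1)) ^ 2, by positivity, fun h j B hB0 hh hsm hB hder r hr => ?_⟩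
  have hr0 : (0 : ℝ) < r := by exact_mod_cast hr
  set a := Real.exp (j : ℝ) with ha
  have ha0 : 0 < a := Real.exp_pos _
  set δ := (Real.exp (j + 1) - a) / r with hδ
  have hlen : Real.exp (j + 1) - a ≤ 2 * a := by
    rw [Real.exp_add]; nlinarith [Real.exp_one_lt_d9]
  have hδ0 : 0 < δ := div_pos (sub_pos.mpr (Real.exp_lt_exp.mpr (by linarith))) hr0
  have hδle : δ ≤ 2 * a / r := by rw [hδ]; gcongr
  have hblk : expBlock j = Ioc a (a + r * δ) := by
    rw [expBlock, hδ, mul_div_cancel₀ _ hr0.ne']; congr 1; ring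
  let node : ℕ → ℝ := fun i => a + i * δ
  have hnode : ∀ i, a ≤ node i := fun i => by
    have : 0 ≤ (i : ℝ) * δ := by positivity
    simp only [node]; linarith
  have hstep : ∀ i, node (i + 1) = node i + δ := fun i => by
    simp only [node]; push_cast; ring
  let φ : ℕ × ℕ → ℝ → ℂ := fun k =>
    (Ioc (node k.1) (node (k.1 + 1))).indicator fun s => (((s - node k.1) ^ k.2 : ℝ) : ℂ)
  have hφm : ∀ k, MemLp (φ k) 2 (volume.restrict (expBlock j)) := by
    intro k
    refine MemLp.of_bound (Measurable.aestronglyMeasurable ?_) (δ ^ k.2)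
      (Eventually.of_forall fun s => ?_)
    · exact Measurable.indicator (by fun_prop) measurableSet_Ioc
    · by_cases hs : s ∈ Ioc (node k.1) (node (k.1 + 1))
      · simp only [φ, indicator_of_mem hs, Complex.norm_real, norm_pow]
        have := hs.2
        rw [hstep] at this
        rw [Real.norm_of_nonneg (by linarith [hs.1])]
        gcongr
        · linarith [hs.1]
        · linarith
      · simp only [φ, indicator_of_notMem hs, norm_zero]; positivity
  let I : Finset (ℕ × ℕ) := Finset.range r ×ˢ Finset.range (N + 1)
  refine ⟨I.image fun k => blockExt j (φ k) (hφm k), ?_, fun x hx => ?_⟩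
  · refine Finset.card_image_le.trans (le_of_eq ?_)
    simp [I, mul_comm]
  have hxm : MemLp x 2 (volume.restrict (expBlock j)) :=
    (Lp.memLp x).mono_measure (restrict_expBlock_le j)
  have hφx : ∀ k ∈ I, ∫ s in expBlock j, φ k s * x s = 0 := by
    intro k hk
    have := hx _ (Finset.mem_image_of_mem _ hk)
    rw [inner_blockExt] at this
    rw [← this]
    refine integral_congr_ae (Eventually.of_forall fun s => ?_)
    by_cases hs : s ∈ Ioc (node k.1) (node (k.1 + 1))
    · simp only [φ, indicator_of_mem hs, Complex.conj_ofReal]; ring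
    · simp [φ, indicator_of_notMem hs]
  have hφi : ∀ k, Integrable (fun s => φ k s * x s) (volume.restrict (expBlock j)) := fun k =>
    (hφm k).integrable_mul hxm
  let c : ℝ → ℕ × ℕ → ℂ := fun t k => ((k.2.factorial : ℝ)⁻¹ : ℝ) •
    iteratedDerivWithin k.2 h (Icc (t + node k.1) (t + node (k.1 + 1))) (t + node k.1)
  let P : ℝ → ℝ → ℂ := fun t s => ∑ k ∈ I, c t k * φ k s
  have hcol : ∀ t > 0, colInt h j x t = ∫ s in expBlock j, (h (t + s) - P t s) * x s := by
    intro t ht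
    have hmul : Integrable (fun s => h (t + s) * x s) (volume.restrict (expBlock j)) := by
      refine (hxm.integrable one_le_two).bdd_mul (c := B * envelope j t)
        (hh.comp (measurable_const_add t)).aestronglyMeasurable ?_
      exact (ae_restrict_iff' (measurableSet_expBlock j)).mpr (Eventually.of_forall (hB t ht))
    have hPi : ∀ k ∈ I, Integrable (fun s => c t k * (φ k s * x s))
        (volume.restrict (expBlock j)) := fun k _ => (hφi k).const_mul _
    have hPeq : (fun s => (h (t + s) - P t s) * x s) =
        fun s => h (t + s) * x s - ∑ k ∈ I, c t k * (φ k s * x s) := by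
      ext s
      simp only [P, sub_mul, Finset.sum_mul, mul_assoc]
    rw [hPeq, integral_sub hmul (integrable_finsetSum _ hPi), integral_finsetSum _ hPi,
      Finset.sum_eq_zero, sub_zero]
    · rfl
    · intro k hk
      rw [integral_const_mul, hφx k hk, mul_zero]
  have hrem : ∀ t > 0, ∀ s ∈ expBlock j, ‖h (t + s) - P t s‖ ≤
      (2 ^ (N + 1) * (B * (r : ℝ) ^ (-((N + 1 : ℕ) : ℝ)))) * envelope j t := by
    intro t ht s hs
    have henv := envelope_nonneg j ht
    rw [hblk] at hs
    obtain ⟨i, hi, hsi⟩ := exists_mem_Ioc_node hδ0 hs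
    change s ∈ Ioc (node i) (node (i + 1)) at hsi
    have hlt : node i < node (i + 1) := hsi.1.trans_le hsi.2
    have hp0 : 0 < t + node i := by linarith [hnode i]
    have hpq : t + node i < t + node (i + 1) := by linarith
    have hPs : P t s = taylorWithinEval h N (Icc (t + node i) (t + node (i + 1)))
        (t + node i) (t + s) := by
      simp only [P, I]
      rw [taylor_within_apply, Finset.sum_product, Finset.sum_eq_single i]
      · refine Finset.sum_congr rfl fun m _ => ?_
        simp only [c, φ, indicator_of_mem hsi, Complex.real_smul]
        rw [add_sub_add_left_eq_sub]
        push_cast; ring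
      · intro i' _ hne
        refine Finset.sum_eq_zero fun m _ => ?_
        have : s ∉ Ioc (node i') (node (i' + 1)) := by
          intro hsi'
          have h1 := hsi.1.trans_le hsi'.2
          have h2 := hsi'.1.trans_le hsi.2
          simp only [node, add_lt_add_iff_left] at h1 h2
          have h1' := lt_of_mul_lt_mul_right h1 hδ0.le
          have h2' := lt_of_mul_lt_mul_right h2 hδ0.le
          norm_cast at h1' h2'
          omega
        simp [φ, indicator_of_notMem this]
      · intro hi'
        exact absurd (Finset.mem_range.mpr hi) hi'
    have hsub : Icc (t + node i) (t + node (i + 1)) ⊆ Ioi 0 := fun y hy => hp0.trans_le hy.1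
    have hup : t + node (i + 1) ≤ t + Real.exp (j + 1) := by
      have h1 : ((i + 1 : ℕ) : ℝ) ≤ r := by exact_mod_cast hi
      have h2 : a + r * δ = Real.exp (j + 1) := by
        rw [hδ, mul_div_cancel₀ _ hr0.ne']; ring
      have h3 : ((i + 1 : ℕ) : ℝ) * δ ≤ r * δ := by gcongr
      simp only [node]; linarith
    have hT := taylor_mean_remainder_bound (f := h) (n := N) (a := t + node i)
      (b := t + node (i + 1)) (x := t + s) (C := (a ^ (N + 1))⁻¹ * (B * envelope j t)) hpq.le
      (by have := hsm.mono hsub; push_cast at this; exact this)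
      ⟨by linarith [hsi.1], by linarith [hsi.2]⟩
      (fun y hy => by
        rw [iteratedDerivWithin_Icc_eq hsm hp0 hpq hy]
        have hy1 : a ≤ y := by linarith [hnode i, hy.1]
        refine (hder t ht y ⟨by linarith [hnode i, hy.1], hy.2.trans hup⟩).trans ?_
        gcongr)
    rw [← hPs, add_sub_add_left_eq_sub] at hT
    refine hT.trans ?_
    have hs1 : 0 ≤ s - node i := by linarith [hsi.1]
    have hs2 : s - node i ≤ 2 * a / r := by
      refine le_trans ?_ hδle
      have := hsi.2
      rw [hstep] at this
      linarith
    calc _ ≤ (a ^ (N + 1))⁻¹ * (B * envelope j t) * (s - node i) ^ (N + 1) := by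
          apply div_le_self (by positivity)
          exact_mod_cast Nat.succ_le_of_lt (Nat.factorial_pos N)
      _ ≤ (a ^ (N + 1))⁻¹ * (B * envelope j t) * (2 * a / r) ^ (N + 1) := by gcongr
      _ = _ := by
          rw [Real.rpow_neg hr0.le, Real.rpow_natCast, div_pow, mul_pow]
          field_simp
  refine (hC j _ (ENNReal.ofReal (2 * (2 ^ (N + 1) * (B * (r : ℝ) ^ (-((N + 1 : ℕ) : ℝ)))) ^ 2) *
    blockMass j x) fun t ht => ?_).trans (le_of_eq ?_)
  · rw [hcol t ht]
    refine (enorm_integral_mul_sq_le j _ _ hxm.1 (hrem t ht)).trans (le_of_eq ?_)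
    rw [envelope_sq_mul j ht, ENNReal.ofReal_mul (by positivity), mul_assoc]
  · rw [← mul_assoc, ← ENNReal.ofReal_mul hC0]
    congr 2
    ring

/-- A combination of two logarithmic decay rates. -/
def twoScale (α a ε L y : ℝ) : ℝ := ε * (1 + |y|) ^ (-α) + L * (1 + |y|) ^ (-a)

lemma twoScale_nonneg (α a : ℝ) {ε L : ℝ} (hε : 0 ≤ ε) (hL : 0 ≤ L) (y : ℝ) :
    0 ≤ twoScale α a ε L y := by
  unfold twoScale; positivity

lemma twoScale_mono (α a ε y : ℝ) {L L' : ℝ} (hL : L ≤ L') :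
    twoScale α a ε L y ≤ twoScale α a ε L' y := by
  unfold twoScale; gcongr

lemma exists_inv_mul_twoScale_le {α a : ℝ} (hα : 0 < α) (ha : 0 < a) : ∃ K : ℝ, 0 ≤ K ∧
    ∀ (ε L : ℝ) (j : ℤ) (t u : ℝ), 0 ≤ ε → 0 ≤ L → 0 < t → t + Real.exp j ≤ u →
      u ≤ t + Real.exp (j + 1) →
        u⁻¹ * twoScale α a ε L (Real.log u) ≤ K * twoScale α a ε L j * envelope j t := by
  obtain ⟨K₁, hK₁, h₁⟩ := exists_rpow_neg_log_le hα
  obtain ⟨K₂, hK₂, h₂⟩ := exists_rpow_neg_log_le ha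
  refine ⟨K₁ + K₂, by positivity, fun ε L j t u hε hL ht htu hut => ?_⟩
  have e := envelope_nonneg j ht
  have b₁ := mul_le_mul_of_nonneg_left (h₁ j t u ht htu hut) hε
  have b₂ := mul_le_mul_of_nonneg_left (h₂ j t u ht htu hut) hL
  have c₁ : 0 ≤ K₂ * (ε * (1 + |(j : ℝ)|) ^ (-α) * envelope j t) := by positivity
  have c₂ : 0 ≤ K₁ * (L * (1 + |(j : ℝ)|) ^ (-a) * envelope j t) := by positivity
  unfold twoScale
  linarith

/-- A singular value bound from finite-rank approximation of each column over a block. -/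
lemma exists_singVal_le_of_blocks {α a ν : ℝ} (hα : 0 < α) (ha : α < a) (haν : a < ν) (c : ℕ)
    {K : ℝ} (hK0 : 0 ≤ K)
    (hK : ∀ (ε L : ℝ) (j : ℤ) (t u : ℝ), 0 ≤ ε → 0 ≤ L → 0 < t → t + Real.exp j ≤ u →
      u ≤ t + Real.exp (j + 1) →
        u⁻¹ * twoScale α a ε L (Real.log u) ≤ K * twoScale α a ε L j * envelope j t)
    (R : (ℝ → ℂ) → ℤ → ℝ → Prop)
    (hR : ∃ C : ℝ, 0 ≤ C ∧ ∀ (h : ℝ → ℂ) (j : ℤ) (B : ℝ), 0 ≤ B → Measurable h → R h j B →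
      (∀ t > 0, ∀ s ∈ expBlock j, ‖h (t + s)‖ ≤ B * envelope j t) → ∀ r : ℕ, 1 ≤ r →
        ∃ S : Finset HSp, S.card ≤ c * r ∧ ∀ x : HSp, (∀ φ ∈ S, inner ℂ φ x = 0) →
          colForm h j x ≤ ENNReal.ofReal (C * (B * (r : ℝ) ^ (-ν)) ^ 2) * blockMass j x) :
    ∃ C : ℝ, ∀ (h : ℝ → ℂ) (H : HSp →L[ℂ] HSp) (ε L : ℝ), 0 ≤ ε → 0 ≤ L → Measurable h →
      IsHankel h H → (∀ u > 0, ‖h u‖ ≤ u⁻¹ * twoScale α a ε L (Real.log u)) →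
      (∀ j : ℤ, R h j (K * twoScale α a ε L j)) → ∀ n m : ℕ, 1 ≤ n →
        2 * c * (1 + 1 / (1 - a / ν)) * n < m →
          singVal H m ≤ C * (ε * (n : ℝ) ^ (-α) + L * (n : ℝ) ^ (-a)) := by
  obtain ⟨C₁, hC₁, hS⟩ := exists_enorm_sq_le_tsum_colForm
  obtain ⟨C₂, hC₂, hF⟩ := exists_colForm_le
  obtain ⟨C₃, hC₃, hT⟩ := hR
  refine ⟨√(C₁ * ((C₂ + C₃) * K ^ 2)), fun h H ε L hε hL hh hH hb hRh n m hn hm => ?_⟩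
  have hblock : ∀ j : ℤ, ∀ t > 0, ∀ s ∈ expBlock j,
      ‖h (t + s)‖ ≤ K * twoScale α a ε L j * envelope j t := fun j t ht s hs =>
    (hb _ (by linarith [expBlock_subset j hs, mem_Ioi.mp (expBlock_subset j hs)])).trans
      (hK ε L j t _ hε hL ht (by linarith [hs.1]) (by linarith [hs.2]))
  refine singVal_le_of_columns H (fun j x => colForm h j x) (fun j x => blockMass j x) hC₁
    (by positivity) (hS h H hh hH) (fun x => (tsum_blockMass x).le) hα ha haν c hε hL
    (fun j => twoScale α a ε L j) (fun j => rfl) (fun j x => ?_) (fun j r hr => ?_) hn hm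
  · refine (hF h j _ (hblock j) x).trans ?_
    gcongr ENNReal.ofReal ?_ * _
    rw [mul_pow]
    nlinarith [mul_nonneg hC₃ (mul_nonneg (sq_nonneg K) (sq_nonneg (twoScale α a ε L j)))]
  · obtain ⟨S, hScard, hSx⟩ := hT h j _
      (mul_nonneg hK0 (twoScale_nonneg α a hε hL j)) hh (hRh j) (hblock j) r hr
    refine ⟨S, hScard, fun x hx => (hSx x hx).trans ?_⟩
    gcongr ENNReal.ofReal ?_ * _
    rw [mul_assoc K, mul_pow K]
    nlinarith [mul_nonneg hC₂ (mul_nonneg (sq_nonneg K)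
      (sq_nonneg (twoScale α a ε L j * (r : ℝ) ^ (-ν))))]

lemma IsHankel.congr_ae {h g : ℝ → ℂ} {H : HSp →L[ℂ] HSp} (hH : IsHankel h H)
    (hg : h =ᵐ[muP] g) : IsHankel g H := by
  intro u
  filter_upwards [hH u, ae_restrict_mem measurableSet_Ioi] with t ht ht0
  rw [ht]
  refine integral_congr_ae ?_
  have h1 : ∀ᵐ x : ℝ, x ∈ Ioi (0 : ℝ) → h x = g x :=
    (ae_restrict_iff' measurableSet_Ioi).mp hg
  have h2 : ∀ᵐ s : ℝ, t + s ∈ Ioi (0 : ℝ) → h (t + s) = g (t + s) :=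
    (measurePreserving_add_left volume t).quasiMeasurePreserving.ae h1
  filter_upwards [ae_restrict_of_ae h2, ae_restrict_mem measurableSet_Ioi] with s hs hs0
  rw [hs (mem_Ioi.mpr (add_pos ht0 hs0))]

lemma one_add_sq_rpow_le {α : ℝ} (hα : 0 < α) (y : ℝ) :
    (1 + y ^ 2) ^ (-α / 2) ≤ 2 ^ (α / 2) * (1 + |y|) ^ (-α) := by
  have h1 : (1 + |y|) ^ 2 / 2 ≤ 1 + y ^ 2 := by
    nlinarith [sq_nonneg (1 - |y|), sq_abs y]
  have h2 : (0 : ℝ) < 1 + |y| := by positivity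
  calc (1 + y ^ 2) ^ (-α / 2) ≤ ((1 + |y|) ^ 2 / 2) ^ (-α / 2) :=
        Real.rpow_le_rpow_of_nonpos (by positivity) h1 (by linarith)
    _ = 2 ^ (α / 2) * (1 + |y|) ^ (-α) := by
        rw [Real.div_rpow (by positivity) (by norm_num), ← Real.rpow_natCast (1 + |y|) 2,
          ← Real.rpow_mul h2.le, neg_div, Real.rpow_neg (by norm_num : (0 : ℝ) ≤ 2), div_inv_eq_mul,
          mul_comm]
        congr 2; push_cast; ring

lemma rpow_neg_one_sub_natCast {u : ℝ} (hu : 0 < u) (m : ℕ) :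
    u ^ (-1 - (m : ℝ)) = (u ^ m)⁻¹ * u⁻¹ := by
  rw [Real.rpow_sub hu, Real.rpow_neg_one, Real.rpow_natCast, div_eq_mul_inv, mul_comm]

/-- Decay at both ends of the half-line together with local boundedness gives a global two-scale
bound. -/
lemma exists_norm_le_twoScale {α : ℝ} (hα : 0 < α) (a : ℝ) {g : ℝ → ℂ} {m : ℕ} {l : Filter ℝ}
    (hl : Ioi (0 : ℝ) ∈ l)
    (hInf : g =o[atTop] fun t : ℝ => t ^ (-1 - (m : ℝ)) * (1 + Real.log t ^ 2) ^ (-α / 2))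
    (hZero : g =o[nhdsWithin 0 (Ioi 0)]
      fun t : ℝ => t ^ (-1 - (m : ℝ)) * (1 + Real.log t ^ 2) ^ (-α / 2))
    (hmid : ∀ K : Set ℝ, IsCompact K → K ⊆ Ioi 0 → ∃ C, ∀ᶠ t in l, t ∈ K → ‖g t‖ ≤ C)
    {ε : ℝ} (hε : 0 < ε) :
    ∃ L : ℝ, 0 ≤ L ∧ ∀ᶠ u in l, ‖g u‖ ≤ (u ^ m)⁻¹ * (u⁻¹ * twoScale α a ε L (Real.log u)) := by
  set ε' : ℝ := ε / 2 ^ (α / 2) with hε'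
  have hε0 : 0 < ε' := by positivity
  have hend : ∀ u L : ℝ, 0 < u → 0 ≤ L →
      ‖g u‖ ≤ ε' * ‖u ^ (-1 - (m : ℝ)) * (1 + Real.log u ^ 2) ^ (-α / 2)‖ →
      ‖g u‖ ≤ (u ^ m)⁻¹ * (u⁻¹ * twoScale α a ε L (Real.log u)) := by
    intro u L hu hL hgu
    refine hgu.trans ?_
    rw [Real.norm_of_nonneg (by positivity), rpow_neg_one_sub_natCast hu]
    have h1 : ε' * (1 + Real.log u ^ 2) ^ (-α / 2) ≤ twoScale α a ε L (Real.log u) := by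
      calc ε' * (1 + Real.log u ^ 2) ^ (-α / 2)
          ≤ ε' * (2 ^ (α / 2) * (1 + |Real.log u|) ^ (-α)) := by
            gcongr; exact one_add_sq_rpow_le hα _
        _ = ε * (1 + |Real.log u|) ^ (-α) := by rw [hε']; field_simp
        _ ≤ _ := by
            unfold twoScale
            exact le_add_of_nonneg_right (by positivity)
    calc ε' * ((u ^ m)⁻¹ * u⁻¹ * (1 + Real.log u ^ 2) ^ (-α / 2))
        = (u ^ m)⁻¹ * (u⁻¹ * (ε' * (1 + Real.log u ^ 2) ^ (-α / 2))) := by ring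
      _ ≤ _ := by gcongr
  obtain ⟨q, hq⟩ := eventually_atTop.mp (hInf.bound hε0)
  obtain ⟨p, hp0, hp⟩ := mem_nhdsGT_iff_exists_Ioo_subset.mp (hZero.bound hε0)
  have hp0' : (0 : ℝ) < p := hp0
  have hpos : ∀ u ∈ Icc p (max p q), 0 < u := fun u hu => hp0'.trans_le hu.1
  obtain ⟨M, hM⟩ := hmid (Icc p (max p q)) isCompact_Icc hpos
  have hcont : ContinuousOn (fun u : ℝ => (u ^ m)⁻¹ * (u⁻¹ * (1 + |Real.log u|) ^ (-a)))
      (Icc p (max p q)) := by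
    have hne : ∀ u ∈ Icc p (max p q), u ≠ 0 := fun u hu => (hpos u hu).ne'
    refine ((continuousOn_pow m).inv₀ fun u hu => pow_ne_zero m (hne u hu)).mul
      ((continuousOn_id.inv₀ hne).mul (ContinuousOn.rpow_const ?_ fun u hu => Or.inl ?_))
    · exact continuousOn_const.add (Real.continuousOn_log.mono hne).abs
    · positivity
  obtain ⟨v, hv, hmin⟩ := isCompact_Icc.exists_isMinOn
    (nonempty_Icc.mpr (le_max_left p q)) hcont
  set δ : ℝ := (v ^ m)⁻¹ * (v⁻¹ * (1 + |Real.log v|) ^ (-a)) with hδ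
  have hδ0 : 0 < δ := by have := hpos v hv; positivity
  refine ⟨|M| / δ, by positivity, ?_⟩
  filter_upwards [hM, hl] with u hu hu0
  have hu0' : 0 < u := hu0
  by_cases hmem : u ∈ Icc p (max p q)
  · have h1 : δ ≤ (u ^ m)⁻¹ * (u⁻¹ * (1 + |Real.log u|) ^ (-a)) := hmin hmem
    calc ‖g u‖ ≤ |M| := (hu hmem).trans (le_abs_self M)
      _ = |M| / δ * δ := by field_simp
      _ ≤ |M| / δ * ((u ^ m)⁻¹ * (u⁻¹ * (1 + |Real.log u|) ^ (-a))) := by gcongr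
      _ = (u ^ m)⁻¹ * (u⁻¹ * (|M| / δ * (1 + |Real.log u|) ^ (-a))) := by ring
      _ ≤ _ := by
          unfold twoScale
          gcongr
          exact le_add_of_nonneg_left (by positivity)
  · refine hend u _ hu0' (by positivity) ?_
    rcases lt_or_ge u p with h | h
    · exact hp ⟨hu0', h⟩
    · exact hq u (by by_contra hlt; exact hmem ⟨h, le_max_of_le_right (not_le.mp hlt).le⟩)

lemma measurable_twoScale (α a ε L : ℝ) : Measurable (twoScale α a ε L) := by
  unfold twoScale; fun_prop

lemma isLittleO_singVal_of_lt_half {α : ℝ} (hα : 0 < α) (hα2 : α < 1 / 2) {h : ℝ → ℂ}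
    (hloc : LinftyLoc h)
    (hInf : h =o[atTop] fun t : ℝ => t ^ (-1 - ((0 : ℕ) : ℝ)) * (1 + Real.log t ^ 2) ^ (-α / 2))
    (hZero : h =o[nhdsWithin 0 (Ioi 0)]
      fun t : ℝ => t ^ (-1 - ((0 : ℕ) : ℝ)) * (1 + Real.log t ^ 2) ^ (-α / 2))
    {H : HSp →L[ℂ] HSp} (hH : IsHankel h H) :
    (fun n : ℕ => singVal H n) =o[atTop] fun n : ℕ => (n : ℝ) ^ (-α) := by
  obtain ⟨a, ha, haν⟩ := exists_between hα2
  obtain ⟨K, hK0, hK⟩ := exists_inv_mul_twoScale_le hα (hα.trans ha)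
  obtain ⟨C, hC⟩ := exists_singVal_le_of_blocks hα ha haν 1 hK0 hK (fun _ _ _ => True) (by
    obtain ⟨C, hC0, hC⟩ := exists_finset_colForm_le_of_sq_integrable
    exact ⟨C, hC0, fun h j B _ hh _ hB r hr => by simpa using hC h j B hh hB r hr⟩)
  refine isLittleO_rpow_of_two_scale (singVal_nonneg H) hα ha
    (2 * (1 : ℕ) * (1 + 1 / (1 - a / (1 / 2)))) C fun ε hε => ?_
  obtain ⟨L, hL, hbound⟩ := exists_norm_le_twoScale hα a (l := ae muP)
    (ae_restrict_mem measurableSet_Ioi) hInf hZero hloc.2 hε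
  refine ⟨L, hL, ?_⟩
  set f := hloc.1.mk h with hf
  have hfm : Measurable f := hloc.1.stronglyMeasurable_mk.measurable
  have hmeas : MeasurableSet {u : ℝ | ‖f u‖ ≤ u⁻¹ * twoScale α a ε L (Real.log u)} :=
    measurableSet_le hfm.norm
      (measurable_inv.mul ((measurable_twoScale α a ε L).comp Real.measurable_log))
  have hae : h =ᵐ[muP]
      indicator {u : ℝ | ‖f u‖ ≤ u⁻¹ * twoScale α a ε L (Real.log u)} f := by
    filter_upwards [hloc.1.ae_eq_mk, hbound] with u hu hbu
    rw [indicator_of_mem, hu]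
    simpa [hf, ← hu] using hbu
  refine hC _ H ε L hε.le hL (hfm.indicator hmeas) (hH.congr_ae hae) (fun u hu => ?_)
    fun _ => trivial
  by_cases hmem : u ∈ {u : ℝ | ‖f u‖ ≤ u⁻¹ * twoScale α a ε L (Real.log u)}
  · rw [indicator_of_mem hmem]; exact hmem
  · rw [indicator_of_notMem hmem, norm_zero]
    exact mul_nonneg (inv_nonneg.mpr (le_of_lt hu)) (twoScale_nonneg α a hε.le hL _)

lemma isLittleO_singVal_of_contDiffOn {α : ℝ} (hα : 0 < α) {N : ℕ} (hN : α < (N + 1 : ℕ))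
    {h : ℝ → ℂ} (hreg : ContDiffOn ℝ (N + 1 : ℕ) h (Ioi 0))
    (hInf : ∀ m : ℕ, m ≤ N + 1 → iteratedDerivWithin m h (Ioi 0) =o[atTop]
      fun t : ℝ => t ^ (-1 - (m : ℝ)) * (1 + Real.log t ^ 2) ^ (-α / 2))
    (hZero : ∀ m : ℕ, m ≤ N + 1 → iteratedDerivWithin m h (Ioi 0) =o[nhdsWithin 0 (Ioi 0)]
      fun t : ℝ => t ^ (-1 - (m : ℝ)) * (1 + Real.log t ^ 2) ^ (-α / 2))
    {H : HSp →L[ℂ] HSp} (hH : IsHankel h H) :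
    (fun n : ℕ => singVal H n) =o[atTop] fun n : ℕ => (n : ℝ) ^ (-α) := by
  obtain ⟨a, ha, haν⟩ := exists_between hN
  obtain ⟨K, hK0, hK⟩ := exists_inv_mul_twoScale_le hα (hα.trans ha)
  obtain ⟨C, hC⟩ := exists_singVal_le_of_blocks hα ha haν (N + 1) hK0 hK
    (fun h j B => ContDiffOn ℝ (N + 1 : ℕ) h (Ioi 0) ∧ ∀ t > 0,
      ∀ u ∈ Icc (t + Real.exp j) (t + Real.exp (j + 1)),
        ‖iteratedDerivWithin (N + 1) h (Ioi 0) u‖ ≤ (u ^ (N + 1))⁻¹ * (B * envelope j t)) (by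
    obtain ⟨C, hC0, hC⟩ := exists_finset_colForm_le_of_contDiffOn N
    exact ⟨C, hC0, fun h j B hB0 hh hR hB r hr => hC h j B hB0 hh hR.1 hB hR.2 r hr⟩)
  refine isLittleO_rpow_of_two_scale (singVal_nonneg H) hα ha
    (2 * (N + 1 : ℕ) * (1 + 1 / (1 - a / (N + 1 : ℕ)))) C fun ε hε => ?_
  have hbound : ∀ m : ℕ, m ≤ N + 1 → ∃ L : ℝ, 0 ≤ L ∧ ∀ u > 0,
      ‖iteratedDerivWithin m h (Ioi 0) u‖ ≤
        (u ^ m)⁻¹ * (u⁻¹ * twoScale α a ε L (Real.log u)) := by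
    intro m hm
    have hmid : ∀ S : Set ℝ, IsCompact S → S ⊆ Ioi 0 → ∃ M,
        ∀ᶠ t in Filter.principal (Ioi (0 : ℝ)), t ∈ S → ‖iteratedDerivWithin m h (Ioi 0) t‖ ≤ M := by
      intro S hS hS0
      obtain ⟨M, hM⟩ := hS.exists_bound_of_continuousOn
        ((hreg.continuousOn_iteratedDerivWithin (by exact_mod_cast hm)
          (uniqueDiffOn_Ioi 0)).mono hS0)
      exact ⟨M, Eventually.of_forall hM⟩
    obtain ⟨L, hL, hu⟩ := exists_norm_le_twoScale hα a (mem_principal_self (Ioi (0 : ℝ)))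
      (hInf m hm) (hZero m hm) hmid hε
    exact ⟨L, hL, fun u hu0 => hu hu0⟩
  obtain ⟨L₀, hL₀, h₀⟩ := hbound 0 (Nat.zero_le _)
  obtain ⟨L₁, hL₁, h₁⟩ := hbound (N + 1) le_rfl
  have hL : 0 ≤ max L₀ L₁ := hL₀.trans (le_max_left _ _)
  refine ⟨max L₀ L₁, hL, ?_⟩
  have heq : EqOn ((Ioi (0 : ℝ)).indicator h) h (Ioi 0) := fun u hu => indicator_of_mem hu h
  have hmeas : Measurable ((Ioi (0 : ℝ)).indicator h) := by
    rw [← piecewise_eq_indicator]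
    exact hreg.continuousOn.measurable_piecewise continuousOn_const measurableSet_Ioi
  have hae : h =ᵐ[muP] (Ioi (0 : ℝ)).indicator h := by
    filter_upwards [ae_restrict_mem measurableSet_Ioi] with u hu using (heq hu).symm
  refine hC _ H ε _ hε.le hL hmeas (hH.congr_ae hae) (fun u hu => ?_)
    fun j => ⟨hreg.congr heq, fun t ht u hu => ?_⟩
  · rw [heq hu]
    have := h₀ u hu
    rw [iteratedDerivWithin_zero, pow_zero, inv_one, one_mul] at this
    refine this.trans ?_
    have := inv_nonneg.mpr (le_of_lt hu)
    gcongr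
    exact twoScale_mono α a ε _ (le_max_left _ _)
  · have hu0 : 0 < u := by linarith [hu.1, Real.exp_pos (j : ℝ)]
    rw [iteratedDerivWithin_congr heq hu0]
    refine (h₁ u hu0).trans ?_
    have hmono := twoScale_mono α a ε (Real.log u) (le_max_right L₀ L₁)
    have hinv : 0 ≤ u⁻¹ := inv_nonneg.mpr hu0.le
    gcongr ?_ * ?_
    exact (mul_le_mul_of_nonneg_left hmono hinv).trans (hK ε _ j t u hε.le hL ht hu.1 hu.2)

/-- Theorem `thm.a2`, singular value estimates.  Let `α > 0` and let
`h ∈ L^∞_loc((0,∞))` be complex valued, with `h ∈ C^{N(α)}((0,∞))` if `α ≥ 1/2`, and suppose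
`h^{(m)}(t) = o(t^{-1-m} ⟨log t⟩^{-α})` as `t → 0` and as `t → ∞` for all `m ≤ N(α)`.
Then `sₙ(H) = o(n^{-α})` as `n → ∞`. -/
theorem statement6 (α : ℝ) (hα : 0 < α) (h : ℝ → ℂ) (hloc : LinftyLoc h)
    (hreg : 1/2 ≤ α → ContDiffOn ℝ (Nal α) h (Set.Ioi 0))
    (hcondInf : ∀ m : ℕ, m ≤ Nal α →
      iteratedDerivWithin m h (Set.Ioi 0) =o[atTop]
        fun t : ℝ => t ^ (-1 - (m:ℝ)) * (1 + Real.log t ^ 2) ^ (-α/2))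
    (hcondZero : ∀ m : ℕ, m ≤ Nal α →
      iteratedDerivWithin m h (Set.Ioi 0) =o[nhdsWithin 0 (Set.Ioi 0)]
        fun t : ℝ => t ^ (-1 - (m:ℝ)) * (1 + Real.log t ^ 2) ^ (-α/2))
    (H : HSp →L[ℂ] HSp) (hH : IsHankel h H) :
    (fun nn : ℕ => singVal H nn) =o[atTop] fun nn : ℕ => (nn:ℝ) ^ (-α) := by
  by_cases hα2 : α < 1 / 2
  · refine isLittleO_singVal_of_lt_half hα hα2 hloc ?_ ?_ hH
    · simpa only [iteratedDerivWithin_zero] using hcondInf 0 (Nat.zero_le _)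
    · simpa only [iteratedDerivWithin_zero] using hcondZero 0 (Nat.zero_le _)
  · have hNal : Nal α = ⌊α⌋₊ + 1 := if_neg hα2
    rw [hNal] at hreg hcondInf hcondZero
    exact isLittleO_singVal_of_contDiffOn hα (by exact_mod_cast Nat.lt_floor_add_one α)
      (hreg (not_lt.mp hα2)) hcondInf hcondZero hH
end
end

section
/- Let l ∈ ℤ₊, t₀ > 0, h₀ ∈ ℝ, and let h(t) = h₀ (t₀ − t)^l for t ≤ t₀ and h(t) = 0 for t > t₀. Then the eigenvalues of the Hankel operator H with kernel h satisfy, for both signs, λ_n^±(H) = |h₀| · l! · (2π)^{−l−1} t₀^{l+1} n^{−l−1} (1 + O(n^{-1})) as n → ∞. -/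
noncomputable section
open MeasureTheory Filter Asymptotics Set

section Variational

variable {E : Type*} [NormedAddCommGroup E] [InnerProductSpace ℂ E]

theorem abs_re_inner_le_opNorm (K : E →L[ℂ] E) {x : E} (hx : ‖x‖ = 1) :
    |(inner ℂ (K x) x).re| ≤ ‖K‖ := by
  calc |(inner ℂ (K x) x).re| ≤ ‖inner ℂ (K x) x‖ := Complex.abs_re_le_norm _
    _ ≤ ‖K x‖ * ‖x‖ := norm_inner_le_norm _ _
    _ ≤ ‖K‖ * ‖x‖ * ‖x‖ := by gcongr; exact K.le_opNorm x
    _ = ‖K‖ := by simp [hx]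

theorem bddBelow_range_re_inner (K : E →L[ℂ] E) (V : Submodule ℂ E) :
    BddBelow (range fun x : {x : E // x ∈ V ∧ ‖x‖ = 1} => (inner ℂ (K x.1) x.1).re) := by
  refine ⟨-‖K‖, ?_⟩
  rintro _ ⟨x, rfl⟩
  exact neg_le_of_abs_le (abs_re_inner_le_opNorm K x.2.2)

theorem le_posEig {K : E →L[ℂ] E} {n : ℕ} (hn : n ≠ 0) {V : Submodule ℂ E}
    (hV : Module.finrank ℂ V = n) {c : ℝ}
    (hc : ∀ x ∈ V, c * ‖x‖ ^ 2 ≤ (inner ℂ (K x) x).re) : c ≤ posEig K n := by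
  have hbdd : BddAbove (range fun V : {V : Submodule ℂ E // Module.finrank ℂ V = n} =>
      ⨅ x : {x : E // x ∈ V.1 ∧ ‖x‖ = 1}, (inner ℂ (K x.1) x.1).re) := by
    refine ⟨‖K‖, ?_⟩
    rintro _ ⟨W, rfl⟩
    rcases isEmpty_or_nonempty {x : E // x ∈ W.1 ∧ ‖x‖ = 1} with h | ⟨⟨x⟩⟩
    · simp only [Real.iInf_of_isEmpty]
      exact norm_nonneg K
    · exact (ciInf_le (bddBelow_range_re_inner K W.1) x).trans
        (le_of_abs_le (abs_re_inner_le_opNorm K x.2.2))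
  refine le_trans ?_ (le_ciSup hbdd ⟨V, hV⟩)
  have hpos : 0 < Module.finrank ℂ V := by omega
  have : FiniteDimensional ℂ V := Module.finite_of_finrank_pos hpos
  have : Nontrivial V := Module.finrank_pos_iff.mp hpos
  obtain ⟨⟨x, hxV⟩, hx0⟩ := exists_ne (0 : V)
  have hx0' : x ≠ 0 := fun h => hx0 (by ext; exact h)
  have : Nonempty {x : E // x ∈ V ∧ ‖x‖ = 1} :=
    ⟨⟨(‖x‖⁻¹ : ℂ) • x, V.smul_mem _ hxV, by
      rw [norm_smul]; simp [norm_ne_zero_iff.mpr hx0']⟩⟩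
  refine le_ciInf fun y => ?_
  simpa [y.2.2] using hc y.1 y.2.1

theorem posEig_le {K : E →L[ℂ] E} {n : ℕ} {c : ℝ} (hc0 : 0 ≤ c)
    (hc : ∀ V : Submodule ℂ E, Module.finrank ℂ V = n →
      ∃ x ∈ V, x ≠ 0 ∧ (inner ℂ (K x) x).re ≤ c * ‖x‖ ^ 2) : posEig K n ≤ c := by
  refine Real.iSup_le (fun V => ?_) hc0
  obtain ⟨x, hxV, hx0, hx⟩ := hc V.1 V.2
  have hnx : ‖x‖ ≠ 0 := norm_ne_zero_iff.mpr hx0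
  refine (ciInf_le (bddBelow_range_re_inner K V.1)
    ⟨(‖x‖⁻¹ : ℂ) • x, V.1.smul_mem _ hxV, by rw [norm_smul]; simp [hnx]⟩).trans ?_
  have : (inner ℂ (K ((‖x‖⁻¹ : ℂ) • x)) ((‖x‖⁻¹ : ℂ) • x)).re
      = (‖x‖⁻¹) ^ 2 * (inner ℂ (K x) x).re := by
    rw [map_smul, inner_smul_left, inner_smul_right, ← mul_assoc, ← Complex.ofReal_inv,
      Complex.conj_ofReal, ← Complex.ofReal_mul, Complex.re_ofReal_mul, sq]
  simp only [this]
  calc (‖x‖⁻¹) ^ 2 * (inner ℂ (K x) x).re ≤ (‖x‖⁻¹) ^ 2 * (c * ‖x‖ ^ 2) := by gcongr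
    _ = c := by field_simp

variable {r : ℕ} {p : Fin r → E} {f g : ℕ → E} {μ : ℕ → ℝ} {K : E →L[ℂ] E}

/-- If the quadratic form of `K` is diagonalised by the orthonormal systems `f`, `g` on the
orthogonal complement of `r` vectors, its positive eigenvalues are bounded below by the shifted
diagonal values. -/
theorem le_posEig_of_hasSum (hf : Orthonormal ℂ f) (hfg : ∀ i j, inner ℂ (g i) (f j) = 0)
    (hμ : Antitone μ)
    (hK : ∀ x : E, (∀ i, inner ℂ (p i) x = 0) →
      HasSum (fun k => μ k * (‖inner ℂ (f k) x‖ ^ 2 - ‖inner ℂ (g k) x‖ ^ 2))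
        (inner ℂ (K x) x).re) {n : ℕ} (hn : n ≠ 0) :
    μ (n + r) ≤ posEig K n := by
  set Φ : (Fin (n + r) → ℂ) →ₗ[ℂ] E := Fintype.linearCombination ℂ fun i : Fin (n + r) => f i
    with hΦ
  have hf' : Orthonormal ℂ fun i : Fin (n + r) => f i := hf.comp _ Fin.val_injective
  have hΦinj : Function.Injective Φ :=
    linearIndependent_iff_injective_fintypeLinearCombination.mp hf'.linearIndependent
  let G : (Fin (n + r) → ℂ) →ₗ[ℂ] (Fin r → ℂ) :=
    LinearMap.pi fun i => (innerSL ℂ (p i)).toLinearMap ∘ₗ Φ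
  have hG : n ≤ Module.finrank ℂ (LinearMap.ker G) := by
    have h1 := LinearMap.finrank_range_add_finrank_ker G
    have h2 := Submodule.finrank_le (LinearMap.range G)
    simp only [Module.finrank_fin_fun] at h1 h2
    omega
  obtain ⟨s, hs, hli⟩ := exists_finset_linearIndependent_of_le_finrank hG
  let W : Submodule ℂ (Fin (n + r) → ℂ) :=
    (Submodule.span ℂ (s : Set (LinearMap.ker G))).map (LinearMap.ker G).subtype
  have hW : Module.finrank ℂ (W.map Φ) = n := by
    rw [← (Submodule.equivMapOfInjective Φ hΦinj W).finrank_eq,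
      ← (Submodule.equivMapOfInjective _ (Submodule.injective_subtype _) _).finrank_eq,
      finrank_span_finset_eq_card hli, hs]
  refine le_posEig hn hW ?_
  rintro x ⟨c, ⟨w, -, rfl⟩, rfl⟩
  have hw : ∀ i, inner ℂ (p i) (Φ w) = 0 := fun i => congrFun (LinearMap.mem_ker.mp w.2) i
  set c : Fin (n + r) → ℂ := (LinearMap.ker G).subtype w
  have hΦc : Φ c = ∑ i, c i • f i := Fintype.linearCombination_apply ..
  have hg0 : ∀ k, inner ℂ (g k) (Φ c) = 0 := fun k => by
    simp [hΦc, hfg]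
  have hfk : ∀ k : Fin (n + r), inner ℂ (f k) (Φ c) = c k := fun k => by
    rw [hΦc]
    exact hf'.inner_right_fintype c k
  have hfk0 : ∀ k, n + r ≤ k → inner ℂ (f k) (Φ c) = 0 := fun k hk => by
    rw [hΦc, inner_sum]
    refine Finset.sum_eq_zero fun i _ => ?_
    rw [inner_smul_right, hf.2 (by omega), mul_zero]
  have hnorm : ‖Φ c‖ ^ 2 = ∑ i, ‖c i‖ ^ 2 := by
    have h1 : ((‖Φ c‖ ^ 2 : ℝ) : ℂ) = ∑ i, ((‖c i‖ ^ 2 : ℝ) : ℂ) := by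
      have := hf'.inner_sum c c Finset.univ
      rw [← hΦc, inner_self_eq_norm_sq_to_K] at this
      push_cast
      rw [← Complex.coe_algebraMap] at *
      refine this.trans (Finset.sum_congr rfl fun i _ => ?_)
      rw [mul_comm]
      exact RCLike.mul_conj (c i)
    exact_mod_cast h1
  have hsum : (inner ℂ (K (Φ c)) (Φ c)).re = ∑ i : Fin (n + r), μ i * ‖c i‖ ^ 2 := by
    have hfin := hasSum_sum_of_ne_finset_zero (s := Finset.range (n + r))
      (f := fun k => μ k * (‖inner ℂ (f k) (Φ c)‖ ^ 2 - ‖inner ℂ (g k) (Φ c)‖ ^ 2))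
      (L := SummationFilter.unconditional ℕ) fun k hk => by
        rw [hg0, hfk0 k (by simpa using hk)]; simp
    rw [HasSum.unique (a₁ := (inner ℂ (K (Φ c)) (Φ c)).re) (hK _ hw) hfin]
    rw [← Fin.sum_univ_eq_sum_range
      (fun k => μ k * (‖inner ℂ (f k) (Φ c)‖ ^ 2 - ‖inner ℂ (g k) (Φ c)‖ ^ 2))]
    exact Finset.sum_congr rfl fun i _ => by simp [hg0, hfk]
  change _ * ‖Φ c‖ ^ 2 ≤ (inner ℂ (K (Φ c)) (Φ c)).re
  rw [hsum, hnorm, Finset.mul_sum]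
  gcongr with i
  exact hμ i.2.le

/-- Companion of `le_posEig_of_hasSum`: the upper bound. -/
theorem posEig_le_of_hasSum (hf : Orthonormal ℂ f) (hμ : Antitone μ) (hμ0 : ∀ k, 0 ≤ μ k)
    (hK : ∀ x : E, (∀ i, inner ℂ (p i) x = 0) →
      HasSum (fun k => μ k * (‖inner ℂ (f k) x‖ ^ 2 - ‖inner ℂ (g k) x‖ ^ 2))
        (inner ℂ (K x) x).re) (n : ℕ) :
    posEig K (n + r + 1) ≤ μ n := by
  refine posEig_le (hμ0 n) fun V hV => ?_
  have : FiniteDimensional ℂ V := Module.finite_of_finrank_pos (by omega)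
  let G : V →ₗ[ℂ] (Fin r ⊕ Fin n → ℂ) := LinearMap.pi fun i =>
    (innerSL ℂ (Sum.elim p (fun k : Fin n => f k) i)).toLinearMap ∘ₗ V.subtype
  have hker : LinearMap.ker G ≠ ⊥ := LinearMap.ker_ne_bot_of_finrank_lt (by
    simp only [Module.finrank_fintype_fun_eq_card, Fintype.card_sum, Fintype.card_fin]; omega)
  obtain ⟨x, hx, hx0⟩ := Submodule.exists_mem_ne_zero_of_ne_bot hker
  have hp : ∀ i, inner ℂ (p i) (x : E) = 0 := fun i => congrFun (LinearMap.mem_ker.mp hx) (.inl i)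
  have hfx : ∀ k, k < n → inner ℂ (f k) (x : E) = 0 := fun k hk =>
    congrFun (LinearMap.mem_ker.mp hx) (.inr ⟨k, hk⟩)
  refine ⟨x, x.2, by simpa using hx0, ?_⟩
  have hs : Summable fun k => ‖inner ℂ (f k) (x : E)‖ ^ 2 := hf.inner_products_summable _
  calc (inner ℂ (K x) (x : E)).re
      ≤ ∑' k, μ n * ‖inner ℂ (f k) (x : E)‖ ^ 2 := by
        refine hasSum_le (fun k => ?_) (hK x hp) (hs.mul_left _).hasSum
        rcases lt_or_ge k n with hk | hk
        · rw [hfx k hk]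
          have := mul_nonneg (hμ0 k) (sq_nonneg ‖inner ℂ (g k) (x : E)‖)
          simp only [norm_zero]
          linarith
        · have h1 := mul_nonneg (hμ0 k) (sq_nonneg ‖inner ℂ (g k) (x : E)‖)
          have h2 := mul_le_mul_of_nonneg_right (hμ hk) (sq_nonneg ‖inner ℂ (f k) (x : E)‖)
          linarith
    _ = μ n * ∑' k, ‖inner ℂ (f k) (x : E)‖ ^ 2 := tsum_mul_left
    _ ≤ μ n * ‖(x : E)‖ ^ 2 :=
        mul_le_mul_of_nonneg_left (hf.tsum_inner_products_le _) (hμ0 n)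

end Variational

section Asymptotics

theorem isBigO_sub_of_shifted_bounds {F : ℕ → ℝ} {C : ℝ} (hC : 0 ≤ C) (l r : ℕ)
    (hlow : ∀ n : ℕ, n ≠ 0 → C / ((n + r : ℕ) + 1 : ℝ) ^ (l + 1) ≤ F n)
    (hup : ∀ n : ℕ, F (n + r + 1) ≤ C / (n + 1 : ℝ) ^ (l + 1)) :
    (fun n : ℕ => F n - C * (n : ℝ) ^ (-(l : ℝ) - 1)) =O[atTop]
      fun n : ℕ => (n : ℝ) ^ (-(l : ℝ) - 2) := by
  have key : ∀ a b : ℝ, 0 ≤ b → b ≤ a → a ^ (l + 1) - b ^ (l + 1) ≤ (l + 1) * (a - b) * a ^ l := by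
    intro a b hb hab
    have h := Commute.geom_sum₂_mul (Commute.all a b) (l + 1)
    rw [← h]
    have : ∑ i ∈ Finset.range (l + 1), a ^ i * b ^ (l + 1 - 1 - i) ≤ (l + 1) * a ^ l := by
      calc _ ≤ ∑ i ∈ Finset.range (l + 1), a ^ l := by
            refine Finset.sum_le_sum fun i hi => ?_
            have hi' : i ≤ l := by simpa [Nat.lt_succ_iff] using hi
            calc a ^ i * b ^ (l + 1 - 1 - i) ≤ a ^ i * a ^ (l - i) := by
                  have := hb.trans hab
                  simp only [Nat.add_sub_cancel]; gcongr
              _ = a ^ l := by rw [← pow_add]; congr 1; omega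
        _ = _ := by simp
    nlinarith [sub_nonneg.mpr hab]
  refine IsBigO.of_bound (C * (l + 1) * (2 ^ l * (2 * (r + 1)))) ?_
  filter_upwards [eventually_ge_atTop (2 * r + 1)] with n hn
  have hn' : (2 * r + 1 : ℝ) ≤ n := by exact_mod_cast hn
  have hn0 : (0 : ℝ) < n := by linarith [(Nat.cast_nonneg r : (0 : ℝ) ≤ r)]
  have hr0 : (0 : ℝ) ≤ r := Nat.cast_nonneg r
  have e1 : (n : ℝ) ^ (-(l : ℝ) - 1) = (1 / (n : ℝ)) ^ (l + 1) := by
    rw [show (-(l : ℝ) - 1) = -((l + 1 : ℕ) : ℝ) by push_cast; ring, Real.rpow_neg hn0.le,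
      Real.rpow_natCast]; simp
  have e2 : (n : ℝ) ^ (-(l : ℝ) - 2) = (1 / (n : ℝ)) ^ l * (1 / (n : ℝ)) ^ 2 := by
    rw [show (-(l : ℝ) - 2) = -((l + 2 : ℕ) : ℝ) by push_cast; ring, Real.rpow_neg hn0.le,
      Real.rpow_natCast]; simp [pow_add, mul_comm]
  rw [e1, e2, Real.norm_of_nonneg (by positivity : 0 ≤ (1 / (n : ℝ)) ^ l * (1 / (n : ℝ)) ^ 2),
    Real.norm_eq_abs, abs_le]
  constructor
  · have h1 := hlow n (by omega)
    have h2 := key (1 / n) (1 / ((n + r : ℕ) + 1 : ℝ)) (by positivity) (by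
      gcongr; push_cast; linarith)
    have h3 : 1 / (n : ℝ) - 1 / ((n + r : ℕ) + 1 : ℝ) ≤ 2 ^ l * (2 * (r + 1)) * (1 / (n : ℝ)) ^ 2 := by
      have : 1 / (n : ℝ) - 1 / ((n + r : ℕ) + 1 : ℝ) ≤ 1 * (r + 1) * (1 / (n : ℝ)) ^ 2 := by
        push_cast
        rw [div_sub_div _ _ hn0.ne' (by positivity), one_div, inv_pow, ← div_eq_mul_inv,
          div_le_div_iff₀ (by positivity) (by positivity)]
        nlinarith [mul_nonneg hn0.le hr0, mul_nonneg (mul_nonneg hn0.le hr0) hr0]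
      refine this.trans ?_
      gcongr
      · exact one_le_pow₀ (by norm_num)
      · linarith
    have h4 : C / ((n + r : ℕ) + 1 : ℝ) ^ (l + 1) = C * (1 / ((n + r : ℕ) + 1 : ℝ)) ^ (l + 1) := by
      rw [one_div, inv_pow, div_eq_mul_inv]
    rw [h4] at h1
    have h5 : (l + 1) * (1 / (n : ℝ) - 1 / ((n + r : ℕ) + 1 : ℝ)) * (1 / (n : ℝ)) ^ l ≤
        (l + 1) * (2 ^ l * (2 * (r + 1)) * (1 / (n : ℝ)) ^ 2) * (1 / (n : ℝ)) ^ l := by gcongr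
    have h6 := mul_le_mul_of_nonneg_left (h2.trans h5) hC
    linarith
  · obtain ⟨k, rfl⟩ : ∃ k, n = k + r + 1 := ⟨n - r - 1, by omega⟩
    have h1 := hup k
    push_cast at hn' hn0 ⊢
    have hk : (r : ℝ) ≤ k := by linarith
    have hkp : (0 : ℝ) < k + 1 := by positivity
    have h2 := key (1 / (k + 1 : ℝ)) (1 / (k + r + 1 : ℝ)) (by positivity) (by gcongr; linarith)
    have ha : 1 / (k + 1 : ℝ) ≤ 2 * (1 / (k + r + 1 : ℝ)) := by
      rw [mul_one_div, div_le_div_iff₀ hkp hn0]; linarith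
    have hb : 1 / (k + 1 : ℝ) - 1 / (k + r + 1 : ℝ) ≤ 2 * (r + 1) * (1 / (k + r + 1 : ℝ)) ^ 2 := by
      have : 1 / (k + 1 : ℝ) - 1 / (k + r + 1 : ℝ) = r * (1 / (k + 1 : ℝ)) * (1 / (k + r + 1 : ℝ)) := by
        field_simp; ring
      rw [this]
      calc r * (1 / (k + 1 : ℝ)) * (1 / (k + r + 1 : ℝ))
          ≤ (r + 1) * (2 * (1 / (k + r + 1 : ℝ))) * (1 / (k + r + 1 : ℝ)) := by
            gcongr; linarith
        _ = _ := by ring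
    have hc : (1 / (k + 1 : ℝ)) ^ l ≤ 2 ^ l * (1 / (k + r + 1 : ℝ)) ^ l := by
      rw [← mul_pow]; gcongr
    have h4 : C / (k + 1 : ℝ) ^ (l + 1) = C * (1 / (k + 1 : ℝ)) ^ (l + 1) := by
      rw [one_div, inv_pow, div_eq_mul_inv]
    rw [h4] at h1
    have h5 : (l + 1) * (1 / (k + 1 : ℝ) - 1 / (k + r + 1 : ℝ)) * (1 / (k + 1 : ℝ)) ^ l ≤
        (l + 1) * (2 * (r + 1) * (1 / (k + r + 1 : ℝ)) ^ 2) *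
          (2 ^ l * (1 / (k + r + 1 : ℝ)) ^ l) := by gcongr
    have h6 := mul_le_mul_of_nonneg_left (h2.trans h5) hC
    linarith

end Asymptotics

section OrthonormalExpansion

variable {E : Type*} [NormedAddCommGroup E] [InnerProductSpace ℂ E]

/-- The symmetrised vectors `(e_{k+1} + s_k e_{-(k+1)}) / √2`. -/
def pairVec (e : ℤ → E) (s : ℕ → ℂ) (k : ℕ) : E :=
  ((√2)⁻¹ : ℂ) • (e (k + 1) + s k • e (-(k + 1)))

theorem sqrt_two_inv_mul_self : ((√2)⁻¹ : ℂ) * ((√2)⁻¹ : ℂ) = 1 / 2 := by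
  rw [← Complex.ofReal_inv, ← Complex.ofReal_mul, ← mul_inv, Real.mul_self_sqrt (by norm_num)]
  norm_num

theorem inner_pairVec_pairVec {e : ℤ → E} (he : Orthonormal ℂ e) (s s' : ℕ → ℂ) (i j : ℕ) :
    inner ℂ (pairVec e s i) (pairVec e s' j) =
      if i = j then (1 + (starRingEnd ℂ) (s i) * s' i) / 2 else 0 := by
  have h := orthonormal_iff_ite.mp he
  have h1 : ¬ ((i : ℤ) + 1 = -(j + 1)) := by omega
  have h2 : ¬ (-((i : ℤ) + 1) = j + 1) := by omega
  have h3 : (-((i : ℤ) + 1) = -(j + 1)) ↔ i = j := by omega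
  have h4 : ((i : ℤ) + 1 = j + 1) ↔ i = j := by omega
  simp only [pairVec, inner_smul_left, inner_smul_right, inner_add_left, inner_add_right, h, h1,
    h2, h3, h4, if_false]
  rw [← Complex.ofReal_inv, Complex.conj_ofReal, Complex.ofReal_inv]
  split_ifs with hij
  · subst hij
    linear_combination (1 + (starRingEnd ℂ) (s i) * s' i) * sqrt_two_inv_mul_self
  · simp

theorem orthonormal_pairVec {e : ℤ → E} (he : Orthonormal ℂ e) {s : ℕ → ℂ}
    (hs : ∀ k, ‖s k‖ = 1) : Orthonormal ℂ (pairVec e s) := by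
  rw [orthonormal_iff_ite]
  intro i j
  rw [inner_pairVec_pairVec he]
  have : (starRingEnd ℂ) (s i) * s i = 1 := by rw [Complex.conj_mul', hs]; simp
  rw [this]
  norm_num

theorem norm_sq_inner_pairVec_sub (e : ℤ → E) (s : ℕ → ℂ) (k : ℕ) (x : E) :
    ‖inner ℂ (pairVec e s k) x‖ ^ 2 - ‖inner ℂ (pairVec e (-s) k) x‖ ^ 2 =
      2 * (s k * inner ℂ (e (k + 1)) x * (starRingEnd ℂ) (inner ℂ (e (-(k + 1))) x)).re := by
  set u := inner ℂ (e (k + 1)) x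
  set v := inner ℂ (e (-(k + 1))) x
  have hgen : ∀ s' : ℕ → ℂ, ‖inner ℂ (pairVec e s' k) x‖ ^ 2
      = ‖u + (starRingEnd ℂ) (s' k) * v‖ ^ 2 / 2 := fun s' => by
    simp only [pairVec, inner_smul_left, inner_add_left]
    rw [norm_mul, mul_pow, ← Complex.ofReal_inv, Complex.conj_ofReal, Complex.norm_real,
      Real.norm_eq_abs, sq_abs, inv_pow, Real.sq_sqrt (by norm_num)]
    ring
  rw [hgen, hgen]
  simp only [Complex.sq_norm, Complex.normSq_apply, Pi.neg_apply, map_neg]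
  simp
  ring

theorem hasSum_re_inner_of_orthonormal [CompleteSpace E] {e : ℤ → E} (he : Orthonormal ℂ e)
    {K : E →L[ℂ] E} (hK : ∀ y, (∀ n, inner ℂ (e n) y = 0) → K y = 0) {a s : ℕ → ℂ}
    (has : ∀ k, a k = ‖a k‖ * s k) {x : E} (h0 : inner ℂ (K (e 0)) x = 0)
    (hpos : ∀ k : ℕ, inner ℂ (K (e (k + 1))) x = (starRingEnd ℂ) (a k) * inner ℂ (e (-(k + 1))) x)
    (hneg : ∀ k : ℕ, inner ℂ (K (e (-(k + 1)))) x = a k * inner ℂ (e (k + 1)) x) :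
    HasSum (fun k => ‖a k‖ * (‖inner ℂ (pairVec e s k) x‖ ^ 2 -
      ‖inner ℂ (pairVec e (-s) k) x‖ ^ 2)) (inner ℂ (K x) x).re := by
  have hsum : Summable fun n => inner ℂ (e n) x • e n := by
    have := (he.orthogonalFamily.summable_iff_norm_sq_summable fun n => inner ℂ (e n) x).mpr
      (he.inner_products_summable x)
    simpa using this
  have hres : K (x - ∑' n, inner ℂ (e n) x • e n) = 0 := by
    refine hK _ fun m => ?_
    rw [inner_sub_right, sub_eq_zero]
    have h1 := (innerSL ℂ (e m)).hasSum hsum.hasSum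
    have h2 : HasSum (fun n => innerSL ℂ (e m) (inner ℂ (e n) x • e n)) (inner ℂ (e m) x) := by
      convert hasSum_ite_eq m (inner ℂ (e m) x) using 2 with n
      rw [innerSL_apply_apply, inner_smul_right, orthonormal_iff_ite.mp he]
      by_cases hmn : n = m
      · subst hmn; simp
      · simp [hmn, Ne.symm hmn]
    exact h2.unique h1
  have hKx : HasSum (fun n => K (inner ℂ (e n) x • e n)) (K x) := by
    have h1 := K.hasSum hsum.hasSum
    rw [map_sub, sub_eq_zero] at hres
    rwa [← hres] at h1
  have hre : HasSum (fun n => (inner ℂ (K (inner ℂ (e n) x • e n)) x).re) (inner ℂ (K x) x).re := by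
    have h1 := Complex.reCLM.hasSum ((innerSL ℂ x).hasSum hKx)
    have h2 : ∀ y : E, Complex.reCLM (innerSL ℂ x y) = (inner ℂ y x).re := fun y => by
      rw [innerSL_apply_apply, ← inner_conj_symm y x, Complex.conj_re, Complex.reCLM_apply]
    simpa only [h2] using h1
  have hnat := (hasSum_nat_add_iff' 1).mpr hre.nat_add_neg
  have hterm : ∀ n : ℤ, inner ℂ (K (inner ℂ (e n) x • e n)) x =
      (starRingEnd ℂ) (inner ℂ (e n) x) * inner ℂ (K (e n)) x := fun n => by
    rw [map_smul, inner_smul_left]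
  have hval : (inner ℂ (K x) x).re + (inner ℂ (K (inner ℂ (e 0) x • e 0)) x).re -
      ∑ i ∈ Finset.range 1, ((inner ℂ (K (inner ℂ (e i) x • e i)) x).re +
        (inner ℂ (K (inner ℂ (e (-i)) x • e (-i))) x).re) = (inner ℂ (K x) x).re := by
    simp only [Finset.range_one, Finset.sum_singleton, Nat.cast_zero, neg_zero, hterm, h0, mul_zero,
      Complex.zero_re]
    ring
  rw [hval] at hnat
  refine hnat.congr_fun fun k => ?_
  rw [norm_sq_inner_pairVec_sub, hterm, hterm, Nat.cast_succ, hpos, hneg]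
  have hak := has k
  generalize ‖a k‖ = m at hak ⊢
  rw [hak]
  simp only [map_mul, Complex.conj_ofReal, Complex.mul_re, Complex.mul_im, Complex.conj_re,
    Complex.conj_im, Complex.ofReal_re, Complex.ofReal_im]
  ring

end OrthonormalExpansion

section Primitive

/-- Modulo a polynomial of degree `l`, the truncated power convolved with `e^{ωs}`
is a multiple of `e^{ωy}`. -/
theorem exists_integral_pow_mul_exp {ω : ℂ} (hω : ω ≠ 0) (l : ℕ) :
    ∃ c : ℕ → ℂ, ∀ y : ℝ,
      ∫ s in (0 : ℝ)..y, ((y - s : ℝ) : ℂ) ^ l * Complex.exp (ω * s) =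
        l.factorial / ω ^ (l + 1) * Complex.exp (ω * y) +
          ∑ k ∈ Finset.range (l + 1), c k * (y : ℂ) ^ k := by
  induction l with
  | zero =>
    refine ⟨fun _ => -1 / ω, fun y => ?_⟩
    simp only [pow_zero, one_mul]
    rw [integral_exp_mul_complex hω]
    simp
    ring
  | succ l ih =>
    obtain ⟨c, hc⟩ := ih
    refine ⟨fun k => if k = l + 1 then -1 / ω else (l + 1) / ω * c k, fun y => ?_⟩
    have hparts := intervalIntegral.integral_mul_deriv_eq_deriv_mul (a := 0) (b := y)
      (u := fun s : ℝ => ((y - s : ℝ) : ℂ) ^ (l + 1))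
      (u' := fun s : ℝ => -((l + 1) * ((y - s : ℝ) : ℂ) ^ l))
      (v := fun s : ℝ => Complex.exp (ω * s) / ω) (v' := fun s : ℝ => Complex.exp (ω * s))
      (fun s _ => by
        have h1 : HasDerivAt (fun s : ℝ => ((y - s : ℝ) : ℂ)) (-1) s := by
          simpa using (((hasDerivAt_id s).const_sub y).ofReal_comp)
        refine (h1.pow (l + 1)).congr_deriv ?_
        push_cast [Nat.add_sub_cancel]; ring)
      (fun s _ => by
        have h1 : HasDerivAt (fun s : ℝ => ω * (s : ℂ)) ω s := by
          simpa using ((hasDerivAt_id s).ofReal_comp).const_mul ω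
        convert h1.cexp.div_const ω using 1
        field_simp)
      (by apply Continuous.intervalIntegrable; fun_prop)
      (by apply Continuous.intervalIntegrable; fun_prop)
    rw [hparts]
    have : ∫ s in (0 : ℝ)..y, -((l + 1) * ((y - s : ℝ) : ℂ) ^ l) * (Complex.exp (ω * s) / ω) =
        -((l + 1) / ω) * ∫ s in (0 : ℝ)..y, ((y - s : ℝ) : ℂ) ^ l * Complex.exp (ω * s) := by
      rw [← intervalIntegral.integral_const_mul]
      congr 1
      ext s
      ring
    have hsum : ∑ k ∈ Finset.range (l + 1),
        (if k = l + 1 then -1 / ω else (l + 1) / ω * c k) * (y : ℂ) ^ k =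
        (l + 1) / ω * ∑ k ∈ Finset.range (l + 1), c k * (y : ℂ) ^ k := by
      rw [Finset.mul_sum]
      refine Finset.sum_congr rfl fun k hk => ?_
      rw [if_neg (Finset.mem_range.mp hk).ne]
      ring
    rw [this, hc, Finset.sum_range_succ _ (l + 1), hsum, Nat.factorial_succ]
    beta_reduce
    rw [if_pos rfl]
    push_cast
    simp
    field_simp
    ring

theorem integral_sub_pow (l : ℕ) (y : ℝ) :
    ∫ s in (0 : ℝ)..y, ((y - s : ℝ) : ℂ) ^ l = (y : ℂ) ^ (l + 1) / (l + 1) := by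
  have h : ∫ s in (0 : ℝ)..y, (y - s) ^ l = y ^ (l + 1) / (l + 1) := by
    rw [intervalIntegral.integral_comp_sub_left (fun s => s ^ l), integral_pow]
    simp
  have h2 := congrArg (fun r : ℝ => (r : ℂ)) h
  simp only [← intervalIntegral.integral_ofReal] at h2
  exact_mod_cast h2

end Primitive

section TruncatedFunctions

theorem muP_restrict_Ioc (T : ℝ) : muP.restrict (Ioc 0 T) = volume.restrict (Ioc 0 T) := by
  rw [Measure.restrict_restrict measurableSet_Ioc, inter_eq_left.mpr]
  exact fun x hx => hx.1

theorem memLp_indicator_Ioc_of_continuous (T : ℝ) {F : ℝ → ℂ} (hF : Continuous F) :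
    MemLp ((Ioc 0 T).indicator F) 2 muP := by
  rw [memLp_indicator_iff_restrict measurableSet_Ioc, muP_restrict_Ioc]
  obtain ⟨C, hC⟩ := (isCompact_Icc (a := 0) (b := T)).exists_bound_of_continuousOn hF.continuousOn
  refine MemLp.of_bound hF.aestronglyMeasurable C ?_
  filter_upwards [ae_restrict_mem measurableSet_Ioc] with t ht
  exact hC t (Ioc_subset_Icc_self ht)

/-- The element of `L²(0, ∞)` that agrees with the continuous function `F` on `(0, T]` and
vanishes beyond `T`. -/
def cutLp (T : ℝ) (F : ℝ → ℂ) (hF : Continuous F) : HSp :=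
  (memLp_indicator_Ioc_of_continuous T hF).toLp _

theorem coeFn_cutLp (T : ℝ) {F : ℝ → ℂ} (hF : Continuous F) :
    (cutLp T F hF : ℝ → ℂ) =ᵐ[muP] (Ioc 0 T).indicator F :=
  MemLp.coeFn_toLp _

theorem inner_cutLp {T : ℝ} (hT : 0 ≤ T) {F : ℝ → ℂ} (hF : Continuous F) (u : HSp) :
    inner ℂ (cutLp T F hF) u = ∫ t in (0 : ℝ)..T, (starRingEnd ℂ) (F t) * u t := by
  rw [L2.inner_def, intervalIntegral.integral_of_le hT, ← muP_restrict_Ioc,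
    ← integral_indicator measurableSet_Ioc]
  refine integral_congr_ae ?_
  filter_upwards [coeFn_cutLp T hF] with t ht
  rw [ht]
  by_cases h : t ∈ Ioc 0 T <;> simp [h, mul_comm]

theorem inner_cutLp_cutLp {T : ℝ} (hT : 0 ≤ T) {F G : ℝ → ℂ} (hF : Continuous F)
    (hG : Continuous G) :
    inner ℂ (cutLp T F hF) (cutLp T G hG) = ∫ t in (0 : ℝ)..T, (starRingEnd ℂ) (F t) * G t := by
  rw [inner_cutLp hT hF, intervalIntegral.integral_of_le hT, intervalIntegral.integral_of_le hT,
    ← muP_restrict_Ioc]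
  refine integral_congr_ae ?_
  filter_upwards [ae_restrict_of_ae (coeFn_cutLp T hG), ae_restrict_mem measurableSet_Ioc] with t ht h
  rw [ht, indicator_of_mem h]

/-- The normalised exponentials `e^{2πint/T}/√T` on `(0, T]`. -/
def expLp (T : ℝ) (n : ℤ) : HSp :=
  cutLp T (fun t => ((√T)⁻¹ : ℝ) * Complex.exp (2 * Real.pi * Complex.I * n / T * t)) (by fun_prop)

theorem conj_exp_two_pi_mul (T : ℝ) (n : ℤ) (t : ℝ) :
    (starRingEnd ℂ) (Complex.exp (2 * Real.pi * Complex.I * n / T * t)) =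
      Complex.exp (2 * Real.pi * Complex.I * (-n : ℤ) / T * t) := by
  rw [← Complex.exp_conj]
  congr 1
  simp only [map_mul, map_div₀, Complex.conj_ofReal, Complex.conj_I, map_intCast, map_ofNat]
  push_cast
  ring

theorem orthonormal_expLp {T : ℝ} (hT : 0 < T) : Orthonormal ℂ (expLp T) := by
  rw [orthonormal_iff_ite]
  intro m n
  rw [expLp, expLp, inner_cutLp_cutLp hT.le]
  have hTc : (T : ℂ) ≠ 0 := by exact_mod_cast hT.ne'
  have h1 : ∀ t : ℝ, (starRingEnd ℂ) (((√T)⁻¹ : ℝ) *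
      Complex.exp (2 * Real.pi * Complex.I * m / T * t)) *
      (((√T)⁻¹ : ℝ) * Complex.exp (2 * Real.pi * Complex.I * n / T * t)) =
      (T : ℂ)⁻¹ * Complex.exp (2 * Real.pi * Complex.I * (n - m : ℤ) / T * t) := fun t => by
    have h2 : (((√T)⁻¹ : ℝ) : ℂ) * ((√T)⁻¹ : ℝ) = (T : ℂ)⁻¹ := by
      rw [← Complex.ofReal_mul, ← mul_inv, Real.mul_self_sqrt hT.le, Complex.ofReal_inv]
    have h3 : Complex.exp (2 * Real.pi * Complex.I * (n - m : ℤ) / T * t) =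
        Complex.exp (2 * Real.pi * Complex.I * (-m : ℤ) / T * t) *
          Complex.exp (2 * Real.pi * Complex.I * n / T * t) := by
      rw [← Complex.exp_add]
      congr 1
      push_cast
      ring
    rw [map_mul, conj_exp_two_pi_mul, Complex.conj_ofReal, h3, ← h2]
    ring
  simp only [h1, intervalIntegral.integral_const_mul]
  split_ifs with hmn
  · subst hmn
    simp [hTc]
  · have hnm : ((n - m : ℤ) : ℂ) ≠ 0 := by exact_mod_cast sub_ne_zero.mpr (Ne.symm hmn)
    have hpi : (Real.pi : ℂ) ≠ 0 := by exact_mod_cast Real.pi_ne_zero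
    rw [integral_exp_mul_complex (by
      refine div_ne_zero (mul_ne_zero (mul_ne_zero (mul_ne_zero two_ne_zero hpi)
        Complex.I_ne_zero) hnm) hTc)]
    rw [div_mul_cancel₀ _ hTc, mul_comm _ ((n - m : ℤ) : ℂ), Complex.exp_int_mul_two_pi_mul_I]
    simp

theorem ae_eq_zero_of_inner_expLp_eq_zero {T : ℝ} (hT : 0 < T) {u : HSp}
    (hu : ∀ n, inner ℂ (expLp T n) u = 0) : ∀ᵐ t ∂(volume.restrict (Ioc 0 T)), u t = 0 := by
  have hmem : MemLp u 2 (volume.restrict (Ioc 0 T)) := by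
    rw [← muP_restrict_Ioc]
    exact (Lp.memLp u).restrict _
  have hcoeff : ∀ n, fourierCoeffOn hT u n = 0 := fun n => by
    have h1 := hu n
    rw [expLp, inner_cutLp hT.le] at h1
    have h4 : ∀ t : ℝ, (starRingEnd ℂ) (((√T)⁻¹ : ℝ) *
        Complex.exp (2 * Real.pi * Complex.I * n / T * t)) * u t = ((√T)⁻¹ : ℝ) *
          (Complex.exp (2 * Real.pi * Complex.I * (-n : ℤ) / T * t) * u t) := fun t => by
      rw [map_mul, conj_exp_two_pi_mul, Complex.conj_ofReal, mul_assoc]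
    simp only [h4, intervalIntegral.integral_const_mul] at h1
    have h2 := (mul_eq_zero.mp h1).resolve_left (by
      simpa using (Real.sqrt_pos.mpr hT).ne')
    rw [fourierCoeffOn_eq_integral]
    have h3 : ∫ x in (0 : ℝ)..T, fourier (-n) (x : AddCircle (T - 0)) • u x = 0 := by
      rw [← h2]
      congr 1
      ext x
      rw [fourier_coe_apply, smul_eq_mul]
      congr 2
      push_cast
      rw [sub_zero]
      ring
    rw [h3, smul_zero]
  have hpars := hasSum_sq_fourierCoeffOn hT hmem
  simp only [hcoeff, norm_zero, ne_eq, OfNat.ofNat_ne_zero, not_false_eq_true, zero_pow] at hpars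
  have h_int := hpars.unique hasSum_zero
  have h_int' : ∫ x in Ioc 0 T, ‖u x‖ ^ 2 = 0 := by
    rw [intervalIntegral.integral_of_le hT.le, smul_eq_zero] at h_int
    refine h_int.resolve_left ?_
    simpa using hT.ne'
  rw [integral_eq_zero_iff_of_nonneg (fun _ => by positivity) hmem.integrable_norm_pow'] at h_int'
  filter_upwards [h_int'] with t ht
  simpa using ht

end TruncatedFunctions

section TruncatedPowerHankel

theorem cutLp_add (T : ℝ) {F G : ℝ → ℂ} (hF : Continuous F) (hG : Continuous G) :
    cutLp T (fun t => F t + G t) (hF.add hG) = cutLp T F hF + cutLp T G hG := by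
  rw [cutLp, cutLp, cutLp, ← MemLp.toLp_add]
  congr 1
  exact indicator_add ..

theorem cutLp_const_mul (T : ℝ) (c : ℂ) {F : ℝ → ℂ} (hF : Continuous F) :
    cutLp T (fun t => c * F t) (hF.const_mul c) = c • cutLp T F hF := by
  rw [cutLp, cutLp, ← MemLp.toLp_const_smul]
  congr 1
  exact Set.indicator_const_smul (Ioc 0 T) c F

/-- The function `(T - t)^k` on `(0, T]`. -/
def powLp (T : ℝ) (k : ℕ) : HSp :=
  cutLp T (fun t => ((T - t : ℝ) : ℂ) ^ k) (by fun_prop)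

theorem inner_cutLp_sum_pow_eq_zero {T : ℝ} (c : ℕ → ℂ) {m : ℕ} {x : HSp}
    (hx : ∀ k < m, inner ℂ (powLp T k) x = 0) :
    inner ℂ (cutLp T (fun t => ∑ k ∈ Finset.range m, c k * ((T - t : ℝ) : ℂ) ^ k)
      (by fun_prop)) x = 0 := by
  induction m with
  | zero =>
    have h := cutLp_const_mul T 0 (F := fun _ => 0) continuous_const
    simp only [zero_mul, zero_smul] at h
    simp only [Finset.range_zero, Finset.sum_empty, h, inner_zero_left]
  | succ m ih =>
    simp only [Finset.sum_range_succ]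
    rw [cutLp_add T (F := fun t => ∑ k ∈ Finset.range m, c k * ((T - t : ℝ) : ℂ) ^ k)
      (G := fun t => c m * ((T - t : ℝ) : ℂ) ^ m) (by fun_prop) (by fun_prop), inner_add_left,
      ih fun k hk => hx k (by omega),
      cutLp_const_mul T (c m) (F := fun t => ((T - t : ℝ) : ℂ) ^ m) (by fun_prop), inner_smul_left]
    have := hx m (by omega)
    rw [powLp] at this
    rw [this, mul_zero, add_zero]

variable {l : ℕ} {T h0 : ℝ} {h : ℝ → ℝ} {H : HSp →L[ℂ] HSp}

theorem hankel_eq_zero_of_ae_eq_zero (hh2 : ∀ t : ℝ, T < t → h t = 0)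
    (hH : IsHankel (fun t => ((h t : ℝ) : ℂ)) H) {u : HSp}
    (hu : ∀ᵐ t ∂(volume.restrict (Ioc 0 T)), u t = 0) : H u = 0 := by
  rw [Lp.eq_zero_iff_ae_eq_zero]
  rw [← muP_restrict_Ioc, ae_restrict_iff' measurableSet_Ioc] at hu
  filter_upwards [hH u, ae_restrict_mem measurableSet_Ioi] with t ht ht0
  rw [ht, Pi.zero_apply]
  refine integral_eq_zero_of_ae ?_
  filter_upwards [hu, ae_restrict_mem measurableSet_Ioi] with s hs hs0
  by_cases hsT : s ≤ T
  · simp [hs ⟨hs0, hsT⟩]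
  · have : T < t + s := by
      have := mem_Ioi.mp ht0
      linarith
    simp [hh2 _ this]

theorem hankel_cutLp (hh1 : ∀ t : ℝ, 0 < t → t ≤ T → h t = h0 * (T - t) ^ l)
    (hh2 : ∀ t : ℝ, T < t → h t = 0) (hH : IsHankel (fun t => ((h t : ℝ) : ℂ)) H)
    {F G : ℝ → ℂ} (hF : Continuous F) (hG : Continuous G)
    (hFG : ∀ t, h0 * ∫ s in (0 : ℝ)..(T - t), ((T - t - s : ℝ) : ℂ) ^ l * F s = G t) :
    H (cutLp T F hF) = cutLp T G hG := by
  refine Lp.ext ?_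
  filter_upwards [hH (cutLp T F hF), coeFn_cutLp T hG, ae_restrict_mem measurableSet_Ioi]
    with t ht hGt ht0
  rw [mem_Ioi] at ht0
  rw [ht, hGt]
  have hcongr : ∫ s in Ioi (0 : ℝ), ((h (t + s) : ℝ) : ℂ) * cutLp T F hF s =
      ∫ s in Ioi (0 : ℝ), (Ioc 0 (T - t)).indicator
        (fun s => h0 * (((T - t - s : ℝ) : ℂ) ^ l * F s)) s := by
    refine integral_congr_ae ?_
    filter_upwards [coeFn_cutLp T hF, ae_restrict_mem measurableSet_Ioi] with s hs hs0
    rw [mem_Ioi] at hs0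
    rw [hs]
    by_cases hsT : s ≤ T - t
    · rw [indicator_of_mem (show s ∈ Ioc 0 (T - t) from ⟨hs0, hsT⟩),
        indicator_of_mem (show s ∈ Ioc 0 T from ⟨hs0, by linarith⟩),
        hh1 _ (by linarith) (by linarith)]
      push_cast
      ring
    · rw [indicator_of_notMem (show s ∉ Ioc 0 (T - t) from fun hmem => hsT hmem.2),
        hh2 _ (by linarith)]
      simp
  rw [hcongr, setIntegral_indicator measurableSet_Ioc,
    inter_eq_right.mpr (Ioc_subset_Ioi_self : Ioc 0 (T - t) ⊆ Ioi 0)]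
  by_cases htT : t ≤ T
  · rw [indicator_of_mem (show t ∈ Ioc 0 T from ⟨ht0, htT⟩), ← hFG,
      intervalIntegral.integral_of_le (by linarith), integral_const_mul]
  · rw [indicator_of_notMem (show t ∉ Ioc 0 T from fun hmem => htT hmem.2),
      Ioc_eq_empty (by linarith)]
    simp

theorem inner_hankel_expLp_zero (hh1 : ∀ t : ℝ, 0 < t → t ≤ T → h t = h0 * (T - t) ^ l)
    (hh2 : ∀ t : ℝ, T < t → h t = 0) (hH : IsHankel (fun t => ((h t : ℝ) : ℂ)) H)
    {x : HSp} (hx : ∀ k < l + 2, inner ℂ (powLp T k) x = 0) :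
    inner ℂ (H (expLp T 0)) x = 0 := by
  have hc : Continuous fun t : ℝ => ((T - t : ℝ) : ℂ) ^ (l + 1) := by fun_prop
  rw [expLp, hankel_cutLp hh1 hh2 hH _
    (hc.const_mul (h0 * ((√T)⁻¹ : ℝ) / (l + 1))) (fun t => ?_),
    cutLp_const_mul _ _ hc, inner_smul_left]
  · have := hx (l + 1) (by omega)
    rw [powLp] at this
    rw [this, mul_zero]
  · simp only [Int.cast_zero, mul_zero, zero_div, zero_mul, Complex.exp_zero, mul_one]
    rw [intervalIntegral.integral_mul_const, integral_sub_pow]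
    ring

theorem inner_hankel_expLp (hT : 0 < T)
    (hh1 : ∀ t : ℝ, 0 < t → t ≤ T → h t = h0 * (T - t) ^ l)
    (hh2 : ∀ t : ℝ, T < t → h t = 0) (hH : IsHankel (fun t => ((h t : ℝ) : ℂ)) H)
    {x : HSp} (hx : ∀ k < l + 2, inner ℂ (powLp T k) x = 0) {n : ℤ} (hn : n ≠ 0) :
    inner ℂ (H (expLp T n)) x =
      (starRingEnd ℂ) (h0 * l.factorial / (2 * Real.pi * Complex.I * n / T) ^ (l + 1)) *
        inner ℂ (expLp T (-n)) x := by
  have hTc : (T : ℂ) ≠ 0 := by exact_mod_cast hT.ne'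
  have hω : 2 * Real.pi * Complex.I * n / T ≠ 0 :=
    div_ne_zero (mul_ne_zero Complex.two_pi_I_ne_zero (by exact_mod_cast hn)) hTc
  obtain ⟨c, hc⟩ := exists_integral_pow_mul_exp hω l
  set A : ℂ := h0 * l.factorial / (2 * Real.pi * Complex.I * n / T) ^ (l + 1) with hA
  have hE : Continuous fun t : ℝ => ((√T)⁻¹ : ℝ) *
      Complex.exp (2 * Real.pi * Complex.I * (-n : ℤ) / T * t) := by fun_prop
  have hP : Continuous fun t : ℝ => ∑ k ∈ Finset.range (l + 1),
      (h0 * ((√T)⁻¹ : ℝ) * c k) * ((T - t : ℝ) : ℂ) ^ k := by fun_prop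
  have hEP : Continuous fun t : ℝ => A * (((√T)⁻¹ : ℝ) *
      Complex.exp (2 * Real.pi * Complex.I * (-n : ℤ) / T * t)) +
      ∑ k ∈ Finset.range (l + 1), (h0 * ((√T)⁻¹ : ℝ) * c k) * ((T - t : ℝ) : ℂ) ^ k :=
    (hE.const_mul A).add hP
  rw [expLp, hankel_cutLp hh1 hh2 hH _ hEP (fun t => ?_),
    cutLp_add _ (hE.const_mul A) hP, cutLp_const_mul _ _ hE, inner_add_left, inner_smul_left,
    inner_cutLp_sum_pow_eq_zero _ (fun k hk => hx k (by omega)), add_zero, expLp]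
  have hexp : Complex.exp (2 * Real.pi * Complex.I * n / T * (T - t : ℝ)) =
      Complex.exp (2 * Real.pi * Complex.I * (-n : ℤ) / T * t) := by
    rw [← mul_one (Complex.exp (2 * Real.pi * Complex.I * (-n : ℤ) / T * t)),
      ← Complex.exp_int_mul_two_pi_mul_I n, ← Complex.exp_add]
    congr 1
    push_cast
    field_simp
    ring
  have hsum : ∑ k ∈ Finset.range (l + 1), h0 * ((√T)⁻¹ : ℝ) * c k * ((T - t : ℝ) : ℂ) ^ k =
      h0 * ((√T)⁻¹ : ℝ) * ∑ k ∈ Finset.range (l + 1), c k * ((T - t : ℝ) : ℂ) ^ k := by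
    rw [Finset.mul_sum]
    exact Finset.sum_congr rfl fun k _ => by ring
  rw [hsum]
  have h_int : ∫ s in (0 : ℝ)..(T - t), ((T - t - s : ℝ) : ℂ) ^ l *
      (((√T)⁻¹ : ℝ) * Complex.exp (2 * Real.pi * Complex.I * n / T * s)) =
      ((√T)⁻¹ : ℝ) * ∫ s in (0 : ℝ)..(T - t), ((T - t - s : ℝ) : ℂ) ^ l *
        Complex.exp (2 * Real.pi * Complex.I * n / T * s) := by
    rw [← intervalIntegral.integral_const_mul]
    congr 1
    ext s
    ring
  rw [h_int, hc, hexp, hA]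
  ring

/-- On the complement of polynomials of degree at most `l + 1`, the quadratic form of the Hankel
operator is diagonalised by combinations of the exponentials with opposite frequencies. -/
theorem exists_hasSum_re_inner_hankel (hT : 0 < T)
    (hh1 : ∀ t : ℝ, 0 < t → t ≤ T → h t = h0 * (T - t) ^ l)
    (hh2 : ∀ t : ℝ, T < t → h t = 0) (hH : IsHankel (fun t => ((h t : ℝ) : ℂ)) H) :
    ∃ s : ℕ → ℂ, (∀ k, ‖s k‖ = 1) ∧
      ∀ x : HSp, (∀ i : Fin (l + 2), inner ℂ (powLp T i) x = 0) →
        HasSum (fun k : ℕ =>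
          |h0| * l.factorial * (2 * Real.pi) ^ (-(l : ℝ) - 1) * T ^ (l + 1) / (k + 1 : ℝ) ^ (l + 1) *
          (‖inner ℂ (pairVec (expLp T) s k) x‖ ^ 2 - ‖inner ℂ (pairVec (expLp T) (-s) k) x‖ ^ 2))
          (inner ℂ (H x) x).re := by
  set a : ℕ → ℂ := fun k =>
    h0 * l.factorial / (2 * Real.pi * Complex.I * (k + 1) / T) ^ (l + 1) with ha
  have hnorm : ∀ k, ‖a k‖ =
      |h0| * l.factorial * (2 * Real.pi) ^ (-(l : ℝ) - 1) * T ^ (l + 1) / (k + 1 : ℝ) ^ (l + 1) := by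
    intro k
    have hk : ‖(k + 1 : ℂ)‖ = k + 1 := by
      rw [← Nat.cast_succ, Complex.norm_natCast, Nat.cast_succ]
    have hpow : (2 * Real.pi) ^ (-(l : ℝ) - 1) = ((2 * Real.pi) ^ (l + 1))⁻¹ := by
      rw [show (-(l : ℝ) - 1) = -((l + 1 : ℕ) : ℝ) by push_cast; ring,
        Real.rpow_neg (by positivity), Real.rpow_natCast]
    rw [ha, hpow]
    simp only [norm_div, norm_mul, norm_pow, hk, Complex.norm_real, Complex.norm_natCast,
      Complex.norm_I, Complex.norm_ofNat, Real.norm_eq_abs, abs_of_pos Real.pi_pos, abs_of_pos hT,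
      mul_one]
    rw [div_pow, mul_pow (2 * Real.pi)]
    field_simp
  refine ⟨fun k => Complex.exp (Complex.arg (a k) * Complex.I),
    fun k => Complex.norm_exp_ofReal_mul_I _, fun x hx => ?_⟩
  have hx' : ∀ k < l + 2, inner ℂ (powLp T k) x = 0 := fun k hk => hx ⟨k, hk⟩
  have hmain := hasSum_re_inner_of_orthonormal (orthonormal_expLp hT) (K := H) (a := a)
    (s := fun k => Complex.exp (Complex.arg (a k) * Complex.I)) (x := x)
    (fun y hy => hankel_eq_zero_of_ae_eq_zero hh2 hH (ae_eq_zero_of_inner_expLp_eq_zero hT hy))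
    (fun k => (Complex.norm_mul_exp_arg_mul_I (a k)).symm)
    (inner_hankel_expLp_zero hh1 hh2 hH hx')
    (fun k => by
      rw [inner_hankel_expLp hT hh1 hh2 hH hx' (by omega), ha]
      push_cast
      rfl)
    (fun k => by
      rw [inner_hankel_expLp hT hh1 hh2 hH hx' (by omega), ha, neg_neg]
      congr 1
      simp only [map_div₀, map_mul, map_pow, Complex.conj_ofReal, Complex.conj_I, map_natCast,
        map_intCast, map_ofNat]
      push_cast
      congr 2
      ring)
  simpa only [hnorm] using hmain

theorem isBigO_posEig_sub_of_hasSum (hT : 0 < T) {s : ℕ → ℂ} (hs : ∀ k, ‖s k‖ = 1) {C : ℝ}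
    (hC : 0 ≤ C) {K : HSp →L[ℂ] HSp}
    (hK : ∀ x : HSp, (∀ i : Fin (l + 2), inner ℂ (powLp T i) x = 0) →
      HasSum (fun k : ℕ => C / (k + 1 : ℝ) ^ (l + 1) *
        (‖inner ℂ (pairVec (expLp T) s k) x‖ ^ 2 - ‖inner ℂ (pairVec (expLp T) (-s) k) x‖ ^ 2))
        (inner ℂ (K x) x).re) :
    (fun n : ℕ => posEig K n - C * (n : ℝ) ^ (-(l : ℝ) - 1)) =O[atTop]
      fun n : ℕ => (n : ℝ) ^ (-(l : ℝ) - 2) := by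
  have hanti : Antitone fun k : ℕ => C / (k + 1 : ℝ) ^ (l + 1) := fun i j hij => by
    have : (i : ℝ) ≤ j := by exact_mod_cast hij
    dsimp only
    gcongr
  have hon := orthonormal_expLp hT
  have horth : ∀ i j, inner ℂ (pairVec (expLp T) (-s) i) (pairVec (expLp T) s j) = 0 :=
    fun i j => by
      rw [inner_pairVec_pairVec hon, Pi.neg_apply, map_neg, neg_mul, Complex.conj_mul', hs]
      simp
  refine isBigO_sub_of_shifted_bounds hC l (l + 2) (fun n hn => ?_) fun n => ?_
  · exact le_posEig_of_hasSum (p := fun i : Fin (l + 2) => powLp T i)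
      (orthonormal_pairVec hon hs) horth hanti hK hn
  · exact posEig_le_of_hasSum (p := fun i : Fin (l + 2) => powLp T i)
      (orthonormal_pairVec hon hs) hanti (fun k => by positivity) hK n

end TruncatedPowerHankel

/-- Theorem `power` of the paper.  For the kernel `h(t) = h₀ (t₀ - t)^l`
for `t ≤ t₀` and `h(t) = 0` for `t > t₀`, the eigenvalues of the Hankel operator `H` satisfy
`λₙ^±(H) = |h₀| l! (2π)^{-l-1} t₀^{l+1} n^{-l-1} (1 + O(n⁻¹))` as `n → ∞`. -/
theorem statement11 (l : ℕ) (t0 h0 : ℝ) (ht0 : 0 < t0)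
    (h : ℝ → ℝ)
    (hh1 : ∀ t : ℝ, 0 < t → t ≤ t0 → h t = h0 * (t0 - t) ^ l)
    (hh2 : ∀ t : ℝ, t0 < t → h t = 0)
    (H : HSp →L[ℂ] HSp) (hH : IsHankel (fun t => ((h t : ℝ) : ℂ)) H) :
    ((fun nn : ℕ => posEig H nn -
        |h0| * (Nat.factorial l : ℝ) * (2*Real.pi) ^ (-(l:ℝ) - 1) * t0 ^ (l+1) *
          (nn:ℝ) ^ (-(l:ℝ) - 1))
      =O[atTop] fun nn : ℕ => (nn:ℝ) ^ (-(l:ℝ) - 2)) ∧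
    ((fun nn : ℕ => negEig H nn -
        |h0| * (Nat.factorial l : ℝ) * (2*Real.pi) ^ (-(l:ℝ) - 1) * t0 ^ (l+1) *
          (nn:ℝ) ^ (-(l:ℝ) - 1))
      =O[atTop] fun nn : ℕ => (nn:ℝ) ^ (-(l:ℝ) - 2)) := by
  obtain ⟨s, hs, hsum⟩ := exists_hasSum_re_inner_hankel ht0 hh1 hh2 hH
  have hC : 0 ≤ |h0| * (Nat.factorial l : ℝ) * (2*Real.pi) ^ (-(l:ℝ) - 1) * t0 ^ (l+1) := by
    positivity
  refine ⟨isBigO_posEig_sub_of_hasSum ht0 hs hC hsum,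
    isBigO_posEig_sub_of_hasSum (s := -s) (K := -H) ht0 (by simpa using hs) hC fun x hx => ?_⟩
  have hneg := (hsum x hx).neg
  rw [neg_neg, neg_apply, inner_neg_left, Complex.neg_re]
  refine hneg.congr_fun fun k => ?_
  ring
end
end
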